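/- Let S be a self-homeomorphism of a compact metric space Y that satisfies (1) almost weak specification, (2) asymptotic entropy expansiveness, and (3) the small boundary property. Then (Y, S) is fully universal: every invertible ergodic measure-preserving transformation T of a non-atomic Lebesgue probability space (X, μ) with h_μ(T) < h_top(S) embeds into (Y, S) via a measurable equivariant injection (mod null sets) whose push-forward measure is fully supported on Y. -/

import Mathlib

open MeasureTheory Filter Set
open scoped ENNReal

/-- Shannon entropy of the finite-valued observable `P` with respect to `μ`. -/
noncomputable def infoEntropy {X : Type*} [MeasurableSpace X] (μ : Measure X)
    {α : Type*} [Fintype α] (P : X → α) : ℝ :=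
  ∑ a : α, Real.negMulLog (μ (P ⁻¹' {a})).toReal

/-- Entropy of the transformation `T` with respect to the observable (finite partition) `P`. -/
noncomputable def entropyWrt {X : Type*} [MeasurableSpace X] (μ : Measure X) (T : X → X)
    {α : Type*} [Fintype α] (P : X → α) : ℝ :=
  Filter.atTop.liminf fun n : ℕ =>
    infoEntropy μ (fun x => fun i : Fin n => P (T^[(i : ℕ)] x)) / n

/-- Kolmogorov–Sinai (measure-theoretic) entropy of `T` with respect to `μ`. -/
noncomputable def ksEntropy {X : Type*} [MeasurableSpace X] (μ : Measure X) (T : X → X) : ℝ≥0∞ :=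
  ⨆ (k : ℕ) (P : X → Fin k) (_ : Measurable P), ENNReal.ofReal (entropyWrt μ T P)

/-- Topological entropy (Bowen–Dinaburg, via dynamical covers). -/
noncomputable def topEntropy {Y : Type*} [UniformSpace Y] (S : Y → Y) : EReal :=
  Dynamics.coverEntropy S Set.univ

/-- `Ψ` is an embedding of the measure-preserving system `(X, μ, T)` into `(Y, S)`. -/
def IsMeasEmbedding {X Y : Type*} [MeasurableSpace X] [MeasurableSpace Y]
    (μ : Measure X) (T : X → X) (S : Y → Y) (Ψ : X → Y) : Prop :=
  Measurable Ψ ∧ ∃ X' : Set X, MeasurableSet X' ∧ μ X'ᶜ = 0 ∧ Set.InjOn Ψ X' ∧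
    ∀ x ∈ X', Ψ (T x) = S (Ψ x)

/-- A measure on a topological space has full support. -/
def FullSupport {Y : Type*} [TopologicalSpace Y] [MeasurableSpace Y] (ν : Measure Y) : Prop :=
  ∀ U : Set Y, IsOpen U → U.Nonempty → 0 < ν U

/-- `(Y, S)` is fully universal. -/
def FullyUniversal {Y : Type*} [UniformSpace Y] [MeasurableSpace Y] (S : Y → Y) : Prop :=
  ∀ (X : Type) [MeasurableSpace X] (μ : Measure X) (T : X ≃ᵐ X),
    StandardBorelSpace X → IsProbabilityMeasure μ → NoAtoms μ → Ergodic (⇑T) μ →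
    (ksEntropy μ (⇑T) : EReal) < topEntropy S →
    ∃ Ψ : X → Y, IsMeasEmbedding μ (⇑T) S Ψ ∧ FullSupport (μ.map Ψ)

/-- `L` is a gap function for the invertible system `S` at scale `ε`. -/
def IsGapFunction {Y : Type*} [MetricSpace Y] (S : Y ≃ Y) (ε : ℝ) (L : ℕ → ℕ) : Prop :=
  Monotone L ∧ (∀ m, 0 < L m) ∧
    ∀ (n : ℕ) (y : Fin n → Y) (a b : Fin n → ℤ),
      (∀ i, a i ≤ b i) →
      (∀ i j : Fin n, (i : ℕ) + 1 = (j : ℕ) → (L (b j - a j).toNat : ℤ) ≤ a j - b i) →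
      ∃ z : Y, ∀ (i : Fin n) (k : ℤ), a i ≤ k → k ≤ b i →
        dist ((S ^ k) z) ((S ^ k) (y i)) ≤ ε

/-- Almost weak specification: for every `ε > 0` there is a sublinear gap function. -/
def AlmostWeakSpec {Y : Type*} [MetricSpace Y] (S : Y ≃ Y) : Prop :=
  ∀ ε : ℝ, 0 < ε → ∃ L : ℕ → ℕ, IsGapFunction S ε L ∧
    Filter.Tendsto (fun m : ℕ => (L m : ℝ) / m) Filter.atTop (nhds 0)

/-- The set `Γ_δ(x)` of points whose forward orbit stays `δ`-close to that of `x`. -/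
def gammaSet {Y : Type*} [MetricSpace Y] (S : Y → Y) (δ : ℝ) (x : Y) : Set Y :=
  {y | ∀ j : ℕ, dist (S^[j] x) (S^[j] y) < δ}

/-- Asymptotic entropy expansiveness: `sup_x h_top(S, Γ_δ(x)) → 0` as `δ → 0⁺`. -/
def AsympEntropyExpansive {Y : Type*} [MetricSpace Y] (S : Y → Y) : Prop :=
  Filter.Tendsto (fun δ : ℝ => ⨆ x : Y, Dynamics.coverEntropy S (gammaSet S δ x))
    (nhdsWithin 0 (Set.Ioi 0)) (nhds (0 : EReal))

/-- A finite measurable partition of the whole space. -/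
def IsFinPartition {Y : Type*} [MeasurableSpace Y] (P : Finset (Set Y)) : Prop :=
  (∀ s ∈ P, MeasurableSet s) ∧ ⋃₀ (P : Set (Set Y)) = Set.univ ∧
    (P : Set (Set Y)).Pairwise (Disjoint · ·)

/-- The small boundary property: finite measurable partitions of arbitrarily small diameter
whose boundaries are null for every `S`-invariant Borel probability measure. -/
def SmallBoundaryProperty {Y : Type*} [MetricSpace Y] [MeasurableSpace Y] (S : Y → Y) : Prop :=
  ∀ δ : ℝ, 0 < δ → ∃ P : Finset (Set Y), IsFinPartition P ∧
    (∀ s ∈ P, Metric.diam s < δ) ∧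
    ∀ ν : Measure Y, IsProbabilityMeasure ν → MeasurePreserving S ν ν →
      ν (⋃ s ∈ P, frontier s) = 0

set_option linter.unusedSectionVars false

namespace Universality

/-- `P` is measurable for the discrete σ-algebra on its range. -/
def IsObs {X α : Type*} [MeasurableSpace X] (P : X → α) : Prop :=
  ∀ s : Set α, MeasurableSet (P ⁻¹' s)

/-- The name of length `n` of a point with respect to an observable. -/
def name {X α : Type*} (T : X → X) (P : X → α) (n : ℕ) (x : X) : Fin n → α :=
  fun i => P (T^[(i : ℕ)] x)

section Observables

variable {X α β : Type*} [MeasurableSpace X]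

lemma IsObs.comp {P : X → α} (hP : IsObs P) (f : α → β) : IsObs (fun x => f (P x)) :=
  fun s => hP (f ⁻¹' s)

lemma IsObs.comp_right {P : X → α} (hP : IsObs P) {T : X → X} (hT : Measurable T) :
    IsObs (fun x => P (T x)) :=
  fun s => hT (hP s)

lemma isObs_of_singleton [Countable α] {P : X → α} (h : ∀ a, MeasurableSet (P ⁻¹' {a})) :
    IsObs P := by
  intro s
  have : P ⁻¹' s = ⋃ a ∈ s, P ⁻¹' {a} := by ext x; simp
  rw [this]
  exact MeasurableSet.biUnion (Set.to_countable s) fun a _ => h a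

lemma IsObs.pair [Countable α] [Countable β] {P : X → α} {Q : X → β} (hP : IsObs P)
    (hQ : IsObs Q) : IsObs (fun x => (P x, Q x)) := by
  refine isObs_of_singleton fun ⟨a, b⟩ => ?_
  have : (fun x => (P x, Q x)) ⁻¹' {(a, b)} = P ⁻¹' {a} ∩ Q ⁻¹' {b} := by ext x; simp
  rw [this]
  exact (hP _).inter (hQ _)

lemma isObs_pi {ι : Type*} [Finite ι] [Finite α] {P : ι → X → α} (hP : ∀ i, IsObs (P i)) :
    IsObs (fun x i => P i x) := by
  refine isObs_of_singleton fun a => ?_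
  have : (fun x i => P i x) ⁻¹' {a} = ⋂ i, P i ⁻¹' {a i} := by ext x; simp [funext_iff]
  rw [this]
  exact MeasurableSet.iInter fun i => hP i _

lemma IsObs.name [Finite α] {P : X → α} (hP : IsObs P) {T : X → X} (hT : Measurable T) (n : ℕ) :
    IsObs (name T P n) :=
  isObs_pi fun i => hP.comp_right (hT.iterate i)

lemma IsObs.measurable [MeasurableSpace α] {P : X → α} (hP : IsObs P) : Measurable P :=
  fun s _ => hP s

end Observables

section Entropy

variable {X : Type*} [MeasurableSpace X] {μ : Measure X} [IsProbabilityMeasure μ]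
variable {α β γ : Type*} [Fintype α] [Fintype β] [Fintype γ]

lemma infoEntropy_eq (P : X → α) :
    infoEntropy μ P = ∑ a, Real.negMulLog (μ.real (P ⁻¹' {a})) := rfl

lemma infoEntropy_nonneg (P : X → α) : 0 ≤ infoEntropy μ P :=
  Finset.sum_nonneg fun _ _ => Real.negMulLog_nonneg measureReal_nonneg measureReal_le_one

lemma real_preimage_comp [DecidableEq β] {P : X → α} (hP : IsObs P) (f : α → β) (b : β) :
    μ.real ((fun x => f (P x)) ⁻¹' {b}) =
      ∑ a ∈ Finset.univ.filter (fun a => f a = b), μ.real (P ⁻¹' {a}) := by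
  have : (fun x => f (P x)) ⁻¹' {b} =
      ⋃ a ∈ Finset.univ.filter (fun a => f a = b), P ⁻¹' {a} := by ext x; simp
  rw [this, measureReal_biUnion_finset]
  · intro a _ b _ hab
    exact Disjoint.preimage _ (by simpa using hab)
  · exact fun a _ => hP _

lemma sum_real_preimage {P : X → α} (hP : IsObs P) : ∑ a, μ.real (P ⁻¹' {a}) = 1 := by
  have := real_preimage_comp (μ := μ) hP (fun _ => ()) ()
  simp at this
  exact this.symm

lemma infoEntropy_comp_le {P : X → α} (hP : IsObs P) (f : α → β) :
    infoEntropy μ (fun x => f (P x)) ≤ infoEntropy μ P := by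
  classical
  rw [infoEntropy_eq, infoEntropy_eq, ← Finset.sum_fiberwise Finset.univ f]
  refine Finset.sum_le_sum fun b _ => ?_
  rw [real_preimage_comp hP, Real.negMulLog, neg_mul, Finset.sum_mul, ← Finset.sum_neg_distrib]
  refine Finset.sum_le_sum fun a ha => ?_
  rw [Real.negMulLog, neg_mul, neg_le_neg_iff]
  rcases (measureReal_nonneg (μ := μ) (s := P ⁻¹' {a})).eq_or_lt with h | h
  · simp [← h]
  · refine mul_le_mul_of_nonneg_left (Real.log_le_log h ?_) h.le
    exact Finset.single_le_sum (f := fun a => μ.real (P ⁻¹' {a}))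
      (fun _ _ => measureReal_nonneg) ha

lemma infoEntropy_le_of_factor {P : X → α} {Q : X → β} (hQ : IsObs Q)
    (h : ∀ x y, Q x = Q y → P x = P y) : infoEntropy μ P ≤ infoEntropy μ Q := by
  have hX : Nonempty X := nonempty_of_isProbabilityMeasure μ
  have : Nonempty α := hX.map P
  have hf : P = fun x => (Function.extend Q P fun _ => Classical.arbitrary α) (Q x) := by
    funext x
    exact (Function.FactorsThrough.extend_apply (fun x y hxy => h x y hxy) _ x).symm
  rw [hf]
  exact infoEntropy_comp_le hQ _

lemma infoEntropy_comp_mp {P : X → α} (hP : IsObs P) {T : X → X} (hT : MeasurePreserving T μ μ) :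
    infoEntropy μ (fun x => P (T x)) = infoEntropy μ P := by
  refine Finset.sum_congr rfl fun a _ => ?_
  have : (fun x => P (T x)) ⁻¹' {a} = T ⁻¹' (P ⁻¹' {a}) := rfl
  rw [this, hT.measure_preimage (hP _).nullMeasurableSet]

lemma infoEntropy_pair_le {P : X → α} {Q : X → β} (hP : IsObs P) (hQ : IsObs Q) :
    infoEntropy μ (fun x => (P x, Q x)) ≤ infoEntropy μ P + infoEntropy μ Q := by
  classical
  set r : α × β → ℝ := fun c => μ.real ((fun x => (P x, Q x)) ⁻¹' {c}) with hr
  set p : α → ℝ := fun a => μ.real (P ⁻¹' {a}) with hp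
  set q : β → ℝ := fun b => μ.real (Q ⁻¹' {b}) with hq
  have hPQ := hP.pair hQ
  have rp : ∀ a, p a = ∑ b, r (a, b) := by
    intro a
    have := real_preimage_comp (μ := μ) hPQ Prod.fst a
    simp only [hp]
    rw [this, Finset.sum_filter, Fintype.sum_prod_type_right]
    refine Finset.sum_congr rfl fun b _ => ?_
    simp [hr]
  have rq : ∀ b, q b = ∑ a, r (a, b) := by
    intro b
    have := real_preimage_comp (μ := μ) hPQ Prod.snd b
    simp only [hq]
    rw [this, Finset.sum_filter, Fintype.sum_prod_type]
    refine Finset.sum_congr rfl fun b _ => ?_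
    simp [hr]
  have r0 : ∀ c, 0 ≤ r c := fun c => measureReal_nonneg
  have hle1 : ∀ a b, r (a, b) ≤ p a := fun a b => by
    rw [rp]; exact Finset.single_le_sum (f := fun b => r (a, b)) (fun _ _ => r0 _)
      (Finset.mem_univ b)
  have hle2 : ∀ a b, r (a, b) ≤ q b := fun a b => by
    rw [rq]; exact Finset.single_le_sum (f := fun a => r (a, b)) (fun _ _ => r0 _)
      (Finset.mem_univ a)
  have key : ∀ a b, Real.negMulLog (r (a, b)) ≤
      r (a, b) * (-Real.log (p a)) + r (a, b) * (-Real.log (q b)) + (p a * q b - r (a, b)) := by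
    intro a b
    rcases (r0 (a, b)).eq_or_lt with h | h
    · rw [← h]
      simp
      exact mul_nonneg measureReal_nonneg measureReal_nonneg
    · have hpa := h.trans_le (hle1 a b)
      have hqb := h.trans_le (hle2 a b)
      have := Real.log_le_sub_one_of_pos (x := p a * q b / r (a, b)) (by positivity)
      rw [Real.log_div (by positivity) h.ne', Real.log_mul hpa.ne' hqb.ne'] at this
      have h2 := mul_le_mul_of_nonneg_left this h.le
      have h3 : r (a, b) * (p a * q b / r (a, b) - 1) = p a * q b - r (a, b) := by
        field_simp
      rw [h3] at h2
      rw [Real.negMulLog]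
      linarith
  have sp : ∑ a, p a = 1 := sum_real_preimage hP
  have sq : ∑ b, q b = 1 := sum_real_preimage hQ
  have sr : ∑ a, ∑ b, r (a, b) = 1 := by rw [← sp]; exact Finset.sum_congr rfl fun a _ => (rp a).symm
  calc infoEntropy μ (fun x => (P x, Q x)) = ∑ a, ∑ b, Real.negMulLog (r (a, b)) := by
        rw [infoEntropy_eq, Fintype.sum_prod_type]
    _ ≤ ∑ a, ∑ b, (r (a, b) * (-Real.log (p a)) + r (a, b) * (-Real.log (q b)) +
          (p a * q b - r (a, b))) :=
        Finset.sum_le_sum fun a _ => Finset.sum_le_sum fun b _ => key a b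
    _ = (∑ a, ∑ b, r (a, b) * (-Real.log (p a))) + (∑ a, ∑ b, r (a, b) * (-Real.log (q b))) +
          ((∑ a, ∑ b, p a * q b) - ∑ a, ∑ b, r (a, b)) := by
        simp only [Finset.sum_add_distrib, Finset.sum_sub_distrib]
    _ = infoEntropy μ P + infoEntropy μ Q := by
        rw [sr, ← Finset.sum_mul_sum, sp, sq, Finset.sum_comm (f := fun a b => r (a, b) *
          (-Real.log (q b)))]
        simp only [← Finset.sum_mul, ← rp, ← rq, infoEntropy_eq, Real.negMulLog]
        simp only [mul_neg, neg_mul, mul_one, sub_self, add_zero]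
        rfl

lemma infoEntropy_pair_le_of_factor {P : X → α} {Q : X → β} {R : X → γ} (hP : IsObs P)
    (hQ : IsObs Q) (h : ∀ x y, P x = P y → Q x = Q y → R x = R y) :
    infoEntropy μ R ≤ infoEntropy μ P + infoEntropy μ Q :=
  (infoEntropy_le_of_factor (hP.pair hQ) fun x y hxy =>
    h x y (congrArg Prod.fst hxy) (congrArg Prod.snd hxy)).trans (infoEntropy_pair_le hP hQ)

lemma name_eq_iff {T : X → X} {P : X → α} {n : ℕ} {x y : X} :
    name T P n x = name T P n y ↔ ∀ i < n, P (T^[i] x) = P (T^[i] y) := by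
  rw [funext_iff]
  exact ⟨fun h i hi => h ⟨i, hi⟩, fun h i => h i i.2⟩

lemma infoEntropy_name_add_le {T : X → X} (hT : MeasurePreserving T μ μ) {P : X → α}
    (hP : IsObs P) (m n : ℕ) :
    infoEntropy μ (name T P (m + n)) ≤ infoEntropy μ (name T P m) + infoEntropy μ (name T P n) := by
  classical
  have hTn := hT.iterate m
  rw [← infoEntropy_comp_mp (hP.name hT.measurable n) hTn]
  refine infoEntropy_pair_le_of_factor (hP.name hT.measurable m)
    ((hP.name hT.measurable n).comp_right hTn.measurable) fun x y h1 h2 => ?_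
  rw [name_eq_iff] at *
  intro i hi
  by_cases him : i < m
  · exact h1 i him
  · have := h2 (i - m) (by omega)
    rwa [← Function.iterate_add_apply, ← Function.iterate_add_apply,
      Nat.sub_add_cancel (by omega)] at this

lemma infoEntropy_name_le {T : X → X} (hT : MeasurePreserving T μ μ) {P : X → α}
    (hP : IsObs P) (m : ℕ) :
    infoEntropy μ (name T P m) ≤ m * infoEntropy μ P := by
  classical
  induction m with
  | zero =>
    have : infoEntropy μ (name T P 0) ≤ infoEntropy μ (fun _ : X => ()) :=
      infoEntropy_le_of_factor (fun s => MeasurableSet.const (() ∈ s)) fun x y _ => Subsingleton.elim _ _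
    simpa [infoEntropy] using this
  | succ m ih =>
    have h1 : infoEntropy μ (name T P 1) ≤ infoEntropy μ P :=
      infoEntropy_le_of_factor hP fun x y h => by
        rw [name_eq_iff]; intro i hi; interval_cases i; exact h
    have := infoEntropy_name_add_le hT hP m 1
    push_cast
    linarith

lemma entropyWrt_eq_liminf {T : X → X} {P : X → α} :
    entropyWrt μ T P = atTop.liminf fun n : ℕ => infoEntropy μ (name T P n) / n := rfl

lemma infoEntropy_name_div_le {T : X → X} (hT : MeasurePreserving T μ μ) {P : X → α}
    (hP : IsObs P) (n : ℕ) : infoEntropy μ (name T P n) / n ≤ infoEntropy μ P := by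
  rcases Nat.eq_zero_or_pos n with rfl | hn
  · simpa using infoEntropy_nonneg P
  · rw [div_le_iff₀ (by positivity), mul_comm]
    exact infoEntropy_name_le hT hP n

lemma frequently_of_entropyWrt_lt {T : X → X} (hT : MeasurePreserving T μ μ) {P : X → α}
    (hP : IsObs P) {c : ℝ} (h : entropyWrt μ T P < c) :
    ∃ᶠ n : ℕ in atTop, 0 < n ∧ infoEntropy μ (name T P n) < n * c := by
  have h1 : ∃ᶠ n : ℕ in atTop, infoEntropy μ (name T P n) / n < c := by
    refine Filter.frequently_lt_of_liminf_lt ?_ (by rwa [entropyWrt_eq_liminf] at h)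
    exact (isBoundedUnder_of ⟨infoEntropy μ P, fun n => infoEntropy_name_div_le hT hP n⟩).isCoboundedUnder_ge
  refine (h1.and_eventually (eventually_gt_atTop 0)).mono fun n ⟨hn, hn0⟩ => ⟨hn0, ?_⟩
  rwa [div_lt_iff₀ (by positivity), mul_comm] at hn

lemma eventually_of_lt_entropyWrt {T : X → X} {P : X → α} {c : ℝ} (h : c < entropyWrt μ T P) :
    ∀ᶠ n : ℕ in atTop, n * c ≤ infoEntropy μ (name T P n) := by
  have h1 : ∀ᶠ n : ℕ in atTop, c < infoEntropy μ (name T P n) / n := by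
    refine Filter.eventually_lt_of_lt_liminf (by rwa [entropyWrt_eq_liminf] at h) ?_
    exact isBoundedUnder_of ⟨0, fun n => div_nonneg (infoEntropy_nonneg _) (Nat.cast_nonneg _)⟩
  refine (h1.and (eventually_gt_atTop 0)).mono fun n ⟨hn, hn0⟩ => ?_
  rw [lt_div_iff₀ (by positivity), mul_comm] at hn
  exact hn.le

/-- An observable that takes one value with probability close to one has small entropy. -/
lemma exists_small_entropy (α : Type*) [Fintype α] (a₀ : α) {κ : ℝ} (hκ : 0 < κ) :
    ∃ δ > 0, ∀ {X : Type*} [MeasurableSpace X] (μ : Measure X) [IsProbabilityMeasure μ]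
      (Z : X → α), IsObs Z → μ.real {x | Z x ≠ a₀} ≤ δ → infoEntropy μ Z ≤ κ := by
  classical
  set κ' := κ / (Fintype.card α + 1) with hκ'
  have hκ'0 : 0 < κ' := by positivity
  have c0 := Metric.continuousAt_iff.1 (Real.continuous_negMulLog.continuousAt (x := 0)) κ' hκ'0
  have c1 := Metric.continuousAt_iff.1 (Real.continuous_negMulLog.continuousAt (x := 1)) κ' hκ'0
  obtain ⟨d0, hd0, h0⟩ := c0
  obtain ⟨d1, hd1, h1⟩ := c1
  refine ⟨min d0 d1 / 2, by positivity, fun {X} _ μ _ Z hZ hδ => ?_⟩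
  have hlt : min d0 d1 / 2 < min d0 d1 := half_lt_self (by positivity)
  have key : ∀ a, Real.negMulLog (μ.real (Z ⁻¹' {a})) ≤ κ' := by
    intro a
    by_cases ha : a = a₀
    · subst ha
      have hc : (Z ⁻¹' {a})ᶜ = {x | Z x ≠ a} := by ext; simp
      have h2 : μ.real (Z ⁻¹' {a})ᶜ = 1 - μ.real (Z ⁻¹' {a}) := by
        rw [measureReal_compl (hZ _)]; simp
      have h3 : dist (μ.real (Z ⁻¹' {a})) 1 < d1 := by
        rw [Real.dist_eq, abs_sub_comm, ← h2, hc, abs_of_nonneg measureReal_nonneg]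
        exact hδ.trans_lt (hlt.trans_le (min_le_right _ _))
      have := h1 h3
      rw [Real.negMulLog_one, Real.dist_eq, sub_zero] at this
      exact (le_abs_self _).trans this.le
    · have h3 : dist (μ.real (Z ⁻¹' {a})) 0 < d0 := by
        rw [Real.dist_eq, sub_zero, abs_of_nonneg measureReal_nonneg]
        refine lt_of_le_of_lt ((measureReal_mono ?_).trans hδ) (hlt.trans_le (min_le_left _ _))
        intro x hx
        simp at hx ⊢
        rwa [hx]
      have := h0 h3
      rw [Real.negMulLog_zero, Real.dist_eq, sub_zero] at this
      exact (le_abs_self _).trans this.le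
  calc infoEntropy μ Z ≤ ∑ _a : α, κ' := Finset.sum_le_sum fun a _ => key a
    _ = Fintype.card α * κ' := by simp
    _ ≤ κ := by
      rw [hκ', mul_div_assoc', div_le_iff₀ (by positivity)]
      nlinarith

end Entropy

section MeanErgodic

variable {X : Type*} [MeasurableSpace X] {μ : Measure X} [IsProbabilityMeasure μ]

lemma birkhoffSum_toLp {T : X → X} (hT : MeasurePreserving T μ μ) {g : X → ℝ}
    (hg : MemLp g 2 μ) (n : ℕ) :
    (birkhoffSum (Lp.compMeasurePreservingₗᵢ ℝ T hT (E := ℝ) (p := 2)) id n (hg.toLp g) : Lp ℝ 2 μ)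
      =ᵐ[μ] birkhoffSum T g n := by
  induction n with
  | zero =>
    simp only [birkhoffSum_zero]
    exact Lp.coeFn_zero _ _ _
  | succ n ih =>
    have h1 : ((Lp.compMeasurePreservingₗᵢ ℝ T hT (E := ℝ) (p := 2))^[n] (hg.toLp g) : Lp ℝ 2 μ)
        =ᵐ[μ] g ∘ T^[n] := by
      have : ((Lp.compMeasurePreservingₗᵢ ℝ T hT (E := ℝ) (p := 2))^[n] (hg.toLp g) : Lp ℝ 2 μ) =
          Lp.compMeasurePreserving T^[n] (hT.iterate n) (hg.toLp g) := by
        rw [← Lp.compMeasurePreserving_iterate]; rfl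
      rw [this, Lp.toLp_compMeasurePreserving]
      exact MemLp.coeFn_toLp _
    rw [birkhoffSum_succ]
    filter_upwards [ih, h1, Lp.coeFn_add (birkhoffSum (Lp.compMeasurePreservingₗᵢ ℝ T hT (E := ℝ)
      (p := 2)) id n (hg.toLp g) : Lp ℝ 2 μ) (id ((Lp.compMeasurePreservingₗᵢ ℝ T hT (E := ℝ)
      (p := 2))^[n] (hg.toLp g)))] with x hx1 hx2 hx3
    rw [hx3, Pi.add_apply, hx1, birkhoffSum_succ]
    simp only [id, hx2, Function.comp]

/-- The weak law of large numbers for ergodic transformations. -/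
lemma eventually_birkhoffSum_le {T : X → X} (hT : Ergodic T μ) {g : X → ℝ} (hg : MemLp g 2 μ)
    {c δ : ℝ} (hc : ∫ x, g x ∂μ < c) (hδ : 0 < δ) :
    ∀ᶠ n : ℕ in atTop, μ.real {x | n * c < birkhoffSum T g n x} < δ := by
  have hTm := hT.toMeasurePreserving
  set f := (Lp.compMeasurePreservingₗᵢ ℝ T hTm (E := ℝ) (p := 2)).toContinuousLinearMap with hf
  have hfn : ‖f‖ ≤ 1 := LinearIsometry.norm_toContinuousLinearMap_le _
  set v : Lp ℝ 2 μ := hg.toLp g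
  have hlim := f.tendsto_birkhoffAverage_orthogonalProjection hfn v
  set w : Lp ℝ 2 μ := ((f.eqLocus (1 : Lp ℝ 2 μ →L[ℝ] Lp ℝ 2 μ)).orthogonalProjectionOnto v).1
  have hw : f w = w := by
    have := ((f.eqLocus (1 : Lp ℝ 2 μ →L[ℝ] Lp ℝ 2 μ)).orthogonalProjectionOnto v).2
    rw [LinearMap.mem_eqLocus] at this
    exact this
  obtain ⟨a, ha⟩ : ∃ a, (w : X → ℝ) =ᵐ[μ] Function.const X a := by
    refine hT.ae_eq_const_of_ae_eq_comp_ae (Lp.aestronglyMeasurable w) ?_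
    have h1 : (f w : X → ℝ) =ᵐ[μ] w ∘ T := Lp.coeFn_compMeasurePreserving w hTm
    rw [hw] at h1
    exact h1.symm
  have hcoe : ∀ n : ℕ, ((birkhoffAverage ℝ f id n v : Lp ℝ 2 μ) : X → ℝ) =ᵐ[μ]
      fun x => (n : ℝ)⁻¹ * birkhoffSum T g n x := by
    intro n
    have h1 := birkhoffSum_toLp hTm hg n
    have h2 := Lp.coeFn_smul (n : ℝ)⁻¹ (birkhoffSum f id n v)
    filter_upwards [h1, h2] with x hx1 hx2
    rw [birkhoffAverage, hx2, Pi.smul_apply, smul_eq_mul]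
    congr 1
  -- the integral is continuous on L²
  have hint : ∀ u : Lp ℝ 2 μ, Integrable u μ := fun u =>
    (Lp.memLp u).integrable (by norm_num)
  have hamean : a = ∫ x, g x ∂μ := by
    have hmean : ∀ n : ℕ, 0 < n → ∫ x, (birkhoffAverage ℝ f id n v : Lp ℝ 2 μ) x ∂μ = ∫ x, g x ∂μ := by
      intro n hn
      rw [integral_congr_ae (hcoe n), integral_const_mul]
      have : ∫ x, birkhoffSum T g n x ∂μ = n * ∫ x, g x ∂μ := by
        simp only [birkhoffSum]
        have hgi : Integrable g μ := hg.integrable (by norm_num)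
        rw [integral_finsetSum _ fun i _ => ?_]
        · have : ∀ i ∈ Finset.range n, ∫ x, g (T^[i] x) ∂μ = ∫ x, g x ∂μ := by
            intro i _
            have hi := hTm.iterate i
            conv_rhs => rw [← hi.map_eq]
            rw [integral_map hi.measurable.aemeasurable]
            rw [hi.map_eq]; exact hgi.1
          rw [Finset.sum_congr rfl this]; simp
        · exact (hTm.iterate i).integrable_comp_of_integrable hgi
      rw [this]; field_simp
    have hL1 : Tendsto (fun n : ℕ => ∫ x, (birkhoffAverage ℝ f id n v : Lp ℝ 2 μ) x ∂μ) atTop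
        (nhds (∫ x, w x ∂μ)) := by
      rw [tendsto_iff_norm_sub_tendsto_zero]
      have hn := tendsto_iff_norm_sub_tendsto_zero.1 hlim
      refine squeeze_zero (fun _ => norm_nonneg _) (fun n => ?_) hn
      rw [← integral_sub (hint _) (hint _)]
      have h3 : ∫ x, ((birkhoffAverage ℝ f id n v : Lp ℝ 2 μ) x - w x) ∂μ =
          ∫ x, (birkhoffAverage ℝ f id n v - w : Lp ℝ 2 μ) x ∂μ :=
        integral_congr_ae (Lp.coeFn_sub _ _).symm
      rw [h3]
      refine (norm_integral_le_integral_norm _).trans ?_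
      rw [integral_norm_eq_lintegral_enorm (Lp.aestronglyMeasurable _), ← eLpNorm_one_eq_lintegral_enorm,
        Lp.norm_def]
      exact ENNReal.toReal_mono (Lp.eLpNorm_ne_top _)
        (eLpNorm_le_eLpNorm_of_exponent_le (by norm_num) (Lp.aestronglyMeasurable _))
    have h4 : Tendsto (fun n : ℕ => ∫ x, (birkhoffAverage ℝ f id n v : Lp ℝ 2 μ) x ∂μ) atTop
        (nhds (∫ x, g x ∂μ)) :=
      tendsto_const_nhds.congr' ((eventually_gt_atTop 0).mono fun n hn => (hmean n hn).symm)
    have h5 := tendsto_nhds_unique hL1 h4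
    rw [integral_congr_ae ha] at h5
    simpa using h5
  have hmeas := tendstoInMeasure_of_tendsto_Lp hlim
  have hη : 0 < c - a := by rw [hamean]; linarith
  have h6 := hmeas (ENNReal.ofReal (c - a)) (by simpa using hη)
  have h7 := (ENNReal.tendsto_toReal ENNReal.zero_ne_top).comp h6
  have h8 := h7.eventually (gt_mem_nhds (show (0:ℝ≥0∞).toReal < δ by simpa using hδ))
  filter_upwards [h8, eventually_gt_atTop 0] with n hn hn0
  refine lt_of_le_of_lt ?_ hn
  refine ENNReal.toReal_mono (measure_ne_top _ _) (measure_mono_ae ?_)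
  filter_upwards [ha, hcoe n] with x hx1 hx2 hx3
  change ENNReal.ofReal (c - a) ≤ edist _ _
  rw [hx2, hx1, edist_dist, Real.dist_eq]
  refine ENNReal.ofReal_le_ofReal ((?_ : _ ≤ _).trans (le_abs_self _))
  simp only [Function.const]
  have hx4 : n * c < birkhoffSum T g n x := hx3
  have : c ≤ (n : ℝ)⁻¹ * birkhoffSum T g n x := by
    rw [inv_mul_eq_div, le_div_iff₀ (by positivity)]
    linarith
  linarith

end MeanErgodic

section TreeCount

/-- Extension of a finite word to an infinite one by a fixed letter. -/
def extendWord {α : Type*} (a₀ : α) {n : ℕ} (p : Fin n → α) (i : ℕ) : α :=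
  if h : i < n then p ⟨i, h⟩ else a₀

lemma extendWord_snoc {α : Type*} (a₀ : α) {n : ℕ} (p : Fin n → α) (a : α) :
    extendWord a₀ (Fin.snoc (α := fun _ => α) p a : Fin (n + 1) → α) =
      Function.update (extendWord a₀ p) n a := by
  funext i
  rcases lt_trichotomy i n with h | h | h
  · rw [Function.update_of_ne h.ne]
    simp [extendWord, h, Nat.lt_succ_of_lt h, Fin.snoc]
  · subst h
    simp [extendWord, Fin.snoc]
  · rw [Function.update_of_ne h.ne']
    simp [extendWord, show ¬ i < n + 1 by omega, show ¬ i < n by omega]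

/-- A product of transition weights sums to at most one over all words. -/
lemma sum_prod_transition_le_one {α : Type*} [Fintype α] (a₀ : α) (w : ℕ → (ℕ → α) → ℝ)
    (hw0 : ∀ k s, 0 ≤ w k s) (hdep : ∀ k s s', (∀ i ≤ k, s i = s' i) → w k s = w k s')
    (hsum : ∀ k s, ∑ a, w k (Function.update s k a) ≤ 1) (n : ℕ) :
    ∑ p : Fin n → α, ∏ k ∈ Finset.range n, w k (extendWord a₀ p) ≤ 1 := by
  induction n with
  | zero => simp
  | succ n ih =>
    rw [← (Fin.snocEquiv fun _ : Fin (n + 1) => α).sum_comp, Fintype.sum_prod_type_right]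
    refine le_trans (Finset.sum_le_sum fun p _ => ?_) ih
    have h1 : ∀ a : α, ∏ k ∈ Finset.range (n + 1), w k (extendWord a₀
        ((Fin.snocEquiv fun _ : Fin (n + 1) => α) (a, p))) =
        (∏ k ∈ Finset.range n, w k (extendWord a₀ p)) *
          w n (Function.update (extendWord a₀ p) n a) := by
      intro a
      have : (Fin.snocEquiv fun _ : Fin (n + 1) => α) (a, p) =
        (Fin.snoc (α := fun _ => α) p a : Fin (n + 1) → α) := rfl
      rw [this, extendWord_snoc, Finset.prod_range_succ]
      congr 1
      refine Finset.prod_congr rfl fun k hk => hdep _ _ _ fun i hi => ?_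
      rw [Function.update_of_ne]
      have := Finset.mem_range.1 hk
      omega
    rw [Finset.sum_congr rfl fun a _ => h1 a, ← Finset.mul_sum]
    exact mul_le_of_le_one_right (Finset.prod_nonneg fun _ _ => hw0 _ _) (hsum _ _)

end TreeCount

section ConditionalCounting

variable {X : Type*} [MeasurableSpace X] {μ : Measure X} [IsProbabilityMeasure μ]
variable {α β : Type*} [Fintype α] [Fintype β]

lemma exists_bound_of_finite {γ : Type*} [Finite γ] (φ : γ → ℝ) : ∃ C, ∀ v, ‖φ v‖ ≤ C := by
  obtain ⟨C, hC⟩ := (Set.finite_range fun v => ‖φ v‖).bddAbove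
  exact ⟨C, fun v => hC ⟨v, rfl⟩⟩

lemma memLp_obs {γ : Type*} [Finite γ] {V : X → γ} (hV : IsObs V) (φ : γ → ℝ) (p : ℝ≥0∞) :
    MemLp (fun x => φ (V x)) p μ := by
  obtain ⟨C, hC⟩ := exists_bound_of_finite φ
  exact MemLp.of_bound (hV.comp φ).measurable.aestronglyMeasurable C
    (Eventually.of_forall fun x => hC _)

lemma integral_obs {γ : Type*} [Fintype γ] {V : X → γ} (hV : IsObs V) (φ : γ → ℝ) :
    ∫ x, φ (V x) ∂μ = ∑ v, μ.real (V ⁻¹' {v}) * φ v := by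
  classical
  have h1 : (fun x => φ (V x)) = fun x => ∑ v, (V ⁻¹' {v}).indicator (fun _ => φ v) x := by
    funext x
    simp [Set.indicator_apply]
  rw [h1, integral_finsetSum]
  · refine Finset.sum_congr rfl fun v _ => ?_
    rw [integral_indicator (hV _)]
    simp
  · intro v _
    exact (integrable_const _).indicator (hV _)

/-- One-symbol prediction: conditional entropies of single steps average to the total. -/
lemma exists_increment_lt {T : X → X} {P : X → α} {Q : X → β} (hT : Measurable T)
    (hP : IsObs P) (hQ : IsObs Q) {c : ℝ} {M : ℕ}
    (h : infoEntropy μ (name T (fun x => (P x, Q x)) M) - infoEntropy μ (name T Q M) < M * c) :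
    ∃ b < M, infoEntropy μ (fun x => (name T P (b + 1) x, name T Q M x)) -
      infoEntropy μ (fun x => (name T P b x, name T Q M x)) < c := by
  classical
  set F : ℕ → ℝ := fun b => infoEntropy μ (fun x => (name T P b x, name T Q M x)) with hF
  have h0 : infoEntropy μ (name T Q M) ≤ F 0 :=
    infoEntropy_le_of_factor ((hP.name hT 0).pair (hQ.name hT M)) fun x y hxy =>
      congrArg Prod.snd hxy
  have hM : infoEntropy μ (name T (fun x => (P x, Q x)) M) ≥ F M :=
    infoEntropy_le_of_factor ((hP.pair hQ).name hT M) fun x y hxy => by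
      rw [name_eq_iff] at hxy
      refine Prod.ext ?_ ?_
      · exact name_eq_iff.2 fun i hi => congrArg Prod.fst (hxy i hi)
      · exact name_eq_iff.2 fun i hi => congrArg Prod.snd (hxy i hi)
  have h2 : ∑ b ∈ Finset.range M, (F (b + 1) - F b) < ∑ b ∈ Finset.range M, c := by
    rw [Finset.sum_range_sub]; simp; linarith
  obtain ⟨b, hb, hlt⟩ := Finset.exists_lt_of_sum_lt h2
  exact ⟨b, Finset.mem_range.1 hb, hlt⟩

/-- If the conditional entropy of `P` given `Q` is less than `c`, then up to a set of small measure
there are at most `exp (n c)` names of `P` of length `n` for any given name of `Q`. -/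
theorem eventually_exists_count_le {T : X → X} (hT : Ergodic T μ) {P : X → α} {Q : X → β}
    (hP : IsObs P) (hQ : IsObs Q) {c : ℝ} {M : ℕ}
    (h : infoEntropy μ (name T (fun x => (P x, Q x)) M) - infoEntropy μ (name T Q M) < M * c)
    {δ : ℝ} (hδ : 0 < δ) :
    ∀ᶠ n : ℕ in atTop, ∃ G : Set X, MeasurableSet G ∧ μ.real Gᶜ < δ ∧ ∀ q : Fin n → β,
      ((name T P n '' {x | x ∈ G ∧ name T Q n x = q}).ncard : ℝ) ≤ Real.exp (n * c) := by
  classical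
  have hTm := hT.toMeasurePreserving
  have hX : Nonempty X := nonempty_of_isProbabilityMeasure μ
  obtain ⟨x₀⟩ := hX
  obtain ⟨b, hbM, hb⟩ := exists_increment_lt hT.measurable hP hQ h
  set U : X → (Fin b → α) × (Fin M → β) := fun x => (name T P b x, name T Q M x) with hU
  set V : X → (Fin (b + 1) → α) × (Fin M → β) := fun x => (name T P (b + 1) x, name T Q M x) with hV
  have oU : IsObs U := (hP.name hT.measurable _).pair (hQ.name hT.measurable _)
  have oV : IsObs V := (hP.name hT.measurable _).pair (hQ.name hT.measurable _)
  set rU : (Fin b → α) × (Fin M → β) → ℝ := fun u => μ.real (U ⁻¹' {u}) with hrU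
  set rV : (Fin (b + 1) → α) × (Fin M → β) → ℝ := fun v => μ.real (V ⁻¹' {v}) with hrV
  set g : X → ℝ := fun x => Real.log (rU (U x)) - Real.log (rV (V x)) with hg
  have g1 : MemLp (fun x => Real.log (rU (U x))) 2 μ := memLp_obs oU (fun u => Real.log (rU u)) 2
  have g2 : MemLp (fun x => Real.log (rV (V x))) 2 μ := memLp_obs oV (fun u => Real.log (rV u)) 2
  have gm : MemLp g 2 μ := g1.sub g2
  have gint : ∫ x, g x ∂μ < c := by
    have h1 : ∫ x, g x ∂μ = infoEntropy μ V - infoEntropy μ U := by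
      simp only [hg]
      rw [integral_sub (g1.integrable (by norm_num)) (g2.integrable (by norm_num)),
        integral_obs oU (fun u => Real.log (rU u)), integral_obs oV (fun u => Real.log (rV u)),
        infoEntropy_eq, infoEntropy_eq]
      simp only [Real.negMulLog, neg_mul, Finset.sum_neg_distrib]
      rw [neg_sub_neg]
    rw [h1]; exact hb
  obtain ⟨c', hc1, hc2⟩ := exists_between gint
  have hav := eventually_birkhoffSum_le hT gm hc1 hδ
  -- the null set of impossible windows
  set Nl : Set X := {x | rV (V x) = 0} with hNl
  have hNl0 : μ Nl = 0 := by
    have : Nl ⊆ ⋃ v ∈ {v | rV v = 0}, V ⁻¹' {v} := by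
      intro x hx
      simp only [mem_iUnion]
      exact ⟨V x, hx, rfl⟩
    refine measure_mono_null this ((measure_biUnion_null_iff (Set.to_countable _)).2 ?_)
    intro v hv
    exact (measureReal_eq_zero_iff).1 hv
  have hNlm : MeasurableSet Nl := oV {v | rV v = 0}
  have hbig : ∀ᶠ n : ℕ in atTop, (Fintype.card α : ℝ) ^ M * Real.exp (n * c') ≤ Real.exp (n * c) := by
    have hpos : 0 < c - c' := by linarith
    have ht : Tendsto (fun n : ℕ => Real.exp (n * (c - c'))) atTop atTop :=
      Real.tendsto_exp_atTop.comp (tendsto_natCast_atTop_atTop.atTop_mul_const hpos)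
    filter_upwards [ht.eventually_ge_atTop ((Fintype.card α : ℝ) ^ M)] with n hn
    calc (Fintype.card α : ℝ) ^ M * Real.exp (n * c') ≤
        Real.exp (n * (c - c')) * Real.exp (n * c') := by gcongr
      _ = Real.exp (n * c) := by rw [← Real.exp_add]; congr 1; ring
  filter_upwards [hav, hbig, eventually_ge_atTop M] with n hn hnbig hnM
  refine ⟨{x | ¬ (n * c' < birkhoffSum T g n x)} ∩ ⋂ k ∈ Finset.range n, (T^[k] ⁻¹' Nl)ᶜ, ?_, ?_, ?_⟩
  · have hbm : Measurable (birkhoffSum T g n) := by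
      unfold birkhoffSum
      refine Finset.measurable_sum _ fun k _ => ?_
      refine Measurable.comp (g := g) ?_ (hT.measurable.iterate k)
      exact (oU.comp (fun u => Real.log (rU u))).measurable.sub
        (oV.comp (fun u => Real.log (rV u))).measurable
    refine ((measurableSet_lt measurable_const hbm).compl).inter ?_
    exact Finset.measurableSet_biInter _ fun k _ => ((hT.measurable.iterate k) hNlm).compl
  · refine lt_of_le_of_lt ?_ hn
    refine ENNReal.toReal_mono (measure_ne_top _ _) ?_
    rw [compl_inter]
    refine (measure_union_le _ _).trans ?_
    have : μ (⋂ k ∈ Finset.range n, (T^[k] ⁻¹' Nl)ᶜ)ᶜ = 0 := by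
      simp only [compl_iInter, compl_compl]
      refine (measure_biUnion_null_iff (Finset.countable_toSet _)).2 fun k _ => ?_
      rw [(hTm.iterate k).measure_preimage hNlm.nullMeasurableSet, hNl0]
    rw [this, add_zero]
    refine measure_mono fun x hx => ?_
    simpa using hx
  · intro q
    set A := Fintype.card α with hA
    have hApos : 0 < A := Fintype.card_pos_iff.2 ⟨P x₀⟩
    set r := n - M + 1 with hr
    set t := M - 1 - b with ht
    have hnsum : n = b + r + t := by omega
    set qe : ℕ → β := extendWord (Q x₀) q with hqe
    set vw : (ℕ → α) → ℕ → (Fin (b + 1) → α) × (Fin M → β) := fun s j =>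
      (fun i => s (j + i), fun i => qe (j + i)) with hvw
    set uw : (ℕ → α) → ℕ → (Fin b → α) × (Fin M → β) := fun s j =>
      (fun i => s (j + i), fun i => qe (j + i)) with huw
    set w : ℕ → (ℕ → α) → ℝ := fun k s => if b ≤ k ∧ k < b + r then
      rV (vw s (k - b)) / rU (uw s (k - b)) else 1 / A with hw
    have hrU0 : ∀ u, 0 ≤ rU u := fun u => measureReal_nonneg
    have hrV0 : ∀ u, 0 ≤ rV u := fun u => measureReal_nonneg
    have hw0 : ∀ k s, 0 ≤ w k s := by
      intro k s
      simp only [hw]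
      split_ifs
      · exact div_nonneg (hrV0 _) (hrU0 _)
      · positivity
    have hdep : ∀ k s s', (∀ i ≤ k, s i = s' i) → w k s = w k s' := by
      intro k s s' hs
      simp only [hw]
      split_ifs with hk
      · have e1 : vw s (k - b) = vw s' (k - b) := by
          simp only [hvw, Prod.mk.injEq, and_true]
          funext i; exact hs _ (by have := i.2; omega)
        have e2 : uw s (k - b) = uw s' (k - b) := by
          simp only [huw, Prod.mk.injEq, and_true]
          funext i; exact hs _ (by have := i.2; omega)
        rw [e1, e2]
      · rfl
    have hsum : ∀ k s, ∑ a, w k (Function.update s k a) ≤ 1 := by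
      intro k s
      simp only [hw]
      split_ifs with hk
      · have e2 : ∀ a, uw (Function.update s k a) (k - b) = uw s (k - b) := by
          intro a
          simp only [huw, Prod.mk.injEq, and_true]
          funext i
          rw [Function.update_of_ne (by have := i.2; omega)]
        simp only [e2]
        rw [← Finset.sum_div]
        refine (div_le_div_of_nonneg_right ?_ (hrU0 _)).trans (div_self_le_one _)
        have hlast : ∀ a, (vw (Function.update s k a) (k - b)).1 (Fin.last b) = a := by
          intro a
          simp only [hvw, Fin.val_last]
          rw [Nat.sub_add_cancel hk.1, Function.update_self]
        have hdisj : ((Finset.univ : Finset α) : Set α).PairwiseDisjoint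
            fun a => V ⁻¹' {vw (Function.update s k a) (k - b)} := by
          intro a _ a' _ haa
          refine Disjoint.preimage _ ?_
          rw [disjoint_singleton]
          intro he
          exact haa (by rw [← hlast a, ← hlast a', he])
        simp only [hrV]
        rw [← measureReal_biUnion_finset hdisj fun a _ => oV _]
        refine measureReal_mono ?_
        intro x hx
        simp only [mem_iUnion, mem_preimage, mem_singleton_iff] at hx ⊢
        obtain ⟨a, -, ha⟩ := hx
        rw [← e2 a]
        have ha2 := congrArg Prod.snd ha
        refine Prod.ext ?_ ha2
        funext i
        have := congrFun (congrArg Prod.fst ha) i.castSucc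
        simpa [hV, hvw, hU, huw, name] using this
      · simp [hA]
        rw [mul_inv_cancel₀]
        exact_mod_cast hApos.ne'
    have htree := sum_prod_transition_le_one (P x₀) w hw0 hdep hsum n
    set B := name T P n '' {x | x ∈ ({x | ¬ (n * c' < birkhoffSum T g n x)} ∩
      ⋂ k ∈ Finset.range n, (T^[k] ⁻¹' Nl)ᶜ) ∧ name T Q n x = q} with hB
    have hlow : ∀ p ∈ B, (1 / (A : ℝ)) ^ M * Real.exp (-(n * c')) ≤
        ∏ k ∈ Finset.range n, w k (extendWord (P x₀) p) := by
      rintro p ⟨x, ⟨⟨hx1, hx2⟩, hxq⟩, rfl⟩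
      have hx1' : birkhoffSum T g n x ≤ n * c' := not_lt.1 hx1
      have hpos : ∀ k < n, 0 < rV (V (T^[k] x)) := by
        intro k hk
        simp only [mem_iInter] at hx2
        exact lt_of_le_of_ne (hrV0 _) (Ne.symm (hx2 k (Finset.mem_range.2 hk)))
      have hVU : ∀ y, rV (V y) ≤ rU (U y) := by
        intro y
        refine measureReal_mono ?_
        intro z hz
        have hz' : V z = V y := hz
        have hz2 := congrArg Prod.snd hz'
        refine Prod.ext ?_ hz2
        funext i
        exact congrFun (congrArg Prod.fst hz') i.castSucc
      have hg0 : ∀ k < n, 0 ≤ g (T^[k] x) := by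
        intro k hk
        simp only [hg, sub_nonneg]
        exact Real.log_le_log (hpos k hk) (hVU _)
      have hw1 : ∀ k, ¬ (b ≤ k ∧ k < b + r) → w k (extendWord (P x₀) (name T P n x)) = 1 / A := by
        intro k hk; simp only [hw]; rw [if_neg hk]
      have hw2 : ∀ j < r, w (b + j) (extendWord (P x₀) (name T P n x)) =
          Real.exp (-g (T^[j] x)) := by
        intro j hj
        simp only [hw]
        rw [if_pos ⟨by omega, by omega⟩, Nat.add_sub_cancel_left]
        have hP' : ∀ i ≤ b, extendWord (P x₀) (name T P n x) (j + i) = P (T^[i] (T^[j] x)) := by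
          intro i hi
          rw [extendWord, dif_pos (by omega), ← Function.iterate_add_apply, add_comm i]
          rfl
        have hQ' : ∀ i < M, qe (j + i) = Q (T^[i] (T^[j] x)) := by
          intro i hi
          rw [hqe, ← hxq, extendWord, dif_pos (by omega), ← Function.iterate_add_apply,
            add_comm i]
          rfl
        have e1 : vw (extendWord (P x₀) (name T P n x)) j = V (T^[j] x) := by
          refine Prod.ext ?_ ?_
          · funext i; exact hP' i (by have := i.2; omega)
          · funext i; exact hQ' i i.2
        have e2 : uw (extendWord (P x₀) (name T P n x)) j = U (T^[j] x) := by
          refine Prod.ext ?_ ?_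
          · funext i; exact hP' i (by have := i.2; omega)
          · funext i; exact hQ' i i.2
        rw [e1, e2]
        have p1 := hpos j (by omega)
        have p2 := p1.trans_le (hVU (T^[j] x))
        simp only [hg]
        rw [neg_sub, Real.exp_sub, Real.exp_log p1, Real.exp_log p2]
      have hsplit : ∀ f : ℕ → ℝ, ∏ k ∈ Finset.range n, f k = ((∏ k ∈ Finset.range b, f k) *
          ∏ k ∈ Finset.range r, f (b + k)) * ∏ k ∈ Finset.range t, f (b + r + k) := by
        intro f
        conv_lhs => rw [hnsum]
        rw [Finset.prod_range_add, Finset.prod_range_add]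
      rw [hsplit, Finset.prod_congr (s₁ := Finset.range b) rfl fun k hk => hw1 k (by have := Finset.mem_range.1 hk; omega),
        Finset.prod_congr rfl fun j hj => hw2 j (Finset.mem_range.1 hj),
        Finset.prod_congr (s₁ := Finset.range t) rfl fun k hk => hw1 (b + r + k) (by omega)]
      rw [Finset.prod_const, Finset.prod_const, Finset.card_range, Finset.card_range,
        ← Real.exp_sum]
      have h5 : (1 / (A : ℝ)) ^ M ≤ (1 / (A : ℝ)) ^ (b + t) := by
        refine pow_le_pow_of_le_one (by positivity) ?_ (by omega)
        rw [div_le_one (by exact_mod_cast hApos)]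
        exact_mod_cast hApos
      have h6 : Real.exp (-(n * c')) ≤ Real.exp (∑ j ∈ Finset.range r, -g (T^[j] x)) := by
        refine Real.exp_le_exp.2 ?_
        rw [Finset.sum_neg_distrib, neg_le_neg_iff]
        refine le_trans ?_ hx1'
        unfold birkhoffSum
        refine Finset.sum_le_sum_of_subset_of_nonneg (Finset.range_mono (by omega)) ?_
        intro k hk _
        exact hg0 k (Finset.mem_range.1 hk)
      calc (1 / (A : ℝ)) ^ M * Real.exp (-(n * c')) ≤ (1 / (A : ℝ)) ^ (b + t) * Real.exp (∑ j ∈ Finset.range r, -g (T^[j] x)) := by gcongr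
        _ = _ := by rw [pow_add]; ring
    have hfin : B.Finite := Set.toFinite _
    have hcard : (B.ncard : ℝ) * ((1 / (A : ℝ)) ^ M * Real.exp (-(n * c'))) ≤ 1 := by
      rw [Set.ncard_eq_toFinset_card B hfin, ← nsmul_eq_mul]
      refine (Finset.card_nsmul_le_sum _ _ _ fun p hp => hlow p (hfin.mem_toFinset.1 hp)).trans ?_
      refine le_trans (Finset.sum_le_univ_sum_of_nonneg fun p => ?_) htree
      exact Finset.prod_nonneg fun _ _ => hw0 _ _
    refine le_trans ?_ hnbig
    have hAr : (0 : ℝ) < A := by exact_mod_cast hApos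
    have hcan : ((1 / (A : ℝ)) ^ M * Real.exp (-(n * c'))) * ((A : ℝ) ^ M * Real.exp (n * c')) = 1 := by
      rw [mul_mul_mul_comm, ← mul_pow, ← Real.exp_add]
      field_simp
      simp
    have hpos2 : 0 < (A : ℝ) ^ M * Real.exp (n * c') := by positivity
    calc (B.ncard : ℝ) = (B.ncard : ℝ) * ((1 / (A : ℝ)) ^ M * Real.exp (-(n * c'))) *
          ((A : ℝ) ^ M * Real.exp (n * c')) := by rw [mul_assoc, hcan, mul_one]
      _ ≤ 1 * ((A : ℝ) ^ M * Real.exp (n * c')) := by gcongr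
      _ = _ := one_mul _

end ConditionalCounting

section IntegerIterates

variable {X : Type*}

/-- Integer iterates of a bijection. -/
def zit (e : X ≃ X) (k : ℤ) (x : X) : X := ((e : Equiv.Perm X) ^ k) x

@[simp] lemma zit_zero (e : X ≃ X) (x : X) : zit e 0 x = x := by simp [zit]

lemma zit_one (e : X ≃ X) (x : X) : zit e 1 x = e x := by simp [zit]

lemma zit_add (e : X ≃ X) (a b : ℤ) (x : X) : zit e a (zit e b x) = zit e (a + b) x := by
  simp [zit, zpow_add]

lemma zit_natCast (e : X ≃ X) (n : ℕ) (x : X) : zit e n x = e^[n] x := by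
  simp only [zit, zpow_natCast]
  exact congrFun (Equiv.Perm.iterate_eq_pow e n).symm x

lemma zit_apply (e : X ≃ X) (a : ℤ) (x : X) : zit e a (e x) = zit e (a + 1) x := by
  rw [← zit_one, zit_add]

lemma apply_zit (e : X ≃ X) (a : ℤ) (x : X) : e (zit e a x) = zit e (a + 1) x := by
  rw [← zit_one, zit_add, add_comm]

lemma zit_symm (e : X ≃ X) (n : ℕ) (x : X) : zit e (-n) x = e.symm^[n] x := by
  have h : (e^[n]) (e.symm^[n] x) = x := (Function.LeftInverse.iterate e.apply_symm_apply n) x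
  rw [← zit_natCast] at h
  conv_lhs => rw [← h]
  rw [zit_add]; simp

variable [MeasurableSpace X] {μ : Measure X}

lemma measurable_zit (T : X ≃ᵐ X) (k : ℤ) : Measurable (zit T.toEquiv k) := by
  obtain ⟨n, rfl | rfl⟩ := k.eq_nat_or_neg
  · have : zit T.toEquiv n = T^[n] := funext fun x => (zit_natCast _ n x)
    rw [this]; exact T.measurable.iterate n
  · have : zit T.toEquiv (-n) = T.symm^[n] := funext fun x => (zit_symm _ n x)
    rw [this]; exact T.symm.measurable.iterate n

lemma measurePreserving_zit (T : X ≃ᵐ X) (hT : MeasurePreserving T μ μ) (k : ℤ) :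
    MeasurePreserving (zit T.toEquiv k) μ μ := by
  obtain ⟨n, rfl | rfl⟩ := k.eq_nat_or_neg
  · have : zit T.toEquiv n = T^[n] := funext fun x => (zit_natCast _ n x)
    rw [this]; exact hT.iterate n
  · have : zit T.toEquiv (-n) = T.symm^[n] := funext fun x => (zit_symm _ n x)
    rw [this]; exact (MeasurePreserving.symm T hT).iterate n

end IntegerIterates

section Markers

variable {X : Type*} [MeasurableSpace X] {μ : Measure X} [IsProbabilityMeasure μ]

lemma exists_bits (X : Type*) [MeasurableSpace X] [StandardBorelSpace X] :
    ∃ f : X → ℕ → Bool, Function.Injective f ∧ ∀ i, IsObs (fun x => f x i) := by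
  obtain ⟨f, hf, hinj⟩ := MeasurableSpace.measurable_injection_nat_bool_of_countablySeparated X
  refine ⟨f, hinj, fun i s => ?_⟩
  exact ((measurable_pi_apply i).comp hf) (MeasurableSet.of_discrete)

lemma exists_small_set [StandardBorelSpace X] [NullSingletonClass μ] {δ : ℝ} (hδ : 0 < δ) :
    ∃ A : Set X, MeasurableSet A ∧ 0 < μ.real A ∧ μ.real A < δ := by
  obtain ⟨f, hinj, hf⟩ := exists_bits X
  set C : ∀ n : ℕ, X → (Fin n → Bool) := fun n x i => f x i with hC
  have oC : ∀ n, IsObs (C n) := fun n => isObs_pi fun i => hf i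
  have hnull : ∀ n, ∀ᵐ x ∂μ, 0 < μ (C n ⁻¹' {C n x}) := by
    intro n
    have : {x | ¬ 0 < μ (C n ⁻¹' {C n x})} ⊆ ⋃ v ∈ {v | μ (C n ⁻¹' {v}) = 0}, C n ⁻¹' {v} := by
      intro x hx
      simp only [mem_iUnion]
      exact ⟨C n x, by simpa using hx, rfl⟩
    exact measure_mono_null this ((measure_biUnion_null_iff (Set.to_countable _)).2 fun v hv => hv)
  obtain ⟨x, hx⟩ := (ae_all_iff.2 hnull).exists
  have hanti : Antitone fun n => C n ⁻¹' {C n x} := by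
    intro m n hmn y hy
    have hy' : C n y = C n x := hy
    refine funext fun i => ?_
    exact congrFun hy' ⟨i, i.2.trans_le hmn⟩
  have hlim := tendsto_measure_iInter_atTop (μ := μ) (s := fun n => C n ⁻¹' {C n x})
    (fun n => (oC n _).nullMeasurableSet) hanti ⟨0, measure_ne_top _ _⟩
  have hI : ⋂ n, C n ⁻¹' {C n x} = {x} := by
    ext y
    simp only [mem_iInter, mem_preimage, mem_singleton_iff]
    refine ⟨fun h => hinj (funext fun i => ?_), fun h n => by rw [h]⟩
    exact congrFun (h (i + 1)) ⟨i, i.lt_succ_self⟩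
  rw [hI, measure_singleton] at hlim
  have h7 := (ENNReal.tendsto_toReal ENNReal.zero_ne_top).comp hlim
  obtain ⟨n, hn⟩ := (h7.eventually (gt_mem_nhds (show (0:ℝ≥0∞).toReal < δ by simpa using hδ))).exists
  exact ⟨_, oC n _, ENNReal.toReal_pos (hx n).ne' (measure_ne_top _ _), hn⟩

lemma ae_of_le_preimage {T : X → X} (hT : Ergodic T μ) {B : Set X} (hB : MeasurableSet B)
    (h : B ≤ᵐ[μ] T ⁻¹' B) (hpos : 0 < μ B) : ∀ᵐ x ∂μ, x ∈ B := by
  rcases hT.ae_empty_or_univ_of_ae_le_preimage hB.nullMeasurableSet h with h | h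
  · exact absurd (ae_eq_empty.1 h) hpos.ne'
  · exact eventuallyEq_univ.1 h

/-- A small set of positive measure without early returns. -/
lemma exists_small_set_no_return [StandardBorelSpace X] [NullSingletonClass μ] {T : X ≃ᵐ X}
    (hT : Ergodic T μ) {δ : ℝ} (hδ : 0 < δ) (N : ℕ) :
    ∃ A : Set X, MeasurableSet A ∧ 0 < μ A ∧ μ.real A < δ ∧
      ∀ x ∈ A, ∀ j : ℕ, 0 < j → j < N → zit T.toEquiv j x ∉ A := by
  obtain ⟨A₀, hA₀, hpos, hlt⟩ := exists_small_set (μ := μ)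
    (show 0 < min δ (1 / (N + 1)) by positivity)
  have hpos' : 0 < μ A₀ := by
    rw [pos_iff_ne_zero]; intro h; simp [Measure.real, h] at hpos
  set A : Set X := A₀ ∩ ⋂ j ∈ Finset.Ico 1 N, (zit T.toEquiv (j : ℕ) ⁻¹' A₀)ᶜ with hA
  have hAm : MeasurableSet A := hA₀.inter (Finset.measurableSet_biInter _ fun j _ =>
    (measurable_zit T j hA₀).compl)
  refine ⟨A, hAm, ?_, (measureReal_mono inter_subset_left).trans_lt
    (hlt.trans_le (min_le_left _ _)), ?_⟩
  · by_contra h0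
    have h0 : μ A = 0 := by simpa using h0
    set B : Set X := ⋃ i ∈ Finset.range (N + 1), zit T.toEquiv (i : ℕ) ⁻¹' A₀ with hB
    have hBm : MeasurableSet B := Finset.measurableSet_biUnion _ fun i _ => measurable_zit T i hA₀
    have hle : B ≤ᵐ[μ] T ⁻¹' B := by
      have : ∀ᵐ x ∂μ, x ∉ A := measure_eq_zero_iff_ae_notMem.1 h0
      filter_upwards [this] with x hx hxB
      have hxB' : x ∈ B := hxB
      change x ∈ T ⁻¹' B
      simp only [hB, mem_iUnion, Finset.mem_range, mem_preimage, exists_prop] at hxB' ⊢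
      have hT1 : ∀ i : ℕ, zit T.toEquiv (i : ℕ) (T x) = zit T.toEquiv (i + 1 : ℕ) x := fun i => by
        push_cast; exact zit_apply T.toEquiv i x
      obtain ⟨i, hi, hxi⟩ := hxB'
      rcases Nat.eq_zero_or_pos i with rfl | hi0
      · have hx0 : x ∈ A₀ := by simpa using hxi
        simp only [hA, mem_inter_iff, hx0, true_and, mem_iInter, not_forall] at hx
        obtain ⟨j, hj, hxj⟩ := hx
        rw [Finset.mem_Ico] at hj
        refine ⟨j - 1, by omega, ?_⟩
        rw [hT1, Nat.sub_add_cancel hj.1]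
        simpa using hxj
      · refine ⟨i - 1, by omega, ?_⟩
        rw [hT1, Nat.sub_add_cancel hi0]
        exact hxi
    have hAB : A₀ ⊆ B := fun x hx => by
      simp only [hB, mem_iUnion]
      exact ⟨0, by simp, by simpa using hx⟩
    have hall := ae_of_le_preimage hT hBm hle (hpos'.trans_le (measure_mono hAB))
    have h1 : μ.real B = 1 := by
      have := prob_compl_eq_zero_iff hBm |>.1 (mem_ae_iff.1 hall)
      simp [Measure.real, this]
    have h2 : μ.real B ≤ ∑ i ∈ Finset.range (N + 1), μ.real A₀ := by
      refine (measureReal_biUnion_finset_le _ _).trans (Finset.sum_le_sum fun i _ => le_of_eq ?_)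
      exact congrArg ENNReal.toReal ((measurePreserving_zit T hT.toMeasurePreserving
        i).measure_preimage hA₀.nullMeasurableSet)
    have h3 := hlt.trans_le (min_le_right _ _)
    rw [h1] at h2
    rw [lt_div_iff₀ (by positivity)] at h3
    simp at h2
    linarith
  · intro x hx j hj hjN hj2
    have := hx.2
    simp only [mem_iInter] at this
    exact this j (Finset.mem_Ico.2 ⟨hj, hjN⟩) hj2.1

/-- A marker set, up to the choice of a shift. -/
lemma exists_premarker [StandardBorelSpace X] [NullSingletonClass μ] {T : X ≃ᵐ X}
    (hT : Ergodic T μ) {N : ℕ} (hN : 0 < N) {δ : ℝ} (hδ : 0 < δ) :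
    ∃ D : Set X, MeasurableSet D ∧
      (∀ x ∈ D, ∀ i : ℕ, 0 < i → i < N → zit T.toEquiv i x ∉ D) ∧
      (∀ᵐ x ∂μ, ∃ i : ℕ, i < 2 * N ∧ zit T.toEquiv i x ∈ D) ∧
      μ.real {x | ∀ i : ℕ, i < N → zit T.toEquiv (-i) x ∉ D} ≤ δ := by
  obtain ⟨A, hAm, hApos, hAlt, hAret⟩ := exists_small_set_no_return (μ := μ) hT
    (show 0 < δ / N by positivity) N
  set τ := zit T.toEquiv with hτ
  have τm : ∀ k, Measurable (τ k) := measurable_zit T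
  have τp : ∀ k, MeasurePreserving (τ k) μ μ := measurePreserving_zit T hT.toMeasurePreserving
  have τa : ∀ a b x, τ a (τ b x) = τ (a + b) x := zit_add T.toEquiv
  have τT : ∀ k x, τ k (T x) = τ (k + 1) x := zit_apply T.toEquiv
  set D : Set X := {x | ∃ i : ℕ, τ (-(i * N : ℕ)) x ∈ A ∧
    ∀ j : ℕ, 0 < j → j < (i + 1) * N → τ ((j : ℤ) - (i * N : ℕ)) x ∉ A} with hD
  have hDm : MeasurableSet D := by
    have : D = ⋃ i : ℕ, (τ (-(i * N : ℕ)) ⁻¹' A ∩ ⋂ j : ℕ, ⋂ (_ : 0 < j), ⋂ (_ : j < (i + 1) * N),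
        (τ ((j : ℤ) - (i * N : ℕ)) ⁻¹' A)ᶜ) := by
      ext x; simp [hD]
    rw [this]
    exact MeasurableSet.iUnion fun i => (τm _ hAm).inter (MeasurableSet.iInter fun j =>
      MeasurableSet.iInter fun _ => MeasurableSet.iInter fun _ => (τm _ hAm).compl)
  -- almost every point visits `A` in the past and in the strict future
  have hpast : ∀ᵐ x ∂μ, ∃ k : ℕ, τ (-k) x ∈ A := by
    have hBm : MeasurableSet {x | ∃ k : ℕ, τ (-k) x ∈ A} := by
      have : {x | ∃ k : ℕ, τ (-k) x ∈ A} = ⋃ k : ℕ, τ (-k) ⁻¹' A := by ext; simp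
      rw [this]; exact MeasurableSet.iUnion fun k => τm _ hAm
    refine ae_of_le_preimage hT hBm (Eventually.of_forall ?_) (hApos.trans_le (measure_mono ?_))
    · rintro x ⟨k, hk⟩
      refine ⟨k + 1, ?_⟩
      rw [τT]
      have : (-((k + 1 : ℕ) : ℤ) + 1) = -k := by push_cast; ring
      rwa [this]
    · intro x hx
      exact ⟨0, by simpa [hτ] using hx⟩
  have hfut : ∀ᵐ x ∂μ, ∃ k : ℕ, 0 < k ∧ τ k x ∈ A := by
    have hBm : MeasurableSet {x | ∃ k : ℕ, τ k x ∈ A} := by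
      have : {x | ∃ k : ℕ, τ k x ∈ A} = ⋃ k : ℕ, τ k ⁻¹' A := by ext; simp
      rw [this]; exact MeasurableSet.iUnion fun k => τm _ hAm
    have hle : T ⁻¹' {x | ∃ k : ℕ, τ k x ∈ A} ≤ᵐ[μ] {x | ∃ k : ℕ, τ k x ∈ A} := by
      refine Eventually.of_forall ?_
      rintro x ⟨k, hk⟩
      exact ⟨k + 1, by rw [τT] at hk; exact_mod_cast hk⟩
    have h1 : ∀ᵐ x ∂μ, x ∈ {x | ∃ k : ℕ, τ k x ∈ A} := by
      rcases hT.ae_empty_or_univ_of_preimage_ae_le hBm.nullMeasurableSet hle with h | h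
      · refine absurd (measure_mono_null ?_ (ae_eq_empty.1 h)) hApos.ne'
        intro x hx
        exact ⟨0, by simpa [hτ] using hx⟩
      · exact eventuallyEq_univ.1 h
    filter_upwards [(τp 1).quasiMeasurePreserving.ae h1] with x hx
    obtain ⟨k, hk⟩ := hx
    exact ⟨k + 1, by omega, by rw [τa] at hk; exact_mod_cast hk⟩
  have hmain : ∀ᵐ x ∂μ, ∃ k s : ℕ, τ (-k) x ∈ A ∧ 0 < s ∧ τ s x ∈ A ∧
      ∀ i : ℕ, (i + 1) * N ≤ k + s → τ ((i * N : ℕ) - (k : ℤ)) x ∈ D := by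
    filter_upwards [hpast, hfut] with x hx1 hx2
    classical
    refine ⟨Nat.find hx1, Nat.find hx2, Nat.find_spec hx1, (Nat.find_spec hx2).1,
      (Nat.find_spec hx2).2, fun i hi => ⟨i, ?_, fun j hj hji => ?_⟩⟩
    · rw [τa]
      have := Nat.find_spec hx1
      convert this using 2; ring
    · rw [τa]
      have he : (j : ℤ) - (i * N : ℕ) + ((i * N : ℕ) - (Nat.find hx1 : ℤ)) = j - Nat.find hx1 := by
        ring
      rw [he]
      rcases le_or_gt j (Nat.find hx1) with h | h
      · have := Nat.find_min hx1 (m := Nat.find hx1 - j) (by omega)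
        convert this using 3
        push_cast [Nat.cast_sub h]; ring
      · have := Nat.find_min hx2 (m := j - Nat.find hx1) (by omega)
        simp only [not_and] at this
        have := this (by omega)
        convert this using 3
        push_cast [Nat.cast_sub h.le]; ring
  have hAD : ∀ x ∈ A, x ∈ D := by
    intro x hx
    refine ⟨0, by simpa [hτ] using hx, fun j hj hjN => ?_⟩
    have := hAret x hx j hj (by simpa using hjN)
    simpa using this
  refine ⟨D, hDm, ?_, ?_, ?_⟩
  · rintro x ⟨i, hi, hi2⟩ s hs hsN ⟨i', hi', hi2'⟩
    rw [τa] at hi'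
    simp only [τa] at hi2'
    rcases lt_trichotomy (i' * N) (i * N + s) with h | h | h
    · refine hi2 (i * N + s - i' * N) (by omega) ?_ ?_
      · have : (i + 1) * N = i * N + N := by ring
        omega
      · convert hi' using 2
        push_cast [Nat.cast_sub h.le]; ring
    · have h1 : i' * N % N = 0 := Nat.mul_mod_left _ _
      rw [h, add_comm, Nat.add_mul_mod_self_right, Nat.mod_eq_of_lt hsN] at h1
      omega
    · refine hi2' (i' * N - (i * N + s)) (by omega) ?_ ?_
      · have : (i' + 1) * N = i' * N + N := by ring
        omega
      · convert hi using 2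
        push_cast [Nat.cast_sub h.le]; ring
  · filter_upwards [hmain] with x ⟨k, s, hk, hs0, hs, hD'⟩
    set i := (k + N - 1) / N with hi
    have hi1 : k ≤ i * N := by
      have : k + N - 1 < i * N + N := Nat.lt_div_mul_add hN
      omega
    have hi2 : i * N ≤ k + N - 1 := Nat.div_mul_le_self _ _
    by_cases h : (i + 1) * N ≤ k + s
    · refine ⟨i * N - k, by omega, ?_⟩
      have := hD' i h
      rwa [← Nat.cast_sub hi1] at this
    · refine ⟨s, ?_, hAD _ hs⟩
      have : (i + 1) * N = i * N + N := by ring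
      omega
  · have hsub : {x | ∀ i : ℕ, i < N → τ (-i) x ∉ D} ≤ᵐ[μ]
        ⋃ s ∈ Finset.range N, τ (s : ℕ) ⁻¹' A := by
      filter_upwards [hmain] with x ⟨k, s, hk, hs0, hs, hD'⟩ hx
      have hx' : ∀ i : ℕ, i < N → τ (-i) x ∉ D := hx
      change x ∈ ⋃ s ∈ Finset.range N, τ (s : ℕ) ⁻¹' A
      simp only [mem_iUnion, Finset.mem_range, exists_prop]
      refine ⟨s, ?_, hs⟩
      set i := k / N with hi
      have hi1 : i * N ≤ k := Nat.div_mul_le_self _ _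
      have hi2 : k < i * N + N := Nat.lt_div_mul_add hN
      by_contra hsN
      refine hx' (k - i * N) (by omega) ?_
      have := hD' i (by rw [add_mul]; omega)
      convert this using 2
      push_cast [Nat.cast_sub hi1]; ring
    have h2 : μ.real (⋃ s ∈ Finset.range N, τ (s : ℕ) ⁻¹' A) ≤ ∑ s ∈ Finset.range N, μ.real A := by
      refine (measureReal_biUnion_finset_le _ _).trans (Finset.sum_le_sum fun i _ => le_of_eq ?_)
      exact congrArg ENNReal.toReal ((τp i).measure_preimage hAm.nullMeasurableSet)
    refine (ENNReal.toReal_mono (measure_ne_top _ _) (measure_mono_ae hsub)).trans (h2.trans ?_)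
    simp only [Finset.sum_const, Finset.card_range, nsmul_eq_mul]
    rw [lt_div_iff₀ (by positivity)] at hAlt
    linarith

/-- Marker sets whose translates cover almost everything and which rarely meet a given set. -/
theorem exists_marker [StandardBorelSpace X] [NullSingletonClass μ] {T : X ≃ᵐ X}
    (hT : Ergodic T μ) {N : ℕ} (hN : 0 < N) {δ : ℝ} (hδ : 0 < δ) {Bad : Set X}
    (hBad : MeasurableSet Bad) :
    ∃ D : Set X, MeasurableSet D ∧
      (∀ x ∈ D, ∀ i : ℕ, 0 < i → i < N → zit T.toEquiv i x ∉ D) ∧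
      (∀ᵐ x ∂μ, ∃ i : ℕ, i < 2 * N ∧ zit T.toEquiv i x ∈ D) ∧
      μ.real {x | ∀ i : ℕ, i < N → zit T.toEquiv (-i) x ∉ D} ≤ δ ∧
      N * μ.real (D ∩ Bad) ≤ μ.real Bad := by
  obtain ⟨D, hDm, h1, h2, h3⟩ := exists_premarker (μ := μ) hT hN hδ
  set τ := zit T.toEquiv with hτ
  have τm : ∀ k, Measurable (τ k) := measurable_zit T
  have τp : ∀ k, MeasurePreserving (τ k) μ μ := measurePreserving_zit T hT.toMeasurePreserving
  have τa : ∀ a b x, τ a (τ b x) = τ (a + b) x := zit_add T.toEquiv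
  have hsum : ∑ i ∈ Finset.range N, μ.real (τ (-(i : ℕ)) ⁻¹' D ∩ Bad) ≤ μ.real Bad := by
    rw [← measureReal_biUnion_finset]
    · exact measureReal_mono (iUnion₂_subset fun i _ => inter_subset_right)
    · intro i hi j hj hij
      refine Disjoint.mono inter_subset_left inter_subset_left (Set.disjoint_left.2 ?_)
      intro x hx hx'
      have hi := Finset.mem_range.1 hi
      have hj := Finset.mem_range.1 hj
      rcases lt_or_gt_of_ne hij with h | h
      · refine h1 _ hx' (j - i) (by omega) (by omega) ?_
        rw [τa]
        have : ((j - i : ℕ) : ℤ) + -(j : ℕ) = -(i : ℕ) := by push_cast [Nat.cast_sub h.le]; ring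
        rw [this]; exact hx
      · refine h1 _ hx (i - j) (by omega) (by omega) ?_
        rw [τa]
        have : ((i - j : ℕ) : ℤ) + -(i : ℕ) = -(j : ℕ) := by push_cast [Nat.cast_sub h.le]; ring
        rw [this]; exact hx'
    · exact fun i _ => (τm _ hDm).inter hBad
  obtain ⟨i, hi, hile⟩ : ∃ i ∈ Finset.range N,
      μ.real (τ (-(i : ℕ)) ⁻¹' D ∩ Bad) ≤ μ.real Bad / N := by
    refine Finset.exists_le_of_sum_le (by simpa using hN.ne') ?_
    refine hsum.trans (le_of_eq ?_)
    simp
    field_simp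
  refine ⟨τ (-(i : ℕ)) ⁻¹' D, τm _ hDm, ?_, ?_, ?_, ?_⟩
  · intro x hx j hj hjN hx'
    refine h1 _ hx j hj hjN ?_
    rw [τa, add_comm, ← τa]
    exact hx'
  · filter_upwards [(τp (-(i : ℕ))).quasiMeasurePreserving.ae h2] with x ⟨j, hj, hx⟩
    refine ⟨j, hj, ?_⟩
    rw [τa] at hx
    rw [mem_preimage, τa, add_comm]
    exact hx
  · refine le_trans (le_of_eq ?_) h3
    have hm : MeasurableSet {x | ∀ i : ℕ, i < N → τ (-i) x ∉ D} := by
      have : {x | ∀ i : ℕ, i < N → τ (-i) x ∉ D} =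
        ⋂ i : ℕ, ⋂ (_ : i < N), (τ (-i) ⁻¹' D)ᶜ := by ext; simp
      rw [this]
      exact MeasurableSet.iInter fun i => MeasurableSet.iInter fun _ => (τm _ hDm).compl
    rw [Measure.real, Measure.real, ← (τp (-(i : ℕ))).measure_preimage hm.nullMeasurableSet]
    congr 2
    ext x
    simp only [mem_ofPred_eq, mem_preimage, τa]
    refine forall₂_congr fun j _ => ?_
    rw [add_comm]
  · rw [le_div_iff₀ (by positivity)] at hile
    linarith

end Markers

section Shadowing

variable {Y : Type*} [MetricSpace Y]

/-- `y` stays within `r` of `z` during the first `n` iterates. -/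
def Shadows (e : Y ≃ Y) (r : ℝ) (n : ℕ) (y z : Y) : Prop :=
  ∀ i : ℕ, i < n → dist (zit e i y) (zit e i z) ≤ r

lemma Shadows.mono {e : Y ≃ Y} {r s : ℝ} {n m : ℕ} {y z : Y} (h : Shadows e r n y z)
    (hr : r ≤ s) (hn : m ≤ n) : Shadows e s m y z :=
  fun i hi => (h i (hi.trans_le hn)).trans hr

lemma Shadows.trans {e : Y ≃ Y} {r s : ℝ} {n : ℕ} {x y z : Y} (h : Shadows e r n x y)
    (h' : Shadows e s n y z) : Shadows e (r + s) n x z :=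
  fun i hi => (dist_triangle _ _ _).trans (add_le_add (h i hi) (h' i hi))

lemma Shadows.symm {e : Y ≃ Y} {r : ℝ} {n : ℕ} {x y : Y} (h : Shadows e r n x y) :
    Shadows e r n y x :=
  fun i hi => by rw [dist_comm]; exact h i hi

lemma Shadows.shift {e : Y ≃ Y} {r : ℝ} {n : ℕ} {x y : Y} (h : Shadows e r n x y) (k : ℕ) :
    Shadows e r (n - k) (zit e k x) (zit e k y) := by
  intro i hi
  rw [zit_add, zit_add, ← Nat.cast_add]
  exact h _ (by omega)

/-- Specification for a finite family of orbit segments with prescribed starting times. -/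
lemma IsGapFunction.exists_shadow {e : Y ≃ Y} {ε : ℝ} {L : ℕ → ℕ} (hL : IsGapFunction e ε L)
    (F : Finset ℤ) (len : ℤ → ℕ) (pt : ℤ → Y)
    (h : ∀ i ∈ F, ∀ j ∈ F, i < j → i + len i + L (len j) ≤ j) :
    ∃ z, ∀ i ∈ F, Shadows e ε (len i) (zit e i z) (pt i) := by
  set s : Fin F.card → ℤ := fun i => F.orderEmbOfFin rfl i with hs
  have hsF : ∀ i, s i ∈ F := fun i => F.orderEmbOfFin_mem rfl i
  obtain ⟨z, hz⟩ := hL.2.2 F.card (fun i => zit e (-(s i)) (pt (s i))) s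
    (fun i => s i + len (s i)) (fun i => by simp) (fun i j hij => by
      have hlt : s i < s j := (F.orderEmbOfFin rfl).strictMono (by
        rw [Fin.lt_def]; omega)
      have := h _ (hsF i) _ (hsF j) hlt
      simp only [add_sub_cancel_left, Int.toNat_natCast]
      omega)
  refine ⟨z, fun i hi k hk => ?_⟩
  obtain ⟨j, rfl⟩ : ∃ j, s j = i := by
    have : i ∈ Set.range s := by rw [hs, Finset.range_orderEmbOfFin]; exact hi
    exact this
  have := hz j (s j + k) (by omega) (by omega)
  change dist (zit e (s j + k) z) (zit e (s j + k) (zit e (-(s j)) (pt (s j)))) ≤ ε at this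
  rw [zit_add] at this ⊢
  convert this using 2
  · rw [add_comm]
  · congr 1; ring

end Shadowing

section Separation

variable {Y : Type*} [MetricSpace Y]

lemma exists_separated (e : Y ≃ Y) {a : ℝ} (h : (a : EReal) < topEntropy e) :
    ∃ δ > 0, ∀ N : ℕ, ∃ m ≥ N, ∃ E : Finset Y, Real.exp (a * m) ≤ E.card ∧
      ∀ x ∈ E, ∀ y ∈ E, Shadows e (δ / 2) m x y → x = y := by
  rw [topEntropy, Dynamics.coverEntropy_eq_iSup_basis_netEntropyEntourage
    Metric.uniformity_basis_dist] at h
  obtain ⟨δ, h⟩ := lt_iSup_iff.1 h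
  obtain ⟨hδ, h⟩ := lt_iSup_iff.1 h
  refine ⟨δ, hδ, fun N => ?_⟩
  obtain ⟨m, hm, hN⟩ := ((ExpGrowth.frequently_exp_le h).and_eventually
    (eventually_ge_atTop (N + 1))).exists
  rw [show ((a : EReal) * (m : EReal)) = ((a * m : ℝ) : EReal) by push_cast; rfl,
    EReal.exp_coe] at hm
  set K := ⌈Real.exp (a * m)⌉₊ with hK
  have hK0 : 0 < K := Nat.ceil_pos.2 (Real.exp_pos _)
  have h1 : (K : ℕ∞) ≤ Dynamics.netMaxcard e univ {p | dist p.1 p.2 < δ} m := by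
    generalize Dynamics.netMaxcard e univ {p | dist p.1 p.2 < δ} m = M at hm
    induction M using ENat.recTopCoe with
    | top => exact le_top
    | coe n =>
      have : Real.exp (a * m) ≤ n := by
        have h2 : ENNReal.ofReal (Real.exp (a * m)) ≤ (n : ℝ≥0∞) := by simpa using hm
        rw [← ENNReal.ofReal_natCast] at h2
        exact (ENNReal.ofReal_le_ofReal_iff (Nat.cast_nonneg _)).1 h2
      exact_mod_cast Nat.ceil_le.2 this
  have h2 : ((K - 1 : ℕ) : ℕ∞) < Dynamics.netMaxcard e univ {p | dist p.1 p.2 < δ} m :=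
    lt_of_lt_of_le (by exact_mod_cast Nat.sub_lt hK0 one_pos) h1
  obtain ⟨E, h2⟩ := lt_iSup_iff.1 h2
  obtain ⟨hE, h2⟩ := lt_iSup_iff.1 h2
  have h3 : K ≤ E.card := by
    have : K - 1 < E.card := by exact_mod_cast h2
    omega
  refine ⟨m, by omega, E, (Nat.le_ceil _).trans (by exact_mod_cast h3), fun x hx y hy hxy => ?_⟩
  refine hE.2.elim_set hx hy y ?_ ?_
  · rw [Dynamics.mem_ball_dynEntourage]
    intro k hk
    have := hxy k hk
    simp only [zit_natCast] at this
    exact lt_of_le_of_lt this (by linarith)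
  · rw [Dynamics.mem_ball_dynEntourage]
    intro k hk
    change dist _ _ < δ
    rw [dist_self]; exact hδ

end Separation

section BaseCode

variable {Y : Type*} [MetricSpace Y]

lemma continuous_zit (S : Y ≃ₜ Y) (k : ℤ) : Continuous (zit S.toEquiv k) := by
  obtain ⟨n, rfl | rfl⟩ := k.eq_nat_or_neg
  · have : zit S.toEquiv n = S^[n] := funext fun x => (zit_natCast _ n x)
    rw [this]; exact S.continuous.iterate n
  · have : zit S.toEquiv (-n) = S.symm^[n] := funext fun x => (zit_symm _ n x)
    rw [this]; exact S.symm.continuous.iterate n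

lemma isClosed_shadows (S : Y ≃ₜ Y) (r : ℝ) (n : ℕ) (a : ℤ) (z : Y) :
    IsClosed {y | Shadows S.toEquiv r n (zit S.toEquiv a y) z} := by
  simp only [Shadows, ofPred_forall]
  refine isClosed_iInter fun i => isClosed_iInter fun _ => isClosed_le ?_ continuous_const
  exact (((continuous_zit S i).comp (continuous_zit S a)).dist continuous_const)

lemma exists_past_shadow [CompactSpace Y] (S : Y ≃ₜ Y) {ε : ℝ} {L : ℕ → ℕ}
    (hL : IsGapFunction S.toEquiv ε L) (v x : Y) (n m : ℕ) {r : ℕ} (hr : m + L m = r) :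
    ∃ p, Shadows S.toEquiv ε n p v ∧
      ∀ j : ℕ, 0 < j → Shadows S.toEquiv ε m (zit S.toEquiv (-(L n + j * r)) p) x := by
  set e := S.toEquiv
  set t : ℕ → Set Y := fun J => {p | Shadows e ε n (zit e 0 p) v} ∩
    ⋂ j : ℕ, ⋂ _ : 0 < j ∧ j ≤ J, {p | Shadows e ε m (zit e (-(L n + j * r)) p) x} with ht
  have hrpos : 0 < r := by have := hL.2.1 m; omega
  have hcl : ∀ J, IsClosed (t J) := fun J => (isClosed_shadows S _ _ _ _).inter
    (isClosed_iInter fun j => isClosed_iInter fun _ => isClosed_shadows S _ _ _ _)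
  have hne : ∀ J, (t J).Nonempty := by
    intro J
    classical
    obtain ⟨z, hz⟩ := IsGapFunction.exists_shadow hL
      (insert 0 ((Finset.Icc 1 J).image fun j : ℕ => -((L n : ℤ) + j * r)))
      (fun i => if i = 0 then n else m) (fun i => if i = 0 then v else x) (by
        have hneg : ∀ j : ℕ, 1 ≤ j → -((L n : ℤ) + j * r) < 0 := by
          intro j hj
          have : (0 : ℤ) < j * r := by positivity
          omega
        intro i hi j hj hij
        simp only [Finset.mem_insert, Finset.mem_image, Finset.mem_Icc] at hi hj
        rcases hi with rfl | ⟨a, ha, rfl⟩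
        · rcases hj with rfl | ⟨b, hb, rfl⟩
          · exact absurd hij (lt_irrefl _)
          · have := hneg b hb.1; omega
        · have ha' := hneg a ha.1
          rw [if_neg ha'.ne]
          rcases hj with rfl | ⟨b, hb, rfl⟩
          · rw [if_pos rfl]
            have : (r : ℤ) ≤ a * r := by
              have : (1 : ℤ) ≤ a := by exact_mod_cast ha.1
              nlinarith
            omega
          · have hb' := hneg b hb.1
            rw [if_neg hb'.ne]
            have h1 : (b : ℤ) * r < a * r := by linarith
            have h2 : (b : ℤ) < a := lt_of_mul_lt_mul_right h1 (by positivity)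
            have h3 : ((b : ℤ) + 1) * r ≤ a * r := by
              apply mul_le_mul_of_nonneg_right h2; positivity
            have h4 : (m : ℤ) + L m = r := by exact_mod_cast hr
            linarith)
    refine ⟨z, ?_, ?_⟩
    · have := hz 0 (by simp)
      simpa using this
    · simp only [mem_iInter]
      intro j hj
      have h0 : -((L n : ℤ) + j * r) ≠ 0 := by
        have : (0 : ℤ) < j * r := by have := hj.1; positivity
        omega
      have := hz (-((L n : ℤ) + j * r)) (by
        refine Finset.mem_insert_of_mem (Finset.mem_image.2 ⟨j, by simp; omega, rfl⟩))
      simp only [if_neg h0] at this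
      exact this
  obtain ⟨p, hp⟩ := IsCompact.nonempty_iInter_of_sequence_nonempty_isCompact_isClosed t
    (fun J => inter_subset_inter_right _ (by
      intro y hy
      simp only [mem_iInter] at hy ⊢
      exact fun j hj => hy j ⟨hj.1, by omega⟩)) hne (hcl 0).isCompact hcl
  rw [mem_iInter] at hp
  refine ⟨p, by simpa using (hp 0).1, fun j hj => ?_⟩
  have := (hp j).2
  simp only [mem_iInter] at this
  exact this j ⟨hj, le_rfl⟩

lemma exists_seed [CompactSpace Y] (S : Y ≃ₜ Y) (hspec : AlmostWeakSpec S.toEquiv) {h : ℝ}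
    (hh : 0 ≤ h) (htop : (h : EReal) < topEntropy S) :
    ∃ h₂ e₁ : ℝ, ∃ m r G : ℕ, ∃ v x₀ p : Y, ∃ E : Finset Y, h < h₂ ∧ 0 < e₁ ∧ m ≤ r ∧ 0 < r ∧
      (∀ (q : ℕ) (x : ℕ → Y), ∃ c, ∀ j < q,
        Shadows S.toEquiv e₁ m (zit S.toEquiv (j * r : ℕ) c) (x j)) ∧
      (∀ x ∈ E, ∀ y ∈ E, Shadows S.toEquiv (4 * e₁) m x y → x = y) ∧
      Real.exp (r * h₂) ≤ E.card ∧
      (∀ u ≤ 2 * r, ∀ x ∈ E, ¬ Shadows S.toEquiv (4 * e₁) m (zit S.toEquiv u v) x) ∧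
      Shadows S.toEquiv e₁ (3 * r) p v ∧ x₀ ∈ E ∧
      ∀ j : ℕ, 0 < j → Shadows S.toEquiv e₁ m (zit S.toEquiv (-(G + j * r)) p) x₀ := by
  classical
  set e := S.toEquiv
  obtain ⟨h₁, hh₁, htop₁⟩ := EReal.lt_iff_exists_real_btwn.1 htop
  have hh₁ : h < h₁ := by exact_mod_cast hh₁
  obtain ⟨h₃, hh₃, h31⟩ := exists_between hh₁
  obtain ⟨h₂, hh₂, h23⟩ := exists_between hh₃
  obtain ⟨δ, hδ, hsep⟩ := exists_separated e htop₁
  obtain ⟨L, hL, hL0⟩ := hspec (δ / 16) (by positivity)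
  obtain ⟨θ, hθ, hθ1, hθ2⟩ : ∃ θ : ℝ, 0 < θ ∧ θ ≤ 1 ∧ (1 + θ) * h₂ ≤ h₃ := by
    have h2p : 0 < h₂ := hh.trans_lt hh₂
    refine ⟨min 1 ((h₃ - h₂) / h₂), by have := sub_pos.2 h23; positivity, min_le_left _ _, ?_⟩
    have : min 1 ((h₃ - h₂) / h₂) * h₂ ≤ h₃ - h₂ := by
      calc _ ≤ (h₃ - h₂) / h₂ * h₂ := by gcongr; exact min_le_right _ _
        _ = _ := by field_simp
    linarith
  have hexp : ∀ᶠ m : ℕ in atTop, 4 * (m : ℝ) + 3 ≤ Real.exp ((h₁ - h₃) * m) := by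
    have hk : 0 < h₁ - h₃ := sub_pos.2 h31
    have h0 : Tendsto (fun m : ℕ => (h₁ - h₃) ^ 2 / 2 * (m : ℝ)) atTop atTop :=
      tendsto_natCast_atTop_atTop.const_mul_atTop (by positivity)
    filter_upwards [h0.eventually_ge_atTop 7, eventually_ge_atTop 1] with m hm hm1
    have h1 := Real.quadratic_le_exp_of_nonneg (x := (h₁ - h₃) * m) (by positivity)
    have hm1' : (1 : ℝ) ≤ m := by exact_mod_cast hm1
    have h2 : ((h₁ - h₃) * m) ^ 2 / 2 = (h₁ - h₃) ^ 2 / 2 * m * m := by ring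
    have h3 : 0 ≤ (h₁ - h₃) * m := by positivity
    nlinarith
  obtain ⟨N, hN⟩ := eventually_atTop.1 (hexp.and ((hL0.eventually (ge_mem_nhds hθ)).and
    (eventually_ge_atTop 1)))
  obtain ⟨m, hm, E, hE, hEsep⟩ := hsep N
  obtain ⟨hm1, hm2, hm3⟩ := hN m hm
  have hmpos : (0 : ℝ) < m := by exact_mod_cast hm3
  rw [div_le_iff₀ hmpos] at hm2
  set r := m + L m with hr
  have hrθ : (r : ℝ) ≤ (1 + θ) * m := by rw [hr]; push_cast; linarith
  have hE0 : E.Nonempty := by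
    rw [← Finset.card_pos]
    have := (Real.exp_pos (h₁ * m)).trans_le hE
    exact_mod_cast this
  obtain ⟨v, -⟩ := hE0
  set E' := E.filter fun x => ∀ u ≤ 2 * r, ¬ Shadows e (4 * (δ / 16)) m (zit e u v) x with hE'
  have hcard : E.card ≤ E'.card + (2 * r + 1) := by
    have hsub : E ⊆ E' ∪ (Finset.range (2 * r + 1)).biUnion fun u =>
        E.filter fun x => Shadows e (4 * (δ / 16)) m (zit e u v) x := by
      intro x hx
      by_cases hx' : x ∈ E'
      · exact Finset.mem_union_left _ hx'
      · simp only [hE', Finset.mem_filter, hx, true_and, not_forall, not_not] at hx'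
        obtain ⟨u, hu, hx'⟩ := hx'
        refine Finset.mem_union_right _ (Finset.mem_biUnion.2 ⟨u, by simp; omega, ?_⟩)
        simp [hx, hx']
    refine (Finset.card_le_card hsub).trans ((Finset.card_union_le _ _).trans
      (Nat.add_le_add_left ?_ _))
    refine (Finset.card_biUnion_le_card_mul _ _ 1 fun u _ => ?_).trans (by simp)
    refine Finset.card_le_one.2 fun x hx y hy => ?_
    rw [Finset.mem_filter] at hx hy
    exact hEsep x hx.1 y hy.1 ((hx.2.symm.trans hy.2).mono (by linarith) le_rfl)
  have hE'card : Real.exp (r * h₂) ≤ E'.card := by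
    have h1 : (E.card : ℝ) ≤ E'.card + (2 * r + 1) := by exact_mod_cast hcard
    have h2 : Real.exp (h₁ * m) = Real.exp (h₃ * m) * Real.exp ((h₁ - h₃) * m) := by
      rw [← Real.exp_add]; ring_nf
    have h3 : Real.exp (r * h₂) ≤ Real.exp (h₃ * m) := by
      refine Real.exp_le_exp.2 ?_
      have : (r : ℝ) * h₂ ≤ ((1 + θ) * m) * h₂ := by
        have : 0 ≤ h₂ := (hh.trans_lt hh₂).le
        gcongr
      nlinarith
    have h4 : (1 : ℝ) ≤ Real.exp (h₃ * m) := by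
      refine Real.one_le_exp ?_
      have := hh.trans_lt (hh₂.trans h23)
      positivity
    have h5 : (r : ℝ) ≤ 2 * m := by nlinarith
    have h6 : Real.exp (h₃ * m) * (4 * m + 3) ≤ Real.exp (h₁ * m) := by
      rw [h2]; gcongr
    nlinarith
  obtain ⟨x₀, hx₀⟩ : E'.Nonempty := by
    rw [← Finset.card_pos]
    have := (Real.exp_pos _).trans_le hE'card
    exact_mod_cast this
  obtain ⟨p, hp1, hp2⟩ := exists_past_shadow S hL v x₀ (3 * r) m hr.symm
  refine ⟨h₂, δ / 16, m, r, L (3 * r), v, x₀, p, E', hh₂, by positivity, by omega, by omega, ?_,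
    ?_, hE'card, ?_, hp1, hx₀, hp2⟩
  · intro q x
    obtain ⟨c, hc⟩ := IsGapFunction.exists_shadow hL
      ((Finset.range q).image fun j : ℕ => ((j * r : ℕ) : ℤ)) (fun _ => m)
      (fun i => x (i.toNat / r)) (by
        intro i hi j hj hij
        simp only [Finset.mem_image, Finset.mem_range] at hi hj
        obtain ⟨a, ha, rfl⟩ := hi
        obtain ⟨b, hb, rfl⟩ := hj
        have h1 : a < b := lt_of_mul_lt_mul_right (by exact_mod_cast hij) (Nat.zero_le r)
        have h2 : (a + 1) * r ≤ b * r := Nat.mul_le_mul_right _ h1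
        rw [add_mul] at h2
        omega)
    refine ⟨c, fun j hj => ?_⟩
    have := hc ((j * r : ℕ) : ℤ) (Finset.mem_image.2 ⟨j, by simpa, rfl⟩)
    rwa [Int.toNat_natCast, Nat.mul_div_cancel _ (by omega)] at this
  · intro x hx y hy hxy
    exact hEsep x (Finset.mem_filter.1 hx).1 y (Finset.mem_filter.1 hy).1
      (hxy.mono (by linarith) le_rfl)
  · intro u hu x hx
    exact (Finset.mem_filter.1 hx).2 u hu

end BaseCode

section BaseCode

variable {Y : Type*} [MetricSpace Y]

/-- A finite code of orbit segments which cannot overlap, of exponential rate `rate`. -/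
structure BaseCode (e : Y ≃ Y) where
  rate : ℝ
  ε : ℝ
  len : ℕ
  R : ℕ
  A : ℕ
  w : Option (Option (Fin A)) → Y
  ε_pos : 0 < ε
  len_pos : 0 < len
  len_le : len ≤ R
  card_le : Real.exp (R * rate) ≤ A
  no_overlap : ∀ (y : Y) (t : ℕ) (σ σ' : Option (Option (Fin A))), 2 * t ≤ R →
    Shadows e ε len y (w σ) → Shadows e ε len (zit e t y) (w σ') → t = 0 ∧ σ = σ'
  concat : ∀ (q : ℕ) (σ : ℕ → Option (Option (Fin A))), ∃ z, ∀ j < q,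
    Shadows e (ε / 2) len (zit e (j * R : ℕ) z) (w (σ j))

lemma eventually_le_mul_of_div_tendsto {L : ℕ → ℕ}
    (hL : Tendsto (fun m : ℕ => (L m : ℝ) / m) atTop (nhds 0)) {θ : ℝ} (hθ : 0 < θ) :
    ∀ᶠ n : ℕ in atTop, (L n : ℝ) ≤ θ * n := by
  filter_upwards [hL.eventually (ge_mem_nhds hθ), eventually_ge_atTop 1] with n hn hn1
  have : (0 : ℝ) < n := by exact_mod_cast hn1
  rwa [div_le_iff₀ this] at hn

lemma exists_code_length {L L' : ℕ → ℕ}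
    (hL : Tendsto (fun m : ℕ => (L m : ℝ) / m) atTop (nhds 0))
    (hL' : Tendsto (fun m : ℕ => (L' m : ℝ) / m) atTop (nhds 0))
    {a b : ℝ} (ha : 0 ≤ a) (hab : a < b) {r : ℕ} (hr : 0 < r) (c : ℕ) :
    ∃ Q : ℕ, 0 < Q ∧ L' (2 * (c + L (Q * r)) + Q * r) + 6 * r ≤ Q * r ∧
      ((2 * (c + L (Q * r)) + Q * r + L' (2 * (c + L (Q * r)) + Q * r) : ℕ) : ℝ) * a + 2 ≤
        (Q * r : ℕ) * b := by
  obtain ⟨θ, hθ, hθ1, hθ2⟩ : ∃ θ : ℝ, 0 < θ ∧ θ ≤ 1 / 20 ∧ 5 * θ * a ≤ (b - a) / 2 := by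
    refine ⟨min (1 / 20) ((b - a) / (10 * (a + 1))), ?_, min_le_left _ _, ?_⟩
    · have := sub_pos.2 hab; positivity
    · have : min (1 / 20) ((b - a) / (10 * (a + 1))) * (a + 1) ≤ (b - a) / 10 := by
        calc _ ≤ (b - a) / (10 * (a + 1)) * (a + 1) := by gcongr; exact min_le_right _ _
          _ = _ := by field_simp
      have h0 : 0 ≤ min (1 / 20) ((b - a) / (10 * (a + 1))) := by
        have := sub_pos.2 hab; positivity
      nlinarith
  have hev : ∀ᶠ n : ℕ in atTop, (L n : ℝ) ≤ θ * n ∧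
      (L' (2 * (c + L n) + n) : ℝ) ≤ θ * (2 * (c + L n) + n : ℕ) ∧ 2 * (c : ℝ) ≤ θ * n ∧
      6 * (r : ℝ) ≤ n / 2 ∧ 2 ≤ n * ((b - a) / 2) := by
    have h1 := tendsto_natCast_atTop_atTop (R := ℝ)
    refine (eventually_le_mul_of_div_tendsto hL hθ).and (Eventually.and ?_ (Eventually.and ?_
      (Eventually.and ?_ ?_)))
    · have : Tendsto (fun n => 2 * (c + L n) + n) atTop atTop :=
        tendsto_atTop_mono (fun n => by simp only [id]; omega) tendsto_id
      exact this.eventually (eventually_le_mul_of_div_tendsto hL' hθ)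
    · exact (h1.const_mul_atTop hθ).eventually_ge_atTop _
    · exact (h1.atTop_div_const two_pos).eventually_ge_atTop _
    · exact (h1.atTop_mul_const (by linarith)).eventually_ge_atTop _
  have hQ : Tendsto (fun Q : ℕ => Q * r) atTop atTop :=
    tendsto_atTop_mono (fun n => Nat.le_mul_of_pos_right _ hr) tendsto_id
  obtain ⟨Q, ⟨h1, h2, h3, h4, h5⟩, hQ0⟩ := ((hQ.eventually hev).and (eventually_gt_atTop 0)).exists
  refine ⟨Q, hQ0, ?_, ?_⟩
  · generalize Q * r = n at *
    have : ((L' (2 * (c + L n) + n) + 6 * r : ℕ) : ℝ) ≤ n := by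
      push_cast at h2 ⊢
      nlinarith
    exact_mod_cast this
  · generalize Q * r = n at *
    push_cast at h2 ⊢
    have h6 : 2 * ((c : ℝ) + L n) + n ≤ (1 + 3 * θ) * n := by nlinarith
    have h7 : (L' (2 * (c + L n) + n) : ℝ) ≤ 2 * θ * n := by nlinarith
    have h8 : (2 * ((c : ℝ) + L n) + n + L' (2 * (c + L n) + n)) * a ≤ ((1 + 5 * θ) * n) * a := by
      gcongr; linarith
    nlinarith

theorem exists_baseCode [CompactSpace Y] (S : Y ≃ₜ Y) (hspec : AlmostWeakSpec S.toEquiv) {h : ℝ}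
    (hh : 0 ≤ h) (htop : (h : EReal) < topEntropy S) :
    ∃ B : BaseCode S.toEquiv, h < B.rate := by
  classical
  obtain ⟨h₂, e₁, m, r, G, v, x₀, p, E, hh₂, he₁, hmr, hr, hslot, hEsep, hEcard, hEv, hpv, hx₀,
    hpx⟩ := exists_seed S hspec hh htop
  set e := S.toEquiv
  obtain ⟨a, ha, ha2⟩ := exists_between hh₂
  -- a run of `v` is never aligned with the past of `p`
  have hstar : ∀ (t : ℕ) (s s' : ℝ) (y : Y), G + 3 * r ≤ t → s + s' ≤ 2 * e₁ →
      Shadows e s (3 * r) y p → Shadows e s' (3 * r) y (zit e (-t) p) → False := by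
    intro t s s' y ht hs hy hy'
    have hjG : (t - G) / r * r ≤ t - G := Nat.div_mul_le_self _ _
    have hjG' : t - G < (t - G) / r * r + r := Nat.lt_div_mul_add hr
    set j := (t - G) / r
    have hj : 0 < j := by
      rcases Nat.eq_zero_or_pos j with h0 | h0
      · rw [h0] at hjG'; omega
      · exact h0
    have h1 : Shadows e s' m (zit e (t - G - j * r : ℕ) y) (zit e (-(G + j * r)) p) := by
      have := (hy'.shift (t - G - j * r)).mono le_rfl (show m ≤ _ by omega)
      rw [zit_add] at this
      convert this using 2
      push_cast [Nat.cast_sub hjG, Nat.cast_sub (show G ≤ t by omega)]; ring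
    have h2 : Shadows e (s + e₁) m (zit e (t - G - j * r : ℕ) y)
        (zit e (t - G - j * r : ℕ) v) :=
      ((hy.trans hpv).shift (t - G - j * r)).mono le_rfl (by omega)
    refine hEv (t - G - j * r) (by omega) x₀ hx₀ ?_
    exact (h2.symm.trans (h1.trans (hpx j hj))).mono (by linarith) le_rfl
  have haper : ∀ t : ℕ, 0 < t → zit e t p ≠ p := by
    intro t ht hp
    have hk : ∀ k : ℕ, zit e (-(k * t : ℕ)) p = p := by
      intro k
      induction k with
      | zero => simp
      | succ k ih =>
        have h1 : zit e (-t) p = p := by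
          conv_lhs => rw [← hp]
          rw [zit_add]; simp
        conv_rhs => rw [← ih, ← h1, zit_add]
        congr 1; push_cast; ring
    refine hstar ((G + 3 * r) * t) 0 0 p (Nat.le_mul_of_pos_right _ ht) (by linarith)
      (fun i _ => by simp) (fun i _ => by rw [hk]; simp)
  set T₀ := G + 3 * r with hT₀
  obtain ⟨η, hη, hηe, hηp⟩ : ∃ η > 0, 2 * η ≤ e₁ ∧ ∀ t : ℕ, 0 < t → t ≤ T₀ →
      4 * η < dist p (zit e t p) := by
    have : ∀ T : ℕ, ∃ η > 0, 2 * η ≤ e₁ ∧ ∀ t : ℕ, 0 < t → t ≤ T →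
        4 * η < dist p (zit e t p) := by
      intro T
      induction T with
      | zero => exact ⟨e₁ / 2, by positivity, by linarith, fun t ht ht' => by omega⟩
      | succ T ih =>
        obtain ⟨η, hη, hηe, hηp⟩ := ih
        have hd : 0 < dist p (zit e (T + 1 : ℕ) p) := dist_pos.2 (haper _ (by omega)).symm
        refine ⟨min η (dist p (zit e (T + 1 : ℕ) p) / 5), by positivity,
          by linarith [min_le_left η (dist p (zit e (T + 1 : ℕ) p) / 5)], fun t ht ht' => ?_⟩
        rcases Nat.lt_or_ge T t with h | h
        · obtain rfl : t = T + 1 := by omega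
          linarith [min_le_right η (dist p (zit e (T + 1 : ℕ) p) / 5)]
        · linarith [min_le_left η (dist p (zit e (T + 1 : ℕ) p) / 5), hηp t ht h]
    exact this T₀
  obtain ⟨L, hL, hL0⟩ := hspec η hη
  obtain ⟨L', hL', hL'0⟩ := hspec (η / 2) (by positivity)
  obtain ⟨Q, hQ0, hQ1, hQ2⟩ := exists_code_length hL0 hL'0 (hh.trans ha.le) ha2 hr (T₀ + 1)
  set n₁ := Q * r with hn₁
  set A := T₀ + 1 + L n₁ with hA
  set ℓ := 2 * A + n₁ with hℓ
  set R := ℓ + L' ℓ with hR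
  -- the content words
  have hcode : ∃ (B : ℕ) (c : Option (Option (Fin B)) → Fin Q → E), Function.Injective c ∧
      Real.exp (R * a) ≤ B := by
    refine ⟨Fintype.card (Fin Q → E) - 2, ?_⟩
    have h1 : Real.exp (R * a) + 2 ≤ Fintype.card (Fin Q → E) := by
      have h2 : (Fintype.card (Fin Q → E) : ℝ) = (E.card : ℝ) ^ Q := by simp
      have h3 : Real.exp (n₁ * h₂) ≤ (E.card : ℝ) ^ Q := by
        calc Real.exp (n₁ * h₂) = Real.exp (r * h₂) ^ Q := by
              rw [← Real.exp_nat_mul, hn₁]; push_cast; ring_nf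
          _ ≤ _ := by gcongr
      have h4 : Real.exp (R * a) * Real.exp 2 ≤ Real.exp (n₁ * h₂) := by
        rw [← Real.exp_add]; exact Real.exp_le_exp.2 hQ2
      have h5 : 1 ≤ Real.exp (R * a) := Real.one_le_exp (by
        have := hh.trans_lt ha; positivity)
      have h6 : (3 : ℝ) ≤ Real.exp 2 := by
        have := Real.add_one_le_exp (2 : ℝ); linarith
      rw [h2]; nlinarith
    have h2 : 2 ≤ Fintype.card (Fin Q → E) := by
      have : (2 : ℝ) ≤ Fintype.card (Fin Q → E) := by linarith [Real.exp_pos (R * a)]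
      exact_mod_cast this
    obtain ⟨c⟩ : Nonempty (Option (Option (Fin (Fintype.card (Fin Q → E) - 2))) ≃ (Fin Q → E)) := by
      rw [← Fintype.card_eq]
      simp only [Fintype.card_option, Fintype.card_fin]; omega
    refine ⟨c, c.injective, ?_⟩
    push_cast [Nat.cast_sub h2] at h1 ⊢
    linarith
  obtain ⟨B, c, hc, hB⟩ := hcode
  have hcont : ∀ σ, ∃ z, ∀ j : Fin Q, Shadows e e₁ m (zit e (j * r : ℕ) z) (c σ j) := by
    intro σ
    obtain ⟨z, hz⟩ := hslot Q (fun j => if hj : j < Q then c σ ⟨j, hj⟩ else x₀)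
    refine ⟨z, fun j => ?_⟩
    have := hz j j.2
    simpa using this
  choose z hz using hcont
  have hword : ∀ σ, ∃ w, Shadows e η (A + T₀ + 1) w (zit e (-A) p) ∧
      Shadows e η n₁ (zit e (2 * A : ℕ) w) (z σ) := by
    intro σ
    obtain ⟨w, hw⟩ := IsGapFunction.exists_shadow hL {0, ((2 * A : ℕ) : ℤ)}
      (fun i => if i = 0 then A + T₀ + 1 else n₁) (fun i => if i = 0 then zit e (-A) p else z σ) (by
        have hA0 : 0 < A := by omega
        intro i hi j hj hij
        simp only [Finset.mem_insert, Finset.mem_singleton] at hi hj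
        rcases hi with rfl | rfl <;> rcases hj with rfl | rfl
        · omega
        · rw [if_pos rfl, if_neg (by omega)]; omega
        · omega
        · omega)
    have h1 := hw 0 (by simp)
    have h2 := hw ((2 * A : ℕ) : ℤ) (by simp)
    rw [if_neg (by omega), if_neg (by omega)] at h2
    exact ⟨w, by simpa using h1, h2⟩
  choose w hwp hwc using hword
  -- shifted versions of the two parts of a word
  have hrun : ∀ y σ, Shadows e η ℓ y (w σ) →
      Shadows e (2 * η) (A + T₀ + 1) y (zit e (-A) p) := fun y σ hy =>
    ((hy.mono le_rfl (by omega)).trans (hwp σ)).mono (by linarith) le_rfl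
  have hcon : ∀ y σ, Shadows e η ℓ y (w σ) → ∀ j : Fin Q,
      Shadows e (2 * η + e₁) m (zit e (2 * A + j * r : ℕ) y) (c σ j) := by
    intro y σ hy j
    have h1 : Shadows e (2 * η) n₁ (zit e (2 * A : ℕ) y) (z σ) :=
      (((hy.shift (2 * A)).mono le_rfl (show n₁ ≤ _ by omega)).trans (hwc σ)).mono
        (by linarith) le_rfl
    have h2 := h1.shift (j * r)
    have h3 : (j + 1) * r ≤ Q * r := Nat.mul_le_mul_right _ j.2
    rw [add_mul, one_mul] at h3
    have h4 := (h2.mono le_rfl (show m ≤ _ by omega)).trans (hz σ j)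
    rw [zit_add] at h4
    convert h4 using 2
    push_cast; ring
  refine ⟨⟨a, η, ℓ, R, B, w, hη, by omega, by omega, hB, ?_, ?_⟩, ha⟩
  · intro y t σ σ' ht hy hy'
    have hr1 := hrun y σ hy
    have hr2 := hrun _ σ' hy'
    have ht0 : t = 0 := by
      by_contra ht0
      rcases Nat.lt_or_ge T₀ t with h | h
      · rcases Nat.lt_or_ge A t with h' | h'
        · -- the second run meets the content of the first word
          have hjs : t - A ≤ (t - A + r - 1) / r * r := by
            have := Nat.lt_div_mul_add (a := t - A + r - 1) hr
            omega
          have hjs' : (t - A + r - 1) / r * r ≤ t - A + r - 1 := Nat.div_mul_le_self _ _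
          set j := (t - A + r - 1) / r
          have hjQ : j < Q := by
            by_contra hjQ
            have := Nat.mul_le_mul_right r (not_lt.1 hjQ)
            omega
          have h1 : Shadows e (2 * η + e₁) (3 * r) (zit e (A + t) y) v := by
            have := (hr2.shift A).mono le_rfl (show 3 * r ≤ _ by omega)
            rw [zit_add, zit_add, add_neg_cancel, zit_zero] at this
            exact this.trans hpv
          have h2 := (h1.shift (j * r - (t - A))).mono le_rfl (show m ≤ _ by omega)
          rw [zit_add, show ((j * r - (t - A) : ℕ) : ℤ) + (A + t) = (2 * A + j * r : ℕ) by
            push_cast [Nat.cast_sub hjs, Nat.cast_sub h'.le]; ring] at h2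
          refine hEv (j * r - (t - A)) (by omega) _ (c σ ⟨j, hjQ⟩).2 ?_
          exact (h2.symm.trans (hcon y σ hy ⟨j, hjQ⟩)).mono (by linarith) le_rfl
        · have h1 : Shadows e (2 * η) (3 * r) (zit e A y) p := by
            have := (hr1.shift A).mono le_rfl (show 3 * r ≤ _ by omega)
            rwa [zit_add, add_neg_cancel, zit_zero] at this
          have h2 : Shadows e (2 * η) (3 * r) (zit e A y) (zit e (-t) p) := by
            have := (hr2.shift (A - t)).mono le_rfl (show 3 * r ≤ _ by omega)
            rw [zit_add, zit_add] at this
            convert this using 2 <;> push_cast [Nat.cast_sub h'] <;> ring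
          exact hstar t (2 * η) (2 * η) _ h.le (by linarith) h1 h2
      · have h1 := hr1 (A + t) (by omega)
        have h2 := hr2 A (by omega)
        rw [zit_add] at h1 h2
        rw [zit_add, add_neg_cancel, zit_zero] at h2
        rw [show ((A + t : ℕ) : ℤ) + -A = t by push_cast; ring] at h1
        rw [show ((A + t : ℕ) : ℤ) = A + t by push_cast; ring] at h1
        have h3 := dist_triangle_left p (zit e t p) (zit e (A + t) y)
        linarith [hηp t (by omega) h]
    subst ht0
    refine ⟨rfl, hc (funext fun j => Subtype.ext ?_)⟩
    rw [Nat.cast_zero, zit_zero] at hy'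
    refine hEsep _ (c σ j).2 _ (c σ' j).2 ?_
    exact ((hcon y σ hy j).symm.trans (hcon y σ' hy' j)).mono (by linarith) le_rfl
  · intro q σ
    obtain ⟨x, hx⟩ := IsGapFunction.exists_shadow hL'
      ((Finset.range q).image fun j : ℕ => ((j * R : ℕ) : ℤ)) (fun _ => ℓ)
      (fun i => w (σ (i.toNat / R))) (by
        intro i hi j hj hij
        simp only [Finset.mem_image, Finset.mem_range] at hi hj
        obtain ⟨a, ha, rfl⟩ := hi
        obtain ⟨b, hb, rfl⟩ := hj
        have h1 : a < b := lt_of_mul_lt_mul_right (by exact_mod_cast hij) (Nat.zero_le R)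
        have h2 : (a + 1) * R ≤ b * R := Nat.mul_le_mul_right _ h1
        rw [add_mul] at h2
        omega)
    refine ⟨x, fun j hj => ?_⟩
    have := hx ((j * R : ℕ) : ℤ) (Finset.mem_image.2 ⟨j, by simpa, rfl⟩)
    rwa [Int.toNat_natCast, Nat.mul_div_cancel _ (by omega)] at this

end BaseCode

section Words

variable {Y : Type*} [MetricSpace Y] {e : Y ≃ Y}

/-- A header `σ` made of a starred run of length `c` followed by information symbols, together
with an arrangement `κ` of blocks of length at least `n` at bounded gaps. -/
structure IsWord {A : ℕ} {Ω : Type} {q len : ℕ} (c n : ℕ) (σ : Fin q → Option (Option (Fin A)))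
    (κ : Fin len → Option Ω) : Prop where
  first : ∀ j : Fin q, (j : ℕ) = 0 → σ j = none
  star : ∀ j : Fin q, 0 < (j : ℕ) → (j : ℕ) < c → σ j = some none
  info : ∀ j : Fin q, c ≤ (j : ℕ) → ∃ b, σ j = some (some b)
  apart : ∀ i j : Fin len, i < j → κ i ≠ none → κ j ≠ none → (i : ℕ) + n ≤ j
  gap : ∀ i : ℕ, i + 2 * n ≤ len → ∃ j : Fin len, i ≤ j ∧ (j : ℕ) < i + 2 * n ∧ κ j ≠ none

/-- The point `x` realizes the word `(σ, κ)` with blocks `z₀`, and visits `pt` at the end. -/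
structure Realizes (B : BaseCode e) {Ω : Type} {q len : ℕ} (r : ℝ) (n l : ℕ) (z₀ : Ω → Y) (pt : Y)
    (σ : Fin q → Option (Option (Fin B.A))) (κ : Fin len → Option Ω) (x : Y) : Prop where
  header : ∀ j : Fin q, Shadows e (r / 2 + B.ε / 2) B.len (zit e (j * B.R : ℕ) x) (B.w (σ j))
  content : ∀ i ω, κ i = some ω →
    Shadows e (r / 2) l (zit e (q * B.R + n + i : ℕ) x) (z₀ ω)
  visit : dist (zit e (q * B.R + n + len + 2 * n : ℕ) x) pt ≤ r / 2

lemma exists_realizes (B : BaseCode e) {Ω : Type} {q len : ℕ} {r : ℝ} {n l c : ℕ} (z₀ : Ω → Y)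
    (pt : Y) {L : ℕ → ℕ} (hL : IsGapFunction e (r / 2) L) (hl : 0 < l) (hln : l + L l ≤ n)
    (hq : 0 < q) (σ : Fin q → Option (Option (Fin B.A))) (κ : Fin len → Option Ω)
    (h : IsWord c n σ κ) : ∃ x, Realizes B r n l z₀ pt σ κ x := by
  classical
  obtain ⟨x₀, hx₀⟩ := B.concat q (fun j => if hj : j < q then σ ⟨j, hj⟩ else none)
  have hR : 0 < B.R := B.len_pos.trans_le B.len_le
  set a := q * B.R + n with ha
  have hL1 : L 1 ≤ L l := hL.1 hl
  have hqR : 0 < q * B.R := Nat.mul_pos hq hR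
  set F : Finset ℕ := insert 0 (insert (a + len + 2 * n)
    ((Finset.univ.filter fun i : Fin len => κ i ≠ none).image fun i : Fin len => a + (i : ℕ)))
    with hF
  set len' : ℕ → ℕ := fun i => if i = 0 then q * B.R else if i = a + len + 2 * n then 1 else l
  set pt' : ℕ → Y := fun i => if i = 0 then x₀ else if i = a + len + 2 * n then pt else
    if hi : i - a < len then (κ ⟨i - a, hi⟩).elim pt z₀ else pt with hpt'
  have hFm : ∀ i, i ∈ F ↔ i = 0 ∨ i = a + len + 2 * n ∨
      ∃ j : Fin len, κ j ≠ none ∧ a + (j : ℕ) = i := by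
    intro i; simp [hF]
  obtain ⟨x, hx⟩ := IsGapFunction.exists_shadow hL (F.image fun i : ℕ => (i : ℤ))
    (fun i => len' i.toNat) (fun i => pt' i.toNat) (by
      intro i hi j hj hij
      simp only [Finset.mem_image, hFm] at hi hj
      obtain ⟨i, hi, rfl⟩ := hi
      obtain ⟨j, hj, rfl⟩ := hj
      have hij : i < j := by exact_mod_cast hij
      have : i + len' i + L (len' j) ≤ j := by
        rcases hi with rfl | rfl | ⟨s, hs, rfl⟩ <;> rcases hj with rfl | rfl | ⟨u, hu, rfl⟩
        · omega
        · simp only [len', if_true]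
          rw [if_neg (by omega)]
          omega
        · simp only [len', if_true]
          have := u.2
          rw [if_neg (by omega), if_neg (by omega)]
          omega
        · omega
        · omega
        · have := u.2
          omega
        · omega
        · simp only [len', if_true]
          have := s.2
          rw [if_neg (by omega), if_neg (by omega), if_neg (by omega)]
          omega
        · simp only [len']
          have := s.2
          have := u.2
          have := h.apart s u (by rw [Fin.lt_def]; omega) hs hu
          rw [if_neg (by omega), if_neg (by omega), if_neg (by omega), if_neg (by omega)]
          omega
      simp only [Int.toNat_natCast]
      exact_mod_cast this)
  have hx' : ∀ i ∈ F, Shadows e (r / 2) (len' i) (zit e i x) (pt' i) := by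
    intro i hi
    have := hx i (Finset.mem_image.2 ⟨i, hi, rfl⟩)
    simpa using this
  refine ⟨x, fun j => ?_, fun i ω hi => ?_, ?_⟩
  · have h1 := hx' 0 ((hFm 0).2 (Or.inl rfl))
    have h2 : Shadows e (r / 2) (q * B.R) x x₀ := by simpa [len', hpt'] using h1
    have h3 : ((j : ℕ) + 1) * B.R ≤ q * B.R := Nat.mul_le_mul_right _ j.2
    rw [add_mul, one_mul] at h3
    have h4 := (h2.shift (j * B.R)).mono le_rfl
      (show B.len ≤ _ by have := B.len_le; omega)
    have h5 := hx₀ j j.2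
    simp only [j.2, dif_pos] at h5
    exact h4.trans h5
  · have hi2 := i.2
    have h1 := hx' (a + i) ((hFm _).2 (Or.inr (Or.inr ⟨i, by simp [hi], rfl⟩)))
    have h0 : a + (i : ℕ) ≠ 0 := by omega
    have h0' : a + (i : ℕ) ≠ a + len + 2 * n := by omega
    simp only [len', hpt', if_neg h0, if_neg h0', Nat.add_sub_cancel_left, hi2, dif_pos, Fin.eta,
      hi, Option.elim_some] at h1
    exact h1
  · have h1 := hx' (a + len + 2 * n) ((hFm _).2 (Or.inr (Or.inl rfl)))
    have h0 : a + len + 2 * n ≠ 0 := by omega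
    simp only [len', hpt', if_neg h0, if_true] at h1
    have h2 := h1 0 one_pos
    rw [Nat.cast_zero, zit_zero, zit_zero] at h2
    exact h2

variable {B : BaseCode e} {Ω : Type} {q len : ℕ} {r : ℝ} {n l c : ℕ} {z₀ : Ω → Y} {pt : Y}
  {σ σ' : Fin q → Option (Option (Fin B.A))} {κ κ' : Fin len → Option Ω} {x x' y : Y}

lemma Realizes.header_of_shadows (h : Realizes B r n l z₀ pt σ κ x) (hr : r ≤ B.ε / 2) {m : ℕ}
    (hm : q * B.R ≤ m) (hy : Shadows e (r / 2) m y x) (j : Fin q) :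
    Shadows e B.ε B.len (zit e (j * B.R : ℕ) y) (B.w (σ j)) := by
  have h3 : ((j : ℕ) + 1) * B.R ≤ q * B.R := Nat.mul_le_mul_right _ j.2
  rw [add_mul, one_mul] at h3
  exact (((hy.shift (j * B.R)).mono le_rfl
    (show B.len ≤ _ by have := B.len_le; omega)).trans (h.header j)).mono (by linarith) le_rfl

lemma Realizes.content_of_shadows (h : Realizes B r n l z₀ pt σ κ x) {m : ℕ}
    (hm : q * B.R + n + len + l ≤ m) (hy : Shadows e (r / 2) m y x) {i : Fin len} {ω : Ω}
    (hi : κ i = some ω) : Shadows e r l (zit e (q * B.R + n + i : ℕ) y) (z₀ ω) := by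
  have := i.2
  exact (((hy.shift (q * B.R + n + i)).mono le_rfl
    (show l ≤ _ by omega)).trans (h.content i ω hi)).mono (by linarith) le_rfl

/-- Non-overlap for the base code, with the symbols in either order. -/
lemma BaseCode.eq_of_near (B : BaseCode e) {y : Y} {s t : ℕ} {a b : Option (Option (Fin B.A))}
    (hs : 2 * s ≤ 2 * t + B.R) (ht : 2 * t ≤ 2 * s + B.R)
    (ha : Shadows e B.ε B.len (zit e s y) (B.w a))
    (hb : Shadows e B.ε B.len (zit e t y) (B.w b)) : s = t ∧ a = b := by
  rcases le_total s t with h | h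
  · have hb' : Shadows e B.ε B.len (zit e (t - s : ℕ) (zit e s y)) (B.w b) := by
      rw [zit_add]; convert hb using 2; push_cast [Nat.cast_sub h]; ring
    obtain ⟨h1, h2⟩ := B.no_overlap _ (t - s) _ _ (by omega) ha hb'
    exact ⟨by omega, h2⟩
  · have ha' : Shadows e B.ε B.len (zit e (s - t : ℕ) (zit e t y)) (B.w a) := by
      rw [zit_add]; convert ha using 2; push_cast [Nat.cast_sub h]; ring
    obtain ⟨h1, h2⟩ := B.no_overlap _ (s - t) _ _ (by omega) hb ha'
    exact ⟨by omega, h2.symm⟩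

lemma Realizes.header_eq (h : Realizes B r n l z₀ pt σ κ x) (h' : Realizes B r n l z₀ pt σ' κ' x')
    (hr : r ≤ B.ε / 2) {m : ℕ} (hm : q * B.R ≤ m) (hy : Shadows e (r / 2) m y x)
    (hy' : Shadows e (r / 2) m y x') : σ = σ' := by
  funext j
  exact (B.eq_of_near (by omega) (by omega) (h.header_of_shadows hr hm hy j)
    (h'.header_of_shadows hr hm hy' j)).2

lemma Realizes.content_eq (h : Realizes B r n l z₀ pt σ κ x)
    (h' : Realizes B r n l z₀ pt σ' κ' x')
    (hsep : ∀ y ω ω', Shadows e r l y (z₀ ω) → Shadows e r l y (z₀ ω') → ω = ω')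
    (hsupp : ∀ i, (κ i).isSome = (κ' i).isSome) {m : ℕ}
    (hm : q * B.R + n + len + l ≤ m) (hy : Shadows e (r / 2) m y x)
    (hy' : Shadows e (r / 2) m y x') : κ = κ' := by
  funext i
  have hs := hsupp i
  rcases hi : κ i with _ | ω <;> rcases hi' : κ' i with _ | ω'
  · rfl
  · simp [hi, hi'] at hs
  · simp [hi, hi'] at hs
  · rw [hsep _ ω ω' (h.content_of_shadows hm hy hi) (h'.content_of_shadows hm hy' hi')]

lemma Realizes.sync (h : Realizes B r n l z₀ pt σ κ x) (h' : Realizes B r n l z₀ pt σ' κ' x')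
    (hw : IsWord c n σ κ) (hw' : IsWord c n σ' κ') (hr : r ≤ B.ε / 2) (hn : 0 < n) (hln : l ≤ n)
    (hc : 4 * n + 4 ≤ c) (hcq : c < q)
    (hinfo : ∀ ω, ∃ u, u + B.len ≤ l ∧ ∃ b, Shadows e (B.ε - r) B.len (zit e u (z₀ ω))
      (B.w (some (some b)))) {m t : ℕ}
    (hm : q * B.R + n + len + l ≤ m) (ht : t + 4 * n + B.R ≤ q * B.R + n + len)
    (hy : Shadows e (r / 2) m y x) (hy' : Shadows e (r / 2) m (zit e t y) x') : t = 0 := by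
  have hR : 0 < B.R := B.len_pos.trans_le B.len_le
  have hq : 0 < q := by omega
  have hhead := fun j => h.header_of_shadows hr (by omega) hy j
  have hhead' : ∀ j : Fin q, Shadows e B.ε B.len (zit e (t + j * B.R : ℕ) y) (B.w (σ' j)) := by
    intro j
    have := h'.header_of_shadows hr (by omega) hy' j
    rw [zit_add] at this
    convert this using 2
    push_cast; ring
  rcases Nat.lt_or_ge ((2 * t + B.R) / (2 * B.R)) q with hj | hj
  · set j := (2 * t + B.R) / (2 * B.R) with hjd
    have h1 : j * (2 * B.R) ≤ 2 * t + B.R := Nat.div_mul_le_self _ _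
    have h2 : 2 * t + B.R < j * (2 * B.R) + 2 * B.R := Nat.lt_div_mul_add (by omega)
    have h3 : j * (2 * B.R) = 2 * (j * B.R) := by ring
    obtain ⟨h4, h5⟩ := B.eq_of_near (s := j * B.R) (t := t + 0 * B.R) (by omega) (by omega)
      (hhead ⟨j, hj⟩) (hhead' ⟨0, hq⟩)
    rw [hw'.first ⟨0, hq⟩ rfl] at h5
    rcases Nat.eq_zero_or_pos j with h0 | h0
    · rw [h0] at h4; omega
    · rcases Nat.lt_or_ge j c with hjc | hjc
      · rw [hw.star ⟨j, hj⟩ h0 hjc] at h5; exact absurd h5 (by simp)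
      · obtain ⟨b, hb⟩ := hw.info ⟨j, hj⟩ hjc
        rw [hb] at h5; exact absurd h5 (by simp)
  · exfalso
    have hqt : q * (2 * B.R) ≤ 2 * t + B.R := (Nat.le_div_iff_mul_le (by omega)).1 hj
    have hq2 : q * (2 * B.R) = 2 * (q * B.R) := by ring
    set a := q * B.R + n with ha
    obtain ⟨i, hi1, hi2, hi3⟩ := hw.gap (t - a) (by omega)
    obtain ⟨ω, hω⟩ := Option.ne_none_iff_exists'.1 hi3
    obtain ⟨u, hu, b, hb⟩ := hinfo ω
    have h1 : Shadows e B.ε B.len (zit e (a + i + u : ℕ) y) (B.w (some (some b))) := by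
      have h2 := ((h.content_of_shadows hm hy hω).shift u).mono le_rfl (show B.len ≤ _ by omega)
      rw [zit_add] at h2
      have h3 := (h2.trans hb).mono (show _ ≤ B.ε by linarith) le_rfl
      convert h3 using 2
      push_cast [ha]; ring
    set d := a + i + u - t with hd
    have h2 : (2 * d + B.R) / (2 * B.R) * (2 * B.R) ≤ 2 * d + B.R := Nat.div_mul_le_self _ _
    have h3 : 2 * d + B.R < (2 * d + B.R) / (2 * B.R) * (2 * B.R) + 2 * B.R :=
      Nat.lt_div_mul_add (by omega)
    set j := (2 * d + B.R) / (2 * B.R) with hjd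
    have h3' : j * (2 * B.R) = 2 * (j * B.R) := by ring
    have hjc : j < c := by
      by_contra hjc
      have h5 : (4 * n + 4) * (2 * B.R) ≤ j * (2 * B.R) := Nat.mul_le_mul_right _ (by omega)
      have h6 : (4 * n + 4) * (2 * B.R) = 8 * (n * B.R) + 8 * B.R := by ring
      have h7 : n ≤ n * B.R := Nat.le_mul_of_pos_right _ hR
      omega
    obtain ⟨-, h5⟩ := B.eq_of_near (s := a + i + u) (t := t + j * B.R) (by omega) (by omega) h1
      (hhead' ⟨j, by omega⟩)
    rcases Nat.eq_zero_or_pos j with h0 | h0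
    · rw [hw'.first ⟨j, by omega⟩ h0] at h5; exact absurd h5 (by simp)
    · rw [hw'.star ⟨j, by omega⟩ h0 hjc] at h5; exact absurd h5 (by simp)

lemma Realizes.info (h : Realizes B r n l z₀ pt σ κ x) (hw : IsWord c n σ κ) (hr : r ≤ B.ε / 2)
    (hcq : c < q) : ∃ u, u + B.len ≤ q * B.R ∧ ∃ b,
      Shadows e (B.ε - r / 2) B.len (zit e u x) (B.w (some (some b))) := by
  obtain ⟨b, hb⟩ := hw.info ⟨c, hcq⟩ le_rfl
  have h3 : (c + 1) * B.R ≤ q * B.R := Nat.mul_le_mul_right _ hcq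
  rw [add_mul, one_mul] at h3
  refine ⟨c * B.R, by have := B.len_le; omega, b, ?_⟩
  have := h.header ⟨c, hcq⟩
  rw [hb] at this
  exact this.mono (by linarith) le_rfl

end Words

section Auxiliary

lemma exists_enumeration {α : Type*} [Nonempty α] {A : Set α} (hA : A.Finite) {M : ℕ}
    (h : A.ncard ≤ M) : ∃ (enc : α → ℕ) (dec : ℕ → α), ∀ a ∈ A, enc a < M ∧ dec (enc a) = a := by
  classical
  have := hA.fintype
  set f := Fintype.equivFin A
  refine ⟨fun a => if ha : a ∈ A then f ⟨a, ha⟩ else 0,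
    fun i => if hi : i < Fintype.card A then (f.symm ⟨i, hi⟩ : α) else Classical.arbitrary α,
    fun a ha => ⟨?_, ?_⟩⟩
  · simp only [ha, dif_pos]
    refine (f ⟨a, ha⟩).2.trans_le (le_trans ?_ h)
    rw [← Nat.card_coe_set_eq, Nat.card_eq_fintype_card]
  · simp only [ha, dif_pos, Fin.is_lt, Fin.eta, Equiv.symm_apply_apply]

/-- Coding of pairs `(k, n)` in a relation: one first reads off `sp k`, then `n` given `k`. -/
lemma exists_code {K N Sp C : Type*} [Finite K] [Finite N] [Finite Sp] [Nonempty N] [Nonempty Sp]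
    [Finite C] [Nonempty C] (R : Set (K × N)) (sp : K → Sp) {M M' : ℕ}
    (hM' : ((fun p : K × N => sp p.1) '' R).ncard ≤ M')
    (hM : ∀ k, {n | (k, n) ∈ R}.ncard ≤ M) (hC : M * M' ≤ Nat.card C) :
    ∃ (g : K × N → C) (sdec : C → Sp) (ndec : C → K → N), ∀ k n, (k, n) ∈ R →
      sdec (g (k, n)) = sp k ∧ ndec (g (k, n)) k = n := by
  obtain ⟨es, ds, hs⟩ := exists_enumeration (Set.toFinite ((fun p : K × N => sp p.1) '' R)) hM'
  choose en dn hn using fun k => exists_enumeration (Set.toFinite {n | (k, n) ∈ R}) (hM k)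
  set f := Finite.equivFin C
  have hpos : 0 < Nat.card C := Nat.card_pos
  refine ⟨fun p => f.symm ⟨(M * es (sp p.1) + en p.1 p.2) % Nat.card C, Nat.mod_lt _ hpos⟩,
    fun c => ds ((f c : ℕ) / M), fun c k => dn k ((f c : ℕ) % M), fun k n h => ?_⟩
  obtain ⟨h1, h2⟩ := hs (sp k) ⟨(k, n), h, rfl⟩
  obtain ⟨h3, h4⟩ := hn k n h
  have h5 : M * es (sp k) + en k n < Nat.card C := by
    refine lt_of_lt_of_le ?_ hC
    calc M * es (sp k) + en k n < M * (es (sp k) + 1) := by rw [mul_add, mul_one]; omega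
      _ ≤ M * M' := Nat.mul_le_mul_left _ h1
  have hM0 : 0 < M := by omega
  simp only [Equiv.apply_symm_apply, Nat.mod_eq_of_lt h5]
  rw [Nat.mul_add_div hM0, Nat.div_eq_of_lt h3, add_zero, Nat.mul_add_mod, Nat.mod_eq_of_lt h3]
  exact ⟨h2, h4⟩

/-- Proportions of the pieces of a long word: header, content and gap. -/
lemma eventually_exists_layout {L : ℕ → ℕ}
    (hL : Tendsto (fun m : ℕ => (L m : ℝ) / m) atTop (nhds 0)) {R : ℕ} (hR : 0 < R) (n k : ℕ)
    {ρ η α β θ C : ℝ} (hρ0 : 0 < ρ) (hρ1 : ρ < 1) (hη : 0 < η) (hα : 0 ≤ α) (hβ : 0 ≤ β)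
    (hcap : ρ * α + (1 - ρ) * β < ρ * θ) :
    ∀ᶠ N : ℕ in atTop, ∃ q len : ℕ, k ≤ q ∧ k ≤ len ∧ q * R + n + len + 2 * n + 1 + L N = N ∧
      (L N + q * R + k : ℝ) ≤ (ρ + η) * N ∧ (L N : ℝ) ≤ η * N ∧
      C + (q * R) * α + len * β ≤ (q * R) * θ := by
  have hθ : 0 ≤ θ := by
    by_contra h
    push Not at h
    nlinarith [mul_nonneg hρ0.le hα, mul_nonneg (sub_nonneg.2 hρ1.le) hβ, mul_pos_of_neg_of_neg (neg_lt_zero.2 hρ0) h]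
  have hR' : (0 : ℝ) < R := by exact_mod_cast hR
  have t : ∀ a : ℝ, 0 < a → ∀ b : ℝ, ∀ᶠ N : ℕ in atTop, b ≤ a * N := by
    intro a ha b
    exact (tendsto_natCast_atTop_atTop.const_mul_atTop ha).eventually_ge_atTop b
  filter_upwards [eventually_le_mul_of_div_tendsto hL (show 0 < min (η / 2) ((1 - ρ) / 2) from
      lt_min (by linarith) (by linarith)), t (η / 2) (by linarith) k,
      t ((1 - ρ) / 2) (by linarith) (3 * n + 1 + k), t ρ hρ0 ((k + 1) * R),
      t (ρ * θ - (ρ * α + (1 - ρ) * β)) (by linarith) (C + R * θ + R * β)] with N h1 h2 h3 h4 h5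
  set q := ⌊ρ * N / R⌋₊ with hq
  have hN : (0 : ℝ) ≤ N := Nat.cast_nonneg _
  have q1 : (q * R : ℝ) ≤ ρ * N := by
    rw [← le_div_iff₀ hR']; exact Nat.floor_le (by positivity)
  have q2 : ρ * N < q * R + R := by
    have := Nat.lt_floor_add_one (ρ * N / R)
    rw [div_lt_iff₀ hR'] at this
    linarith
  have l1 : (L N : ℝ) ≤ η / 2 * N := h1.trans (mul_le_mul_of_nonneg_right (min_le_left _ _) hN)
  have l2 : (L N : ℝ) ≤ (1 - ρ) / 2 * N :=
    h1.trans (mul_le_mul_of_nonneg_right (min_le_right _ _) hN)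
  have h6 : q * R + n + 2 * n + 1 + k + L N ≤ N := by
    have : ((q * R + n + 2 * n + 1 + k + L N : ℕ) : ℝ) ≤ N := by push_cast; linarith
    exact_mod_cast this
  set len := N - (q * R + n + 2 * n + 1 + L N) with hlen
  have h7 : q * R + n + len + 2 * n + 1 + L N = N := by omega
  have h8 : (len : ℝ) ≤ N - q * R := by
    have : ((q * R + n + len + 2 * n + 1 + L N : ℕ) : ℝ) = N := by exact_mod_cast h7
    push_cast at this
    have e1 : (0 : ℝ) ≤ L N := Nat.cast_nonneg _
    have e2 : (0 : ℝ) ≤ n := Nat.cast_nonneg _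
    linarith
  refine ⟨q, len, ?_, by omega, h7, by linarith, by nlinarith, ?_⟩
  · have : ((k : ℝ)) * R < (q + 1) * R := by nlinarith
    have := lt_of_mul_lt_mul_right this hR'.le
    have : k < q + 1 := by exact_mod_cast this
    omega
  · have hN0 : (len : ℝ) ≤ (1 - ρ) * N + R := by linarith
    have e1 := mul_le_mul_of_nonneg_right q1 hα
    have e2 := mul_le_mul_of_nonneg_right hN0 hβ
    have e3 := mul_le_mul_of_nonneg_right q2.le hθ
    nlinarith

variable {X : Type*} [MeasurableSpace X] {μ : Measure X} [IsProbabilityMeasure μ]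

lemma card_mul_measureReal_le_one {T : X ≃ᵐ X} (hT : MeasurePreserving T μ μ) {D : Set X}
    (hD : MeasurableSet D) {N : ℕ}
    (h : ∀ x ∈ D, ∀ i : ℕ, 0 < i → i < N → zit T.toEquiv i x ∉ D) : N * μ.real D ≤ 1 := by
  have h1 : μ.real (⋃ i ∈ Finset.range N, zit T.toEquiv (i : ℕ) ⁻¹' D) = ∑ i ∈ Finset.range N,
      μ.real (zit T.toEquiv (i : ℕ) ⁻¹' D) := by
    refine measureReal_biUnion_finset ?_ fun i _ => measurable_zit T i hD
    have key : ∀ i j : ℕ, i < j → j < N →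
        Disjoint (zit T.toEquiv (i : ℕ) ⁻¹' D) (zit T.toEquiv (j : ℕ) ⁻¹' D) := by
      intro i j hij hj
      refine Set.disjoint_left.2 fun x hx hx' => h _ hx (j - i) (by omega) (by omega) ?_
      rw [zit_add]
      have : ((j - i : ℕ) : ℤ) + i = j := by omega
      rw [this]; exact hx'
    intro i hi j hj hij
    rcases lt_or_gt_of_ne hij with h' | h'
    · exact key i j h' (by simpa using hj)
    · exact (key j i h' (by simpa using hi)).symm
  have h2 : ∀ i ∈ Finset.range N, μ.real (zit T.toEquiv (i : ℕ) ⁻¹' D) = μ.real D := fun i _ =>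
    (measurePreserving_zit T hT i).measureReal_preimage hD.nullMeasurableSet
  rw [Finset.sum_congr rfl h2, Finset.sum_const, Finset.card_range, nsmul_eq_mul] at h1
  rw [← h1]
  exact measureReal_le_one

end Auxiliary

section Counting

variable {X : Type*} [MeasurableSpace X] {μ : Measure X} [IsProbabilityMeasure μ]
variable {α β : Type*} [Fintype α] [Fintype β]

lemma eventually_exists_count_le_of_entropy {T : X → X} (hT : Ergodic T μ) {P : X → α}
    (hP : IsObs P) {c : ℝ} {M : ℕ} (h : infoEntropy μ (name T P M) < M * c) {δ : ℝ} (hδ : 0 < δ) :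
    ∀ᶠ n : ℕ in atTop, ∃ G : Set X, MeasurableSet G ∧ μ.real Gᶜ < δ ∧
      ((name T P n '' G).ncard : ℝ) ≤ Real.exp (n * c) := by
  have hU : IsObs (fun _ : X => ()) := isObs_of_singleton fun _ => by simp
  have h1 : infoEntropy μ (name T (fun x => (P x, ())) M) ≤ infoEntropy μ (name T P M) := by
    refine infoEntropy_le_of_factor (hP.name hT.measurable M) fun x y hxy => ?_
    rw [name_eq_iff] at hxy ⊢
    exact fun i hi => by rw [hxy i hi]
  have h2 := infoEntropy_nonneg (μ := μ) (name T (fun _ : X => ()) M)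
  filter_upwards [eventually_exists_count_le hT hP hU (c := c) (M := M) (by linarith) hδ] with n hn
  obtain ⟨G, hG, hGδ, h3⟩ := hn
  refine ⟨G, hG, hGδ, ?_⟩
  convert h3 (fun _ => ()) using 5
  ext x
  simp only [mem_ofPred_eq, iff_self_and]
  exact fun _ => trivial

/-- The set of points with controlled names: the first `a` coordinates of the `P`-name, then `m`
coordinates of the `P`-name given the `Q`-name, and of the support of the `Q`-name. -/
lemma exists_good_set {T : X → X} (hT : Ergodic T μ) {P : X → α} {Q : X → Option β}
    (hP : IsObs P) (hQ : IsObs Q) {h γ κ τ : ℝ} (hτ : 0 < τ)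
    (hh : entropyWrt μ T P ≤ h) (hh' : entropyWrt μ T (fun x => (P x, Q x)) ≤ h)
    (hγ : ∀ᶠ m : ℕ in atTop, m * (h - γ) ≤ infoEntropy μ (name T Q m))
    (hκ : infoEntropy μ (fun x => (Q x).isSome) ≤ κ)
    {n : ℕ} (hret : ∀ᵐ x ∂μ, ∃ i : ℕ, i < 2 * n ∧ Q (T^[i] x) ≠ none) {δ : ℝ} (hδ : 0 < δ) :
    ∃ k : ℕ, ∀ a m : ℕ, k ≤ a → k ≤ m → ∃ G : Set X, MeasurableSet G ∧ μ.real Gᶜ ≤ δ ∧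
      ((name T P a '' G).ncard : ℝ) ≤ Real.exp (a * (h + τ)) ∧
      (∀ K : Fin m → Option β, (((fun x => name T P m (T^[a] x)) ''
        {x | x ∈ G ∧ name T Q m (T^[a] x) = K}).ncard : ℝ) ≤ Real.exp (m * (γ + τ))) ∧
      (((fun x (i : Fin m) => (name T Q m (T^[a] x) i).isSome) '' G).ncard : ℝ) ≤
        Real.exp (m * (κ + τ)) ∧
      ∀ x ∈ G, ∀ i : ℕ, i + 2 * n ≤ m →
        ∃ j, i ≤ j ∧ j < i + 2 * n ∧ Q (T^[j] (T^[a] x)) ≠ none := by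
  have hTm := hT.toMeasurePreserving
  have hδ3 : 0 < δ / 3 := by positivity
  obtain ⟨M₁, -, hM₁⟩ := (frequently_of_entropyWrt_lt hTm hP
    (show entropyWrt μ T P < h + τ by linarith)).exists
  obtain ⟨M₂, hM₂, hM₂'⟩ := ((frequently_of_entropyWrt_lt hTm (hP.pair hQ)
    (show entropyWrt μ T (fun x => (P x, Q x)) < h + τ by linarith)).and_eventually hγ).exists
  have h3 : infoEntropy μ (name T (fun x => (Q x).isSome) 1) < (1 : ℕ) * (κ + τ) := by
    have := infoEntropy_name_le hTm (hQ.comp Option.isSome) 1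
    simp only [Nat.cast_one, one_mul] at this ⊢
    linarith
  have e1 := eventually_exists_count_le_of_entropy hT hP hM₁ hδ3
  have e2 := eventually_exists_count_le hT hP hQ (c := γ + τ) (M := M₂)
    (by have := hM₂.2; nlinarith) hδ3
  have e3 := eventually_exists_count_le_of_entropy hT (hQ.comp Option.isSome) h3 hδ3
  obtain ⟨k, hk⟩ := eventually_atTop.1 (e1.and (e2.and e3))
  refine ⟨k, fun a m ha hm => ?_⟩
  obtain ⟨⟨G₁, m₁, d₁, c₁⟩, -⟩ := hk a ha
  obtain ⟨-, ⟨G₂, m₂, d₂, c₂⟩, ⟨G₃, m₃, d₃, c₃⟩⟩ := hk m hm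
  have hTa := hTm.iterate a
  set G₄ : Set X := ⋂ i ∈ Finset.range m, {x | ∃ j, i ≤ j ∧ j < i + 2 * n ∧ Q (T^[j] x) ≠ none}
    with hG₄
  have m₄ : MeasurableSet G₄ := by
    refine MeasurableSet.biInter (Set.to_countable _) fun i _ => ?_
    have : {x | ∃ j, i ≤ j ∧ j < i + 2 * n ∧ Q (T^[j] x) ≠ none} =
        ⋃ j ∈ Finset.Ico i (i + 2 * n), {x | Q (T^[j] x) ≠ none} := by
      ext x; simp [and_assoc]
    rw [this]
    refine MeasurableSet.biUnion (Set.to_countable _) fun j _ => ?_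
    exact (hQ.comp_right (hTm.measurable.iterate j)) {o | o ≠ none}
  have d₄ : μ G₄ᶜ = 0 := by
    rw [← mem_ae_iff]
    refine (Filter.biInter_finset_mem _).2 fun i _ => ?_
    filter_upwards [(hTm.iterate i).quasiMeasurePreserving.ae hret] with x ⟨j, hj, hx⟩
    refine ⟨j + i, by omega, by omega, ?_⟩
    rwa [Function.iterate_add_apply]
  refine ⟨G₁ ∩ T^[a] ⁻¹' (G₂ ∩ G₃ ∩ G₄), m₁.inter (hTa.measurable ((m₂.inter m₃).inter m₄)),
    ?_, ?_, fun K => ?_, ?_, ?_⟩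
  · have hs : (G₁ ∩ T^[a] ⁻¹' (G₂ ∩ G₃ ∩ G₄))ᶜ ⊆
        G₁ᶜ ∪ (T^[a] ⁻¹' G₂ᶜ ∪ (T^[a] ⁻¹' G₃ᶜ ∪ T^[a] ⁻¹' G₄ᶜ)) := by
      intro x hx
      simp only [mem_compl_iff, mem_inter_iff, mem_union, mem_preimage] at hx ⊢
      tauto
    have hp : ∀ {s : Set X}, MeasurableSet s → μ.real (T^[a] ⁻¹' sᶜ) = μ.real sᶜ :=
      fun hs => hTa.measureReal_preimage hs.compl.nullMeasurableSet
    have b1 := measureReal_mono (μ := μ) hs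
    have b2 := measureReal_union_le (μ := μ) G₁ᶜ (T^[a] ⁻¹' G₂ᶜ ∪ (T^[a] ⁻¹' G₃ᶜ ∪ T^[a] ⁻¹' G₄ᶜ))
    have b3 := measureReal_union_le (μ := μ) (T^[a] ⁻¹' G₂ᶜ) (T^[a] ⁻¹' G₃ᶜ ∪ T^[a] ⁻¹' G₄ᶜ)
    have b4 := measureReal_union_le (μ := μ) (T^[a] ⁻¹' G₃ᶜ) (T^[a] ⁻¹' G₄ᶜ)
    rw [hp m₂] at b3
    rw [hp m₃, hp m₄] at b4
    have b5 : μ.real G₄ᶜ = 0 := by simp [Measure.real, d₄]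
    linarith
  · refine le_trans ?_ c₁
    exact_mod_cast Set.ncard_le_ncard (image_mono inter_subset_left) (Set.toFinite _)
  · refine le_trans ?_ (c₂ K)
    refine Nat.cast_le.2 (Set.ncard_le_ncard ?_ (Set.toFinite _))
    rintro _ ⟨x, ⟨hx, hK⟩, rfl⟩
    exact ⟨_, ⟨hx.2.1.1, hK⟩, rfl⟩
  · refine le_trans ?_ c₃
    refine Nat.cast_le.2 (Set.ncard_le_ncard ?_ (Set.toFinite _))
    rintro _ ⟨x, hx, rfl⟩
    exact ⟨_, hx.2.1.2, rfl⟩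
  · intro x hx i hi
    rcases Nat.eq_zero_or_pos n with h0 | h0
    · exfalso
      subst h0
      obtain ⟨x, i, hi, -⟩ := hret.exists
      omega
    · exact mem_iInter₂.1 hx.2.2 i (Finset.mem_range.2 (by omega))

/-- If an observable is determined by a window of `Q` and by an observable `Z` of small entropy,
then `Q` carries most of the entropy. -/
lemma eventually_le_of_window {T : X ≃ᵐ X} (hT : MeasurePreserving T μ μ) {γ' : Type*}
    [Fintype γ'] {P : X → α} {Q : X → β} {Z : X → γ'} (hP : IsObs P) (hQ : IsObs Q) (hZ : IsObs Z)
    {N : ℕ} (hdet : ∀ x y, Z x = Z y →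
      (∀ i : ℕ, i < N → Q (zit T.toEquiv (-i) x) = Q (zit T.toEquiv (-i) y)) → P x = P y)
    {h θ : ℝ} (hθ : 0 < θ) (hent : h - θ / 4 < entropyWrt μ T P) (hZθ : infoEntropy μ Z ≤ θ / 4) :
    ∀ᶠ m : ℕ in atTop, m * (h - θ) ≤ infoEntropy μ (name T Q m) := by
  have h1 : ∀ m : ℕ, infoEntropy μ (name T P m) ≤
      infoEntropy μ (name T Q m) + infoEntropy μ (name T Q N) + m * (θ / 4) := by
    intro m
    have hTN := hT.iterate N
    have hmeas := hT.measurable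
    have e1 := infoEntropy_comp_mp (hP.name hmeas m) hTN
    have e2 := infoEntropy_comp_mp (hZ.name hmeas m) hTN
    have e3 : infoEntropy μ (fun x => name T P m (T^[N] x)) ≤
        infoEntropy μ (name T Q (m + N)) + infoEntropy μ (fun x => name T Z m (T^[N] x)) := by
      refine infoEntropy_pair_le_of_factor (hQ.name hmeas _)
        ((hZ.name hmeas m).comp_right hTN.measurable) fun x y hx hz => ?_
      rw [name_eq_iff] at hx hz ⊢
      intro i hi
      refine hdet _ _ (hz i hi) fun j hj => ?_
      have key : ∀ x, zit T.toEquiv (-j) (T^[i] (T^[N] x)) = T^[i + N - j] x := by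
        intro x
        rw [← Function.iterate_add_apply]
        have c1 := zit_natCast T.toEquiv (i + N) x
        have c2 := zit_natCast T.toEquiv (i + N - j) x
        rw [MeasurableEquiv.coe_toEquiv] at c1 c2
        rw [← c1, ← c2, zit_add]
        congr 1
        omega
      rw [key, key]
      exact hx _ (by omega)
    have e4 := infoEntropy_name_add_le hT hQ m N
    have e5 := infoEntropy_name_le hT hZ m
    have e6 := mul_le_mul_of_nonneg_left hZθ (Nat.cast_nonneg (α := ℝ) m)
    linarith
  have h2 : ∀ᶠ m : ℕ in atTop, infoEntropy μ (name T Q N) ≤ θ / 4 * m :=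
    (tendsto_natCast_atTop_atTop.const_mul_atTop (by linarith)).eventually_ge_atTop _
  filter_upwards [h2, eventually_of_lt_entropyWrt hent] with m hm hm'
  have := h1 m
  have hm0 : (0 : ℝ) ≤ m := Nat.cast_nonneg m
  nlinarith

end Counting

section Coding

variable {X : Type*} [MeasurableSpace X] [Nonempty X] {α β : Type} [Fintype α] [Fintype β]

/-- Names of `P` can be written in the header of a word whose content is the `Q`-name. -/
lemma exists_coding {T : X → X} (hT : Measurable T) {P : X → α} {Q : X → Option β}
    (hP : IsObs P) (hQ : IsObs Q) {n a m q c A : ℕ} (hc : 0 < c) (hA : 0 < A) {G : Set X}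
    {E E' E'' : ℝ} (h1 : ((name T P a '' G).ncard : ℝ) ≤ E)
    (h2 : ∀ K : Fin m → Option β, (((fun x => name T P m (T^[a] x)) ''
        {x | x ∈ G ∧ name T Q m (T^[a] x) = K}).ncard : ℝ) ≤ E')
    (h3 : (((fun x (i : Fin m) => (name T Q m (T^[a] x) i).isSome) '' G).ncard : ℝ) ≤ E'')
    (hgap : ∀ x ∈ G, ∀ i : ℕ, i + 2 * n ≤ m →
        ∃ j, i ≤ j ∧ j < i + 2 * n ∧ Q (T^[j] (T^[a] x)) ≠ none)
    (hn : 0 < n)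
    (hapart : ∀ x, Q x ≠ none → ∀ i, 0 < i → i < n → Q (T^[i] x) = none)
    (hcap : E * E' * E'' ≤ (A : ℝ) ^ (q - c)) :
    ∃ (hdr : X → Fin q → Option (Option (Fin A)))
      (sdec : (Fin q → Option (Option (Fin A))) → Fin m → Bool)
      (ndec : (Fin q → Option (Option (Fin A))) → (Fin m → Option β) → (Fin a → α) × (Fin m → α)),
      IsObs hdr ∧ ∀ x ∈ G, IsWord c n (hdr x) (name T Q m (T^[a] x)) ∧
        (∀ i, sdec (hdr x) i = (name T Q m (T^[a] x) i).isSome) ∧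
        ndec (hdr x) (name T Q m (T^[a] x)) = (name T P a x, name T P m (T^[a] x)) := by
  classical
  obtain ⟨x₀⟩ := ‹Nonempty X›
  have hNe : Nonempty ((Fin a → α) × (Fin m → α)) := ⟨(name T P a x₀, name T P m (T^[a] x₀))⟩
  have hFA : Nonempty (Fin A) := ⟨⟨0, hA⟩⟩
  set K : X → Fin m → Option β := fun x => name T Q m (T^[a] x) with hK
  set Nm : X → (Fin a → α) × (Fin m → α) := fun x => (name T P a x, name T P m (T^[a] x)) with hNm
  have oNm : IsObs Nm := (hP.name hT a).pair ((hP.name hT m).comp_right (hT.iterate a))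
  have oK : IsObs K := (hQ.name hT m).comp_right (hT.iterate a)
  have E0 : 0 ≤ E := le_trans (Nat.cast_nonneg _) h1
  have E0' : 0 ≤ E' := le_trans (Nat.cast_nonneg _) (h2 (K x₀))
  have E0'' : 0 ≤ E'' := le_trans (Nat.cast_nonneg _) h3
  set Rel : Set ((Fin m → Option β) × ((Fin a → α) × (Fin m → α))) :=
    (fun x => (K x, Nm x)) '' G with hRel
  have k1 : ((fun p : (Fin m → Option β) × ((Fin a → α) × (Fin m → α)) =>
      fun i : Fin m => (p.1 i).isSome) '' Rel).ncard ≤ ⌊E''⌋₊ := by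
    rw [hRel, Set.image_image]
    exact Nat.le_floor h3
  have k2 : ∀ k, {n | (k, n) ∈ Rel}.ncard ≤ ⌊E⌋₊ * ⌊E'⌋₊ := by
    intro k
    have hsub : {n | (k, n) ∈ Rel} ⊆
        (name T P a '' G) ×ˢ ((fun x => name T P m (T^[a] x)) '' {x | x ∈ G ∧ K x = k}) := by
      rintro n ⟨x, hx, h⟩
      obtain ⟨rfl, rfl⟩ := Prod.mk.inj h
      exact ⟨⟨x, hx, rfl⟩, ⟨x, ⟨hx, rfl⟩, rfl⟩⟩
    refine (Set.ncard_le_ncard hsub (Set.toFinite _)).trans ?_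
    rw [Set.ncard_prod]
    exact Nat.mul_le_mul (Nat.le_floor h1) (Nat.le_floor (h2 k))
  have k3 : ⌊E⌋₊ * ⌊E'⌋₊ * ⌊E''⌋₊ ≤ Nat.card (Fin (q - c) → Fin A) := by
    rw [Nat.card_eq_fintype_card, Fintype.card_fun, Fintype.card_fin, Fintype.card_fin]
    have : ((⌊E⌋₊ * ⌊E'⌋₊ * ⌊E''⌋₊ : ℕ) : ℝ) ≤ ((A ^ (q - c) : ℕ) : ℝ) := by
      push_cast
      refine le_trans ?_ hcap
      gcongr
      · exact Nat.floor_le E0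
      · exact Nat.floor_le E0'
      · exact Nat.floor_le E0''
    exact_mod_cast this
  obtain ⟨g, sd, nd, hg⟩ := exists_code Rel (fun k (i : Fin m) => (k i).isSome) k1 k2 k3
  refine ⟨fun x j => if (j : ℕ) = 0 then none else if (j : ℕ) < c then some none else
    if hj : (j : ℕ) - c < q - c then some (some (g (K x, Nm x) ⟨j - c, hj⟩)) else none,
    fun σ => sd fun j => ((σ ⟨j + c, by omega⟩).getD none).getD (Classical.arbitrary _),
    fun σ => nd fun j => ((σ ⟨j + c, by omega⟩).getD none).getD (Classical.arbitrary _),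
    ?_, fun x hx => ?_⟩
  · exact (oK.pair oNm).comp fun p (j : Fin q) => if (j : ℕ) = 0 then none else
      if (j : ℕ) < c then some none else
      if hj : (j : ℕ) - c < q - c then some (some (g p ⟨j - c, hj⟩)) else none
  have hdec : (fun j : Fin (q - c) => (((fun j : Fin q => if (j : ℕ) = 0 then none else
      if (j : ℕ) < c then some none else
      if hj : (j : ℕ) - c < q - c then some (some (g (K x, Nm x) ⟨j - c, hj⟩)) else none)
      ⟨j + c, by omega⟩).getD none).getD (Classical.arbitrary _)) = g (K x, Nm x) := by
    funext j
    have := j.2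
    have e2 : ¬ ((j : ℕ) + c < c) := by omega
    simp [e2, hc.ne']
  obtain ⟨g1, g2⟩ := hg (K x) (Nm x) ⟨x, hx, rfl⟩
  refine ⟨⟨fun j hj => by simp [hj], fun j hj hj' => by simp [hj.ne', hj'], fun j hj => ?_,
    fun i j hij hi hj => ?_, fun i hi => ?_⟩, fun i => ?_, ?_⟩
  · have := j.2
    have e1 : ¬ ((j : ℕ) = 0) := by omega
    have e2 : ¬ ((j : ℕ) < c) := by omega
    have e3 : (j : ℕ) - c < q - c := by omega
    exact ⟨g (K x, Nm x) ⟨j - c, e3⟩, by simp only [e1, e2, e3, if_false, dif_pos]⟩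
  · by_contra hlt
    have hij' : (i : ℕ) < j := hij
    refine hj ?_
    have := hapart _ hi (j - i) (by omega) (by omega)
    rw [← Function.iterate_add_apply, Nat.sub_add_cancel hij'.le] at this
    exact this
  · obtain ⟨j, h4, h5, h6⟩ := hgap x hx i hi
    exact ⟨⟨j, by omega⟩, h4, h5, h6⟩
  · dsimp only at hdec ⊢
    rw [hdec]
    exact congrFun g1 i
  · dsimp only at hdec ⊢
    rw [hdec]
    exact g2

end Coding

section Covering

variable {X : Type*} [MeasurableSpace X] {μ : Measure X} [IsProbabilityMeasure μ]

lemma iterate_eq_zit (T : X ≃ᵐ X) (n : ℕ) (x : X) : T^[n] x = zit T.toEquiv n x :=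
  (zit_natCast T.toEquiv n x).symm

lemma measureReal_biUnion_zit_le {T : X ≃ᵐ X} (hT : MeasurePreserving T μ μ) {D : Set X}
    (hD : MeasurableSet D) (F : Finset ℕ) :
    μ.real (⋃ i ∈ F, zit T.toEquiv (-(i : ℕ)) ⁻¹' D) ≤ F.card * μ.real D := by
  refine (measureReal_biUnion_finset_le _ _).trans ?_
  rw [Finset.sum_congr rfl fun i _ => (measurePreserving_zit T hT (-(i : ℕ))).measureReal_preimage
    hD.nullMeasurableSet, Finset.sum_const, nsmul_eq_mul]

lemma measureReal_compl_decodable_le {T : X ≃ᵐ X} (hT : MeasurePreserving T μ μ) {D G : Set X}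
    (hD : MeasurableSet D) (hG : MeasurableSet G) (N k : ℕ) :
    μ.real {x | ∃ i : ℕ, i + k ≤ N ∧ zit T.toEquiv (-i) x ∈ D ∩ G}ᶜ ≤
      μ.real {x | ∀ i : ℕ, i < N → zit T.toEquiv (-i) x ∉ D} + N * μ.real (D ∩ Gᶜ) +
        k * μ.real D := by
  have hs : {x | ∃ i : ℕ, i + k ≤ N ∧ zit T.toEquiv (-i) x ∈ D ∩ G}ᶜ ⊆
      {x | ∀ i : ℕ, i < N → zit T.toEquiv (-i) x ∉ D} ∪
      (⋃ i ∈ Finset.range N, zit T.toEquiv (-(i : ℕ)) ⁻¹' (D ∩ Gᶜ)) ∪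
      ⋃ i ∈ Finset.Ico (N - k) N, zit T.toEquiv (-(i : ℕ)) ⁻¹' D := by
    intro x hx
    by_contra hx'
    simp only [mem_union, not_or, mem_ofPred_eq, not_forall, not_not, mem_iUnion, Finset.mem_range,
      Finset.mem_Ico, mem_preimage, not_exists, exists_prop] at hx'
    obtain ⟨⟨⟨i, hi, hiD⟩, h2⟩, h3⟩ := hx'
    refine hx ⟨i, ?_, hiD, ?_⟩
    · have : ¬ (N - k ≤ i) := fun h => h3 i ⟨⟨h, hi⟩, hiD⟩
      omega
    · by_contra hG
      exact h2 i ⟨hi, hiD, hG⟩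
  have b1 := measureReal_mono (μ := μ) hs
  have b2 := measureReal_union_le (μ := μ) ({x | ∀ i : ℕ, i < N → zit T.toEquiv (-i) x ∉ D} ∪
      (⋃ i ∈ Finset.range N, zit T.toEquiv (-(i : ℕ)) ⁻¹' (D ∩ Gᶜ)))
      (⋃ i ∈ Finset.Ico (N - k) N, zit T.toEquiv (-(i : ℕ)) ⁻¹' D)
  have b3 := measureReal_union_le (μ := μ) {x | ∀ i : ℕ, i < N → zit T.toEquiv (-i) x ∉ D}
      (⋃ i ∈ Finset.range N, zit T.toEquiv (-(i : ℕ)) ⁻¹' (D ∩ Gᶜ))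
  have b4 := measureReal_biUnion_zit_le hT (hD.inter hG.compl) (Finset.range N)
  have b5 := measureReal_biUnion_zit_le hT hD (Finset.Ico (N - k) N)
  rw [Finset.card_range] at b4
  rw [Nat.card_Ico] at b5
  have b6 : ((N - (N - k) : ℕ) : ℝ) * μ.real D ≤ k * μ.real D := by
    refine mul_le_mul_of_nonneg_right ?_ measureReal_nonneg
    exact_mod_cast (by omega : N - (N - k) ≤ k)
  linarith

lemma measureReal_uncovered_le {T : X ≃ᵐ X} (hT : MeasurePreserving T μ μ) {D : Set X}
    (hD : MeasurableSet D) (l g : ℕ) :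
    μ.real {x | ∀ i : ℕ, i < l → zit T.toEquiv (-i) x ∉ D} ≤
      μ.real {x | ∀ i : ℕ, i < l + g → zit T.toEquiv (-i) x ∉ D} + g * μ.real D := by
  have hs : {x | ∀ i : ℕ, i < l → zit T.toEquiv (-i) x ∉ D} ⊆
      {x | ∀ i : ℕ, i < l + g → zit T.toEquiv (-i) x ∉ D} ∪
      ⋃ i ∈ Finset.Ico l (l + g), zit T.toEquiv (-(i : ℕ)) ⁻¹' D := by
    intro x hx
    by_contra hx'
    simp only [mem_union, not_or, mem_ofPred_eq, not_forall, not_not, mem_iUnion,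
      Finset.mem_Ico, mem_preimage, not_exists, exists_prop] at hx'
    obtain ⟨⟨i, hi, hiD⟩, h3⟩ := hx'
    refine hx i ?_ hiD
    have : ¬ (l ≤ i) := fun h => h3 i ⟨⟨h, hi⟩, hiD⟩
    omega
  have b1 := measureReal_mono (μ := μ) hs
  have b2 := measureReal_union_le (μ := μ) {x | ∀ i : ℕ, i < l + g → zit T.toEquiv (-i) x ∉ D}
      (⋃ i ∈ Finset.Ico l (l + g), zit T.toEquiv (-(i : ℕ)) ⁻¹' D)
  have b5 := measureReal_biUnion_zit_le hT hD (Finset.Ico l (l + g))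
  rw [Nat.card_Ico, Nat.add_sub_cancel_left] at b5
  linarith

end Covering

section Stages

variable {X : Type*} [MeasurableSpace X] {Y : Type*} [MetricSpace Y] {e : Y ≃ Y}

/-- A stage of the construction: marked times in `X` carrying words `Q`, realized in `Y` by the
separated points `z`. -/
structure Stage (B : BaseCode e) (T : X ≃ᵐ X) (μ : Measure X) (h : ℝ) where
  Ω : Type
  [fin : Fintype Ω]
  n : ℕ
  l : ℕ
  z : Ω → Y
  Q : X → Option Ω
  r : ℝ
  γ : ℝ
  κ : ℝ
  unc : ℝ
  L : ℕ → ℕ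
  obs : IsObs Q
  l_pos : 0 < l
  r_pos : 0 < r
  r_le : r ≤ B.ε / 2
  γ_nonneg : 0 ≤ γ
  gapFn : IsGapFunction e (r / 2) L
  len_le : l + L l ≤ n
  no_return : ∀ x, Q x ≠ none → ∀ i : ℕ, 0 < i → i < n → Q (zit T.toEquiv i x) = none
  recurrent : ∀ᵐ x ∂μ, ∃ i : ℕ, i < 2 * n ∧ Q (zit T.toEquiv i x) ≠ none
  sep : ∀ y ω ω', Shadows e r l y (z ω) → Shadows e r l y (z ω') → ω = ω'
  info : ∀ ω, ∃ u, u + B.len ≤ l ∧ ∃ b,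
    Shadows e (B.ε - r) B.len (zit e u (z ω)) (B.w (some (some b)))
  entropy : ∀ᶠ m : ℕ in atTop, m * (h - γ) ≤ infoEntropy μ (name T Q m)
  support : infoEntropy μ (fun x => (Q x).isSome) ≤ κ
  uncovered : μ.real {x | ∀ j : ℕ, j < l → Q (zit T.toEquiv (-j) x) = none} ≤ unc

attribute [instance] Stage.fin

variable {B : BaseCode e} {T : X ≃ᵐ X} {μ : Measure X} {h : ℝ}

/-- How a stage `s'` refines a stage `s`: words of `s'` contain words of `s`, determine the values
of `P`, can be located, and visit a neighbourhood of `pt`. -/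
structure Link (s s' : Stage B T μ h) (ρ : ℝ) {α : Type} (P : X → α) (pt : Y) where
  tail : ℕ
  tail_pos : 0 < tail
  Bd : Set X
  Bd_meas : MeasurableSet Bd
  dec : s'.Ω → ℕ → α
  v : ℕ
  v_lt : v < s'.l
  sync : ∀ y ω ω' (t : ℕ), t + tail ≤ s'.n → Shadows e s'.r s'.l y (s'.z ω) →
    Shadows e s'.r s'.l (zit e t y) (s'.z ω') → t = 0
  Bd_le : μ.real Bd ≤ ρ + s.unc + s'.unc
  good : ∀ x, x ∉ Bd → ∃ i : ℕ, i + tail ≤ s'.n ∧ i < s'.l ∧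
    ∃ ω, s'.Q (zit T.toEquiv (-i) x) = some ω ∧ P x = dec ω i ∧
    ∃ j : ℕ, j ≤ i ∧ j < s.l ∧ i - j + s.l ≤ s'.l ∧ ∃ ω₀, s.Q (zit T.toEquiv (-j) x) = some ω₀ ∧
      Shadows e (s.r / 2) s.l (zit e (i - j : ℕ) (s'.z ω)) (s.z ω₀)
  visit : ∀ ω, dist (zit e v (s'.z ω)) pt ≤ s.r / 2

lemma Stage.n_pos (s : Stage B T μ h) : 0 < s.n := s.l_pos.trans_le (by have := s.len_le; omega)

lemma IsObs.indicator {α : Type*} {f : X → α} (hf : IsObs f) {D : Set X} (hD : MeasurableSet D)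
    [DecidablePred (· ∈ D)] : IsObs (fun x => if x ∈ D then some (f x) else none) := by
  intro s
  have : (fun x => if x ∈ D then some (f x) else none) ⁻¹' s =
      (D ∩ f ⁻¹' (some ⁻¹' s)) ∪ (Dᶜ ∩ {_x | none ∈ s}) := by
    ext x
    by_cases hx : x ∈ D <;> simp [hx]
  rw [this]
  exact (hD.inter (hf _)).union (hD.compl.inter (.const _))

end Stages

section Refinement

variable {X : Type*} [MeasurableSpace X] {Y : Type*} [MetricSpace Y] {e : Y ≃ Y}
variable {B : BaseCode e} {T : X ≃ᵐ X} {μ : Measure X} [IsProbabilityMeasure μ] {h : ℝ}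

/-- The refinement of a stage attached to a marker set `D` and to a coding of long names. -/
lemma Stage.exists_refinement (hT : MeasurePreserving T μ μ) (s : Stage B T μ h) {α : Type}
    [Fintype α] {P : X → α} (hP : IsObs P) {L : ℕ → ℕ} (hL : IsGapFunction e (s.r / 2 / 2) L)
    {q len N tail a : ℕ} (ha : a = q * B.R + s.n) (hq : 4 * s.n + 4 < q)
    (hN : q * B.R + s.n + len + 2 * s.n + 1 + L N = N)
    (htail : tail = L N + 6 * s.n + B.R + 2)
    {D G : Set X} (hD : MeasurableSet D) (hG : MeasurableSet G) (hGne : G.Nonempty)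
    (hret : ∀ x ∈ D, ∀ i : ℕ, 0 < i → i < N → zit T.toEquiv i x ∉ D)
    (hrec : ∀ᵐ x ∂μ, ∃ i : ℕ, i < 2 * N ∧ zit T.toEquiv i x ∈ D)
    {hdr : X → Fin q → Option (Option (Fin B.A))}
    (sdec : (Fin q → Option (Option (Fin B.A))) → Fin len → Bool)
    (ndec : (Fin q → Option (Option (Fin B.A))) → (Fin len → Option s.Ω) →
      (Fin a → α) × (Fin len → α))
    (ohdr : IsObs hdr)
    (hcode : ∀ x ∈ G,
      IsWord (4 * s.n + 4) s.n (hdr x) (name T s.Q len (T^[a] x)) ∧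
      (∀ i, sdec (hdr x) i = (name T s.Q len (T^[a] x) i).isSome) ∧
      ndec (hdr x) (name T s.Q len (T^[a] x)) =
        (name T P a x, name T P len (T^[a] x)))
    {ρ γ' κ' η' : ℝ} (hγ' : 0 < γ') (hent : h - γ' / 4 < entropyWrt μ T P)
    (hunc : μ.real {x | ∀ i : ℕ, i < N → zit T.toEquiv (-i) x ∉ D} + L N * μ.real D ≤ η')
    (hκ : ∀ Z : X → Bool, IsObs Z → {x | Z x ≠ false} = D → infoEntropy μ Z ≤ κ')
    (hZ : ∀ Z : X → Option α, IsObs Z →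
      {x | Z x ≠ none} = {x | ∃ i : ℕ, i + tail ≤ N ∧ zit T.toEquiv (-i) x ∈ D ∩ G}ᶜ →
      infoEntropy μ Z ≤ γ' / 4)
    (hBd : μ.real {x | ∃ i : ℕ, i + tail ≤ N ∧ zit T.toEquiv (-i) x ∈ D ∩ G}ᶜ +
      ((a + s.l : ℕ) : ℝ) * μ.real D ≤ ρ + η') (pt : Y) :
    ∃ s' : Stage B T μ h, s'.r = s.r / 2 ∧ s'.γ = γ' ∧ s'.κ = κ' ∧ s'.unc = η' ∧
      Nonempty (Link s s' ρ P pt) := by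
  classical
  set K : X → Fin len → Option s.Ω := fun x => name T s.Q len (T^[a] x) with hK
  have oK : IsObs K := (s.obs.name T.measurable len).comp_right (T.measurable.iterate a)
  set V : (Fin q → Option (Option (Fin B.A))) × (Fin len → Option s.Ω) → Prop := fun p =>
    IsWord (4 * s.n + 4) s.n p.1 p.2 ∧ ∀ i, sdec p.1 i = (p.2 i).isSome with hV
  obtain ⟨x₀, hx₀⟩ := hGne
  set Ω' := {p // V p} with hΩ'
  let ω₀ : Ω' := ⟨(hdr x₀, K x₀), (hcode x₀ hx₀).1, (hcode x₀ hx₀).2.1⟩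
  let wd : X → Ω' := fun x => if hp : V (hdr x, K x) then ⟨(hdr x, K x), hp⟩ else ω₀
  have owd : IsObs wd := (ohdr.pair oK).comp fun p => if hp : V p then ⟨p, hp⟩ else ω₀
  have hwd : ∀ x ∈ G, (wd x).1 = (hdr x, K x) := by
    intro x hx
    have hp : V (hdr x, K x) := ⟨(hcode x hx).1, (hcode x hx).2.1⟩
    simp only [wd, hp, dif_pos]
  have hnpos := s.n_pos
  have hln := s.len_le
  have hlpos := s.l_pos
  choose z' hz' using fun ω : Ω' => exists_realizes B s.z pt s.gapFn s.l_pos s.len_le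
    (by omega) ω.1.1 ω.1.2 ω.2.1
  let Q' : X → Option Ω' := fun x => if x ∈ D then some (wd x) else none
  have oQ' : IsObs Q' := owd.indicator hD
  have hQ'D : ∀ x, Q' x ≠ none ↔ x ∈ D := by
    intro x; by_cases hx : x ∈ D <;> simp [Q', hx]
  have hQ'n : ∀ x, Q' x = none ↔ x ∉ D := by
    intro x; by_cases hx : x ∈ D <;> simp [Q', hx]
  set l' := a + len + 2 * s.n + 1 with hl'
  set U : Set X := {x | ∃ i : ℕ, i + tail ≤ N ∧ zit T.toEquiv (-i) x ∈ D ∩ G} with hU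
  have mU : MeasurableSet U := by
    have : U = ⋃ i : ℕ, {_x | i + tail ≤ N} ∩ zit T.toEquiv (-i) ⁻¹' (D ∩ G) := by
      ext x; simp [hU]
    rw [this]
    exact .iUnion fun i => (MeasurableSet.const _).inter (measurable_zit T _ (hD.inter hG))
  let dec : Ω' → ℕ → α := fun ω i => if hi : i < a then (ndec ω.1.1 ω.1.2).1 ⟨i, hi⟩ else
    if hi' : i - a < len then (ndec ω.1.1 ω.1.2).2 ⟨i - a, hi'⟩ else P x₀
  have hback : ∀ (i : ℕ) (x : X), T^[i] (zit T.toEquiv (-i) x) = x := by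
    intro i x
    rw [iterate_eq_zit, zit_add, add_neg_cancel, zit_zero]
  have hdec : ∀ x (i : ℕ), i + tail ≤ N → zit T.toEquiv (-i) x ∈ D ∩ G →
      P x = dec (wd (zit T.toEquiv (-i) x)) i := by
    intro x i hi hx
    have h1 := (hcode _ hx.2).2.2
    have h2 := hback i x
    simp only [dec, hwd _ hx.2]
    rw [h1]
    split_ifs with h3 h4
    · simp only [name]; rw [h2]
    · simp only [name]
      rw [← Function.iterate_add_apply, Nat.sub_add_cancel (by omega), h2]
    · omega
  have hsome : ∀ x, x ∈ D → Q' x = some (wd x) := fun x hx => by simp [Q', hx]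
  set Z : X → Option α := fun x => if x ∈ Uᶜ then some (P x) else none with hZd
  have oZ : IsObs Z := hP.indicator mU.compl
  have hZs : {x | Z x ≠ none} = Uᶜ := by
    ext x; by_cases hx : x ∈ U <;> simp [hZd, hx]
  have hent' := eventually_le_of_window hT hP oQ' oZ (N := N) (h := h) (θ := γ') (by
    intro x y hxy hQ
    by_cases hx : x ∈ U
    · have hy : y ∈ U := by
        by_contra hy
        simp [hZd, hx, hy] at hxy
      obtain ⟨i, hi, hiD⟩ := hx
      obtain ⟨j, hj, hjD⟩ := hy
      have h1 := hQ i (by omega)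
      rw [hsome _ hiD.1] at h1
      have h2 : zit T.toEquiv (-i) y ∈ D := (hQ'D _).1 (by rw [← h1]; simp)
      have hij : i = j := by
        rcases lt_trichotomy i j with h3 | h3 | h3
        · refine absurd ?_ (hret _ hjD.1 (j - i) (by omega) (by omega))
          rw [zit_add]
          convert h2 using 2
          omega
        · exact h3
        · refine absurd ?_ (hret _ h2 (i - j) (by omega) (by omega))
          rw [zit_add]
          convert hjD.1 using 2
          omega
      subst hij
      rw [hsome _ h2] at h1
      rw [hdec x i hi hiD, hdec y i hj hjD, Option.some.inj h1]
    · have hy : y ∉ U := by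
        intro hy
        simp [hZd, hx, hy] at hxy
      simpa [hZd, hx, hy] using hxy) hγ' hent (hZ Z oZ hZs)
  have hreal : ∀ ω : Ω', Realizes B s.r s.n s.l s.z pt ω.1.1 ω.1.2 (z' ω) := hz'
  let s' : Stage B T μ h :=
    { Ω := Ω'
      fin := Fintype.ofFinite _
      n := N
      l := l'
      z := z'
      Q := Q'
      r := s.r / 2
      γ := γ'
      κ := κ'
      unc := η'
      L := L
      obs := oQ'
      l_pos := by omega
      r_pos := half_pos s.r_pos
      r_le := by have := s.r_le; have := s.r_pos; linarith
      γ_nonneg := hγ'.le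
      gapFn := hL
      len_le := by
        have : L l' ≤ L N := hL.1 (by omega)
        omega
      no_return := fun x hx i hi hi' => (hQ'n _).2 (hret x ((hQ'D x).1 hx) i hi hi')
      recurrent := hrec.mono fun x ⟨i, hi, hx⟩ => ⟨i, hi, (hQ'D _).2 hx⟩
      sep := by
        intro y ω ω' hy hy'
        have h1 := (hreal ω).header_eq (hreal ω') s.r_le (by omega) hy hy'
        have h2 : ∀ i, (ω.1.2 i).isSome = (ω'.1.2 i).isSome := fun i => by
          rw [← ω.2.2 i, ← ω'.2.2 i, h1]
        have h3 := (hreal ω).content_eq (hreal ω') s.sep h2 (by omega) hy hy'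
        exact Subtype.ext (Prod.ext h1 h3)
      info := by
        intro ω
        obtain ⟨u, hu, b, hb⟩ := (hreal ω).info ω.2.1 s.r_le hq
        exact ⟨u, by omega, b, hb⟩
      entropy := by convert hent'
      support := by
        refine hκ _ (oQ'.comp _) ?_
        ext x
        by_cases hx : x ∈ D <;> simp [Q', hx]
      uncovered := by
        have h1 := measureReal_uncovered_le hT hD l' (L N)
        have h2 : l' + L N = N := by omega
        rw [h2] at h1
        refine le_trans (le_of_eq_of_le ?_ h1) hunc
        congr 1
        ext x
        simp only [mem_ofPred_eq, hQ'n] }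
  refine ⟨s', rfl, rfl, rfl, rfl, ⟨?_⟩⟩
  set W : Set X := {x | ∀ j : ℕ, j < s.l → s.Q (zit T.toEquiv (-j) x) = none} with hW
  have mW : MeasurableSet W := by
    have : W = ⋂ j ∈ Finset.range s.l, zit T.toEquiv (-(j : ℕ)) ⁻¹' (s.Q ⁻¹' {none}) := by
      ext x; simp [hW]
    rw [this]
    exact .biInter (Set.to_countable _) fun j _ => measurable_zit T _ (s.obs _)
  set V' : Set X := ⋃ i ∈ Finset.range (a + s.l), zit T.toEquiv (-(i : ℕ)) ⁻¹' D with hV'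
  have mV' : MeasurableSet V' :=
    .biUnion (Set.to_countable _) fun i _ => measurable_zit T _ hD
  refine
    { tail := tail
      tail_pos := by omega
      Bd := Uᶜ ∪ V' ∪ W
      Bd_meas := (mU.compl.union mV').union mW
      dec := dec
      v := a + len + 2 * s.n
      v_lt := Nat.lt_succ_self _
      sync := ?_
      Bd_le := ?_
      good := ?_
      visit := fun ω => ha ▸ (hreal ω).visit }
  · intro y ω ω' t ht hy hy'
    change t + tail ≤ N at ht
    exact (hreal ω).sync (hreal ω') ω.2.1 ω'.2.1 s.r_le hnpos (by omega) le_rfl hq s.info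
      (show q * B.R + s.n + len + s.l ≤ l' by omega) (by omega) hy hy'
  · have b1 := measureReal_union_le (μ := μ) (Uᶜ ∪ V') W
    have b2 := measureReal_union_le (μ := μ) Uᶜ V'
    have b3 := measureReal_biUnion_zit_le hT hD (Finset.range (a + s.l))
    rw [Finset.card_range] at b3
    have b4 := s.uncovered
    change μ.real (Uᶜ ∪ V' ∪ W) ≤ ρ + s.unc + η'
    linarith
  · intro x hx
    simp only [mem_union, not_or, mem_compl_iff, not_not] at hx
    obtain ⟨⟨⟨i, hi, hiD⟩, h2⟩, h3⟩ := hx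
    simp only [hW, mem_ofPred_eq, not_forall] at h3
    obtain ⟨j, hj, hjQ⟩ := h3
    obtain ⟨ω₁, hω₁⟩ := Option.ne_none_iff_exists'.1 hjQ
    have hia : a + s.l ≤ i := by
      by_contra hlt
      refine h2 ?_
      simp only [hV', mem_iUnion, Finset.mem_range, exists_prop]
      exact ⟨i, by omega, hiD.1⟩
    refine ⟨i, hi, show i < l' by omega, wd (zit T.toEquiv (-i) x), hsome _ hiD.1,
      hdec x i hi hiD, j, by omega, hj, show i - j + s.l ≤ l' by omega, ω₁, hω₁, ?_⟩
    have hlt : i - j - a < len := by omega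
    have h4 := (hreal (wd (zit T.toEquiv (-i) x))).content ⟨i - j - a, hlt⟩ ω₁ (by
      rw [hwd _ hiD.2]
      simp only [hK, name]
      rw [← hω₁, ← Function.iterate_add_apply, iterate_eq_zit, zit_add]
      congr 2
      omega)
    have h5 : a + (i - j - a) = i - j := by omega
    simp only [← ha, h5] at h4
    exact h4

end Refinement

section Existence

variable {X : Type*} [MeasurableSpace X] {Y : Type*} [MetricSpace Y] {e : Y ≃ Y}
variable {B : BaseCode e} {T : X ≃ᵐ X} {μ : Measure X} [IsProbabilityMeasure μ] {h : ℝ}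

lemma BaseCode.A_pos (B : BaseCode e) : 0 < B.A := by
  have := (Real.exp_pos _).trans_le B.card_le
  exact_mod_cast this

lemma BaseCode.R_pos (B : BaseCode e) : 0 < B.R := B.len_pos.trans_le B.len_le

theorem Stage.exists_initial [StandardBorelSpace X] [NullSingletonClass μ]
    (hspec : AlmostWeakSpec e) (hT : Ergodic T μ) (hh : 0 ≤ h) (B : BaseCode e) :
    ∃ s : Stage B T μ h, s.r = B.ε / 2 ∧ s.γ = h ∧ s.κ = 1 := by
  classical
  obtain ⟨L, hL, -⟩ := hspec (B.ε / 2 / 2) (by have := B.ε_pos; positivity)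
  obtain ⟨δ, hδ, hent⟩ := exists_small_entropy Bool false one_pos
  obtain ⟨n₁, hn₁⟩ := exists_nat_gt (1 / δ)
  set n := max n₁ (B.len + L B.len) with hn
  have hn0 : 0 < n := by have := B.len_pos; omega
  obtain ⟨D, hD, hret, hrec, -, -⟩ := exists_marker (μ := μ) hT hn0 one_pos MeasurableSet.empty
  set Q : X → Option Unit := fun x => if x ∈ D then some () else none with hQ
  have oQ : IsObs Q := IsObs.indicator (f := fun _ : X => ()) (fun s => .const _) hD
  have hQD : ∀ x, Q x ≠ none ↔ x ∈ D := by
    intro x; by_cases hx : x ∈ D <;> simp [hQ, hx]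
  exact ⟨{
    Ω := Unit
    n := n
    l := B.len
    z := fun _ => B.w (some (some ⟨0, B.A_pos⟩))
    Q := Q
    r := B.ε / 2
    γ := h
    κ := 1
    unc := 1
    L := L
    obs := oQ
    l_pos := B.len_pos
    r_pos := half_pos B.ε_pos
    r_le := le_rfl
    γ_nonneg := hh
    gapFn := hL
    len_le := le_max_right _ _
    no_return := fun x hx i hi hi' =>
      not_ne_iff.1 fun hx' => hret x ((hQD x).1 hx) i hi hi' ((hQD _).1 hx')
    recurrent := hrec.mono fun x ⟨i, hi, hx⟩ => ⟨i, hi, (hQD _).2 hx⟩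
    sep := fun _ _ _ _ _ => rfl
    info := fun _ => ⟨0, by simp, ⟨0, B.A_pos⟩, fun i _ => by
      have := B.ε_pos
      simp only [Nat.cast_zero, zit_zero, dist_self]; linarith⟩
    entropy := Eventually.of_forall fun m => by
      rw [sub_self, mul_zero]; exact infoEntropy_nonneg _
    support := by
      refine hent μ _ (oQ.comp _) ?_
      have h1 : {x | (Q x).isSome ≠ false} = D := by
        ext x; by_cases hx : x ∈ D <;> simp [hQ, hx]
      rw [h1]
      have h2 := card_mul_measureReal_le_one hT.toMeasurePreserving hD hret
      have h3 : 1 / δ < n := hn₁.trans_le (by exact_mod_cast le_max_left _ _)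
      rw [div_lt_iff₀ hδ] at h3
      have h4 : (0 : ℝ) < n := by exact_mod_cast hn0
      nlinarith
    uncovered := measureReal_le_one }, rfl, rfl, rfl⟩

theorem Stage.exists_next [StandardBorelSpace X] [NullSingletonClass μ]
    (hspec : AlmostWeakSpec e) (hT : Ergodic T μ) (hh : 0 ≤ h)
    (hks : ∀ (α : Type) [Fintype α] (P : X → α), IsObs P → entropyWrt μ T P ≤ h)
    (s : Stage B T μ h) {ρ : ℝ} (hρ0 : 0 < ρ) (hρ1 : ρ < 1)
    (hcap : ρ * h + (1 - ρ) * (s.γ + s.κ) < ρ * B.rate) {α : Type} [Fintype α] {P : X → α}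
    (hP : IsObs P) {γ' κ' η' : ℝ} (hγ' : 0 < γ') (hκ' : 0 < κ') (hη' : 0 < η')
    (hent : h - γ' / 4 < entropyWrt μ T P) (pt : Y) :
    ∃ s' : Stage B T μ h, s'.r = s.r / 2 ∧ s'.γ = γ' ∧ s'.κ = κ' ∧ s'.unc = η' ∧
      Nonempty (Link s s' ρ P pt) := by
  classical
  have hX : Nonempty X := nonempty_of_isProbabilityMeasure μ
  have hTm := hT.toMeasurePreserving
  have hκ0 : 0 ≤ s.κ := (infoEntropy_nonneg _).trans s.support
  have hγ0 := s.γ_nonneg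
  have hnpos := s.n_pos
  have hrate : 0 ≤ B.rate := by
    by_contra hneg
    push Not at hneg
    nlinarith [mul_nonneg hρ0.le hh, mul_nonneg (sub_nonneg.2 hρ1.le) (add_nonneg hγ0 hκ0),
      mul_pos hρ0 (neg_pos.2 hneg)]
  set τ := (ρ * B.rate - (ρ * h + (1 - ρ) * (s.γ + s.κ))) / 3 with hτd
  have hτ : 0 < τ := by have := sub_pos.2 hcap; positivity
  obtain ⟨δZ, hδZ, hZ⟩ := exists_small_entropy (Option α) none (show 0 < γ' / 4 by linarith)
  obtain ⟨δκ, hδκ, hK⟩ := exists_small_entropy Bool false hκ'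
  set η := min (min δZ η') 1 / 8 with hηd
  have hη : 0 < η := by positivity
  have hη1 : 8 * η ≤ δZ := by
    have : min (min δZ η') 1 ≤ δZ := (min_le_left _ _).trans (min_le_left _ _)
    linarith
  have hη2 : 8 * η ≤ η' := by
    have : min (min δZ η') 1 ≤ η' := (min_le_left _ _).trans (min_le_right _ _)
    linarith
  have hη3 : 8 * η ≤ 1 := by
    have : min (min δZ η') 1 ≤ 1 := min_le_right _ _
    linarith
  obtain ⟨k₁, hk₁⟩ := exists_good_set hT hP s.obs hτ (hks α P hP) (hks _ _ (hP.pair s.obs))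
    s.entropy s.support (n := s.n)
    (s.recurrent.mono fun x ⟨i, hi, hx⟩ => ⟨i, hi, by rwa [iterate_eq_zit]⟩) hη
  obtain ⟨L, hL, hLlim⟩ := hspec (s.r / 2 / 2) (by have := s.r_pos; positivity)
  set c := 4 * s.n + 4 with hc
  set k := k₁ + c + s.n + s.l + 1 with hk
  have t : ∀ a : ℝ, 0 < a → ∀ b : ℝ, ∀ᶠ N : ℕ in atTop, b ≤ a * N := by
    intro a ha b
    exact (tendsto_natCast_atTop_atTop.const_mul_atTop ha).eventually_ge_atTop b
  have hlay := eventually_exists_layout hLlim B.R_pos s.n k (α := h + τ)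
    (β := s.γ + s.κ + 2 * τ) (θ := B.rate) (C := s.n * (h + τ) + c * B.R * B.rate) hρ0 hρ1 hη
    (by positivity) (by positivity) (by nlinarith)
  obtain ⟨N, ⟨q, len, hq, hlen, hN, hN1, hN2, hN3⟩, hN4, hN5, hN0⟩ :=
    (hlay.and ((t η hη (6 * s.n + B.R + 2)).and
      ((t δκ hδκ 1).and (eventually_gt_atTop 0)))).exists
  have hqR : q ≤ q * B.R := Nat.le_mul_of_pos_right _ B.R_pos
  set a := q * B.R + s.n with ha
  obtain ⟨G, hG, hGη, c₁, c₂, c₃, hgap⟩ := hk₁ a len (by omega) (by omega)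
  have hNpos : (0 : ℝ) < N := by exact_mod_cast hN0
  obtain ⟨D, hD, hret, hrec, hno, hbad⟩ := exists_marker (μ := μ) hT hN0 hη hG.compl
  have hDN := card_mul_measureReal_le_one hTm hD hret
  have hDle : μ.real D ≤ 1 / N := by rw [le_div_iff₀ hNpos]; linarith
  have hDmul : ∀ b θ : ℝ, b ≤ θ * N → 0 ≤ θ → b * μ.real D ≤ θ := by
    intro b θ hb hθ
    calc b * μ.real D ≤ θ * N * μ.real D := mul_le_mul_of_nonneg_right hb measureReal_nonneg
      _ = θ * (N * μ.real D) := by ring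
      _ ≤ θ * 1 := mul_le_mul_of_nonneg_left hDN hθ
      _ = θ := mul_one θ
  obtain ⟨hdr, sdec, ndec, ohdr, hcode⟩ := exists_coding T.measurable hP s.obs (n := s.n) (q := q)
    (c := c) (A := B.A) (by omega) B.A_pos c₁ c₂ c₃ hgap hnpos
    (fun x hx i hi hi' => by rw [iterate_eq_zit]; exact s.no_return x hx i hi hi') (by
      rw [← Real.exp_add, ← Real.exp_add]
      calc _ ≤ Real.exp (B.R * B.rate) ^ (q - c) := by
            rw [← Real.exp_nat_mul, Real.exp_le_exp, Nat.cast_sub (by omega), ha]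
            push_cast
            linarith
        _ ≤ _ := pow_le_pow_left₀ (Real.exp_pos _).le B.card_le _)
  have hGne : G.Nonempty := by
    by_contra hne
    rw [Set.not_nonempty_iff_eq_empty] at hne
    rw [hne, compl_empty, probReal_univ] at hGη
    linarith
  have hU := measureReal_compl_decodable_le hTm hD hG N (L N + 6 * s.n + B.R + 2)
  have hU' : μ.real {x | ∃ i : ℕ, i + (L N + 6 * s.n + B.R + 2) ≤ N ∧
      zit T.toEquiv (-i) x ∈ D ∩ G}ᶜ ≤ 4 * η := by
    have h1 := hDmul ((L N + 6 * s.n + B.R + 2 : ℕ) : ℝ) (2 * η) (by push_cast; linarith)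
      (by positivity)
    linarith
  refine Stage.exists_refinement hTm s hP hL ha (by omega) hN rfl hD hG hGne hret hrec sdec ndec
    ohdr hcode hγ' hent ?_ ?_ ?_ ?_ pt
  · have h1 := hDmul (L N) η hN2 hη.le
    linarith
  · intro Z oZ hZD
    refine hK μ Z oZ ?_
    rw [hZD]
    have h1 := hDmul 1 δκ hN5 hδκ.le
    linarith
  · intro Z oZ hZU
    refine hZ μ Z oZ ?_
    rw [hZU]
    linarith
  · have h1 := hDmul ((a + s.l : ℕ) : ℝ) (ρ + η) (by
      refine le_trans ?_ hN1
      have h2 : a + s.l ≤ L N + q * B.R + k := by omega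
      exact_mod_cast h2) (by positivity)
    linarith

end Existence

section Limit

variable {X : Type*} [MeasurableSpace X] {Y : Type*} [MetricSpace Y] {e : Y ≃ Y}
variable {B : BaseCode e} {T : X ≃ᵐ X} {μ : Measure X} {h : ℝ}

/-- The point `x` lies at position `i` of an occurrence of the word `ω` of the stage `s`. -/
def Stage.At (s : Stage B T μ h) (x : X) (i : ℕ) (ω : s.Ω) : Prop :=
  i < s.l ∧ s.Q (zit T.toEquiv (-i) x) = some ω

lemma Stage.l_lt_n (s : Stage B T μ h) : s.l < s.n := by
  have h1 := s.len_le
  have h2 := s.gapFn.2.1 s.l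
  omega

lemma Stage.At.le_of {s : Stage B T μ h} {x : X} {i i' : ℕ} {ω ω' : s.Ω} (h1 : s.At x i ω)
    (h2 : s.At x i' ω') : i ≤ i' := by
  by_contra! hlt
  have h3 := s.no_return (zit T.toEquiv (-i) x) (by simp [h1.2]) (i - i') (by omega)
    (by have := s.l_lt_n; have := h1.1; omega)
  rw [zit_add, show ((i - i' : ℕ) : ℤ) + -i = -i' by omega, h2.2] at h3
  simp at h3

lemma Stage.At.pos_unique {s : Stage B T μ h} {x : X} {i i' : ℕ} {ω ω' : s.Ω}
    (h1 : s.At x i ω) (h2 : s.At x i' ω') : i = i' :=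
  le_antisymm (h1.le_of h2) (h2.le_of h1)

lemma Stage.At.word_unique {s : Stage B T μ h} {x : X} {i i' : ℕ} {ω ω' : s.Ω}
    (h1 : s.At x i ω) (h2 : s.At x i' ω') : ω = ω' := by
  have h3 := h1.2
  rw [h1.pos_unique h2, h2.2] at h3
  exact (Option.some.inj h3).symm

lemma Stage.At.succ {s : Stage B T μ h} {x : X} {i i' : ℕ} {ω ω' : s.Ω}
    (h1 : s.At x i ω) (h2 : s.At (T x) i' ω') : i' = i + 1 ∧ ω' = ω := by
  have h2' := h2.2
  rw [show T x = T.toEquiv x from rfl, zit_apply] at h2'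
  rcases i' with _ | i'
  · have h3 := s.no_return (zit T.toEquiv (-i) x) (by simp [h1.2]) (i + 1) (by omega)
      (by have := s.l_lt_n; have := h1.1; omega)
    rw [zit_add, show ((i + 1 : ℕ) : ℤ) + -i = -((0 : ℕ) : ℤ) + 1 by push_cast; ring, h2'] at h3
    simp at h3
  · have h3 : s.At x i' ω' := by
      refine ⟨by have := h2.1; omega, ?_⟩
      rw [← h2']; congr 2; push_cast; ring
    exact ⟨by rw [h1.pos_unique h3], (h1.word_unique h3).symm⟩

open Classical in
/-- The point of `Y` read off from a symbol occurring in a past of length `s.l`. -/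
noncomputable def Stage.point (s : Stage B T μ h) (y₀ : Y) (q : Fin s.l → Option s.Ω) : Y :=
  if hq : ∃ p : Fin s.l × s.Ω, q p.1 = some p.2 then
    zit e (hq.choose.1 : ℕ) (s.z hq.choose.2) else y₀

/-- The point of `Y` approximating the image of `x` at stage `s`. -/
noncomputable def Stage.approx (s : Stage B T μ h) (y₀ : Y) (x : X) : Y :=
  s.point y₀ fun i => s.Q (zit T.toEquiv (-(i : ℕ)) x)

lemma Stage.At.approx_eq {s : Stage B T μ h} {x : X} {i : ℕ} {ω : s.Ω} (h1 : s.At x i ω)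
    (y₀ : Y) : s.approx y₀ x = zit e i (s.z ω) := by
  have hq : ∃ p : Fin s.l × s.Ω, s.Q (zit T.toEquiv (-((p.1 : ℕ) : ℤ)) x) = some p.2 :=
    ⟨(⟨i, h1.1⟩, ω), h1.2⟩
  have h2 : s.At x hq.choose.1 hq.choose.2 := ⟨hq.choose.1.2, hq.choose_spec⟩
  have h3 : s.approx y₀ x = zit e (hq.choose.1 : ℕ) (s.z hq.choose.2) := dif_pos hq
  rw [h3, ← h1.pos_unique h2, ← h1.word_unique h2]

lemma Stage.isObs_approx (s : Stage B T μ h) (y₀ : Y) : IsObs (s.approx y₀) :=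
  (isObs_pi fun i : Fin s.l => s.obs.comp_right (measurable_zit T (-(i : ℕ)))).comp (s.point y₀)

end Limit

section Tower

variable {X : Type*} [MeasurableSpace X] {Y : Type*} [MetricSpace Y] [CompactSpace Y] {S : Y ≃ₜ Y}
variable {B : BaseCode S.toEquiv} {T : X ≃ᵐ X} {μ : Measure X} {h : ℝ}
variable {s : ℕ → Stage B T μ h} {ρ : ℕ → ℝ} {α : ℕ → Type} {P : ∀ k, X → α k} {pt : ℕ → Y}

/-- Positions `p`, words `ω` and a limit point `y` encoding `x` along a tower of stages. -/
structure Encodes (lk : ∀ k, Link (s k) (s (k + 1)) (ρ k) (P k) (pt k)) (y₀ : Y) (x : X) (y : Y)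
    (p : ℕ → ℕ) (ω : ∀ k, (s k).Ω) : Prop where
  tendsto : Tendsto (fun k => (s k).approx y₀ x) atTop (nhds y)
  at_pos : ∀ k, (s k).At x (p k) (ω k)
  shadows : ∀ k, Shadows S.toEquiv (s k).r (s k).l (zit S.toEquiv (-(p k : ℕ)) y) ((s k).z (ω k))
  tail_le : ∀ k, p (k + 1) + (lk k).tail ≤ (s (k + 1)).n
  decodes : ∀ k, P k x = (lk k).dec (ω (k + 1)) (p (k + 1))

lemma exists_encodes (lk : ∀ k, Link (s k) (s (k + 1)) (ρ k) (P k) (pt k))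
    (hr : ∀ k, (s (k + 1)).r = (s k).r / 2) (y₀ : Y) {x : X} (hx : ∀ k, x ∉ (lk k).Bd) :
    ∃ y p ω, Encodes lk y₀ x y p ω := by
  choose i hi hil ω' hω' hdec p hpi hpl hwin ω hω hsh using fun k => (lk k).good x (hx k)
  have hat : ∀ k, (s k).At x (p k) (ω k) := fun k => ⟨hpl k, hω k⟩
  have hat' : ∀ k, (s (k + 1)).At x (i k) (ω' k) := fun k => ⟨hil k, hω' k⟩
  obtain rfl : i = fun k => p (k + 1) := funext fun k => (hat' k).pos_unique (hat (k + 1))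
  obtain rfl : ω' = fun k => ω (k + 1) := funext fun k => (hat' k).word_unique (hat (k + 1))
  simp only at hi hil hω' hdec hpi hwin hsh
  set φ : ℕ → Y := fun k => (s k).approx y₀ x with hφ
  have hφe : ∀ k, φ k = zit S.toEquiv (p k) ((s k).z (ω k)) := fun k => (hat k).approx_eq y₀
  have hrk : ∀ k m, (s (k + m)).r = (s k).r / 2 ^ m := by
    intro k m
    induction m with
    | zero => simp
    | succ m ih => rw [← add_assoc, hr, ih, pow_succ]; field_simp
  have hmono : ∀ k m, p k ≤ p (k + m) ∧ p (k + m) - p k + (s k).l ≤ (s (k + m)).l := by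
    intro k m
    induction m with
    | zero => simp
    | succ m ih =>
      have h1 := hpi (k + m)
      have h2 := hwin (k + m)
      rw [← add_assoc]; omega
  have hstep : ∀ k (t : ℕ), t < (s k).l → dist (zit S.toEquiv ((t : ℤ) - p k) (φ k))
      (zit S.toEquiv ((t : ℤ) - p k) (φ (k + 1))) ≤ (s k).r / 2 := by
    intro k t ht
    have h1 := hsh k t ht
    rw [zit_add] at h1
    rw [hφe, hφe, zit_add, zit_add, dist_comm]
    have h2 : (t : ℤ) - p k + p (k + 1) = t + (p (k + 1) - p k : ℕ) := by have := hpi k; omega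
    rwa [h2, sub_add_cancel]
  have hall : ∀ k (t : ℕ), t < (s k).l → ∀ m, dist (zit S.toEquiv ((t : ℤ) - p k) (φ (k + m)))
      (zit S.toEquiv ((t : ℤ) - p k) (φ (k + m + 1))) ≤ (s k).r / 2 / 2 ^ m := by
    intro k t ht m
    have h1 := hmono k m
    have h2 := hstep (k + m) (t + (p (k + m) - p k)) (by omega)
    rw [hrk] at h2
    have h3 : ((t + (p (k + m) - p k) : ℕ) : ℤ) - p (k + m) = (t : ℤ) - p k := by omega
    rw [h3] at h2
    refine h2.trans (le_of_eq ?_)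
    ring
  have hc : CauchySeq φ := by
    refine cauchySeq_of_le_geometric_two (C := (s 0).r) fun m => ?_
    have := hall 0 (p 0) (hpl 0) m
    simpa using this
  obtain ⟨y, hy⟩ := cauchySeq_tendsto_of_complete hc
  refine ⟨y, p, ω, hy, hat, fun k t ht => ?_, hi, hdec⟩
  have h1 : Tendsto (fun m => zit S.toEquiv ((t : ℤ) - p k) (φ (k + m))) atTop
      (nhds (zit S.toEquiv ((t : ℤ) - p k) y)) := by
    have := hy.comp (tendsto_add_atTop_nat k)
    refine ((continuous_zit S _).tendsto y).comp (this.congr fun m => ?_)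
    simp [add_comm]
  have h2 := dist_le_of_le_geometric_two_of_tendsto₀ (f := fun m =>
    zit S.toEquiv ((t : ℤ) - p k) (φ (k + m))) (hall k t ht) h1
  rw [dist_comm, add_zero, hφe, zit_add, sub_add_cancel] at h2
  rwa [zit_add, ← sub_eq_add_neg]

variable {lk : ∀ k, Link (s k) (s (k + 1)) (ρ k) (P k) (pt k)} {y₀ : Y} {x x' : X} {y y' : Y}
  {p p' : ℕ → ℕ} {ω ω' : ∀ k, (s k).Ω}

lemma Encodes.map_eq (hx : Encodes lk y₀ x y p ω) (hx' : Encodes lk y₀ (T x) y' p' ω') :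
    y' = S y := by
  refine tendsto_nhds_unique hx'.tendsto (((S.continuous.tendsto y).comp hx.tendsto).congr ?_)
  intro k
  obtain ⟨h1, h2⟩ := (hx.at_pos k).succ (hx'.at_pos k)
  rw [(hx'.at_pos k).approx_eq, Function.comp_apply, (hx.at_pos k).approx_eq, h1, h2]
  have := apply_zit S.toEquiv (p k) ((s k).z (ω k))
  push_cast
  exact this

lemma Encodes.pos_le (hx : Encodes lk y₀ x y p ω) (hx' : Encodes lk y₀ x' y p' ω') (k : ℕ) :
    p (k + 1) ≤ p' (k + 1) := by
  by_contra! hlt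
  have h1 := hx.tail_le k
  have := (lk k).sync (zit S.toEquiv (-(p (k + 1) : ℕ)) y) (ω (k + 1)) (ω' (k + 1))
    (p (k + 1) - p' (k + 1)) (by omega) (hx.shadows _) (by
      rw [zit_add, show ((p (k + 1) - p' (k + 1) : ℕ) : ℤ) + -p (k + 1) = -p' (k + 1) by omega]
      exact hx'.shadows _)
  omega

lemma Encodes.obs_eq (hx : Encodes lk y₀ x y p ω) (hx' : Encodes lk y₀ x' y p' ω') (k : ℕ) :
    P k x = P k x' := by
  have h1 : p (k + 1) = p' (k + 1) := le_antisymm (hx.pos_le hx' k) (hx'.pos_le hx k)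
  have h2 := hx'.shadows (k + 1)
  rw [← h1] at h2
  rw [hx.decodes, hx'.decodes, h1, (s (k + 1)).sep _ _ _ (hx.shadows (k + 1)) h2]

lemma Encodes.visit (hr : ∀ k, (s (k + 1)).r = (s k).r / 2) (hx : Encodes lk y₀ x y p ω) (k : ℕ) :
    ∃ t : ℤ, dist (zit S.toEquiv t y) (pt k) ≤ (s k).r := by
  refine ⟨(lk k).v + -p (k + 1), ?_⟩
  have h1 := hx.shadows (k + 1) _ (lk k).v_lt
  have h2 := (lk k).visit (ω (k + 1))
  rw [zit_add, hr] at h1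
  linarith [dist_triangle (zit S.toEquiv ((lk k).v + -p (k + 1)) y)
    (zit S.toEquiv (lk k).v ((s (k + 1)).z (ω (k + 1)))) (pt k)]

end Tower

section Embedding

variable {X : Type*} [MeasurableSpace X] {Y : Type*} [MetricSpace Y] [CompactSpace Y]
variable [MeasurableSpace Y] [BorelSpace Y] {S : Y ≃ₜ Y}
variable {B : BaseCode S.toEquiv} {T : X ≃ᵐ X} {μ : Measure X} [IsProbabilityMeasure μ] {h : ℝ}
variable {s : ℕ → Stage B T μ h} {ρ : ℕ → ℝ} {α : ℕ → Type} {P : ∀ k, X → α k} {pt : ℕ → Y}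

theorem exists_embedding_of_tower (lk : ∀ k, Link (s k) (s (k + 1)) (ρ k) (P k) (pt k))
    (hT : MeasurePreserving T μ μ) (hr : ∀ k, (s (k + 1)).r = (s k).r / 2)
    (hsum : Summable fun k => μ.real (lk k).Bd)
    (hP : ∀ x x', (∀ᶠ k in atTop, P k x = P k x') → x = x')
    (hpt : ∀ q : Y, ∀ ε : ℝ, 0 < ε → ∃ᶠ k in atTop, dist (pt k) q < ε) :
    ∃ Ψ : X → Y, IsMeasEmbedding μ T S Ψ ∧ FullSupport (μ.map Ψ) := by
  classical
  set y₀ : Y := pt 0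
  set E : Set X := {x | ∀ᶠ k in atTop, x ∉ (lk k).Bd} with hE
  have hEm : MeasurableSet E := by
    have : E = ⋃ K, ⋂ k, ⋂ (_ : K ≤ k), ((lk k).Bd)ᶜ := by
      ext x; simp [hE, eventually_atTop]
    rw [this]
    exact .iUnion fun K => .iInter fun k => .iInter fun _ => (lk k).Bd_meas.compl
  have hEae : ∀ᵐ x ∂μ, x ∈ E := by
    refine ae_eventually_notMem ?_
    have h1 : ∀ k, μ (lk k).Bd = ENNReal.ofReal (μ.real (lk k).Bd) := fun k =>
      (ofReal_measureReal).symm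
    simp_rw [h1]
    exact hsum.tsum_ofReal_ne_top
  have henc : ∀ x ∈ E, ∃ y : Y, Tendsto (fun k => (s k).approx y₀ x) atTop (nhds y) ∧
      ∀ᶠ K in atTop, ∃ p ω, Encodes (fun k => lk (K + k)) y₀ x y p ω := by
    intro x hx
    obtain ⟨K₀, hK₀⟩ := eventually_atTop.1 hx
    have h1 : ∀ K ≥ K₀, ∃ y p ω, Encodes (fun k => lk (K + k)) y₀ x y p ω := fun K hK =>
      exists_encodes (fun k => lk (K + k)) (fun k => hr (K + k)) y₀ fun k => hK₀ _ (by omega)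
    have hshift : ∀ K y, Tendsto (fun k => (s (K + k)).approx y₀ x) atTop (nhds y) →
        Tendsto (fun k => (s k).approx y₀ x) atTop (nhds y) := fun K y hy => by
      refine (tendsto_add_atTop_iff_nat K).1 (hy.congr fun k => ?_)
      rw [add_comm]
    obtain ⟨y, p, ω, hy⟩ := h1 K₀ le_rfl
    have hy' := hshift _ _ hy.tendsto
    refine ⟨y, hy', eventually_atTop.2 ⟨K₀, fun K hK => ?_⟩⟩
    obtain ⟨y₁, p₁, ω₁, hy₁⟩ := h1 K hK
    obtain rfl := tendsto_nhds_unique (hshift _ _ hy₁.tendsto) hy'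
    exact ⟨p₁, ω₁, hy₁⟩
  choose ψ hψ hψe using henc
  set Ψ : X → Y := fun x => if hx : x ∈ E then ψ x hx else y₀ with hΨ
  have hΨE : ∀ x (hx : x ∈ E), Ψ x = ψ x hx := fun x hx => dif_pos hx
  have hΨe : ∀ x ∈ E, ∀ᶠ K in atTop, ∃ p ω, Encodes (fun k => lk (K + k)) y₀ x (Ψ x) p ω := by
    intro x hx; rw [hΨE x hx]; exact hψe x hx
  have hΨm : Measurable Ψ := by
    refine measurable_of_tendsto_metrizable (f := fun k x => if x ∈ E then (s k).approx y₀ x else y₀)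
      (fun k => Measurable.ite hEm ((s k).isObs_approx y₀).measurable measurable_const) ?_
    refine tendsto_pi_nhds.2 fun x => ?_
    by_cases hx : x ∈ E
    · simpa [hx, hΨE x hx] using hψ x hx
    · simp [hx, hΨ]
  have heq : ∀ x ∈ E, T x ∈ E → Ψ (T x) = S (Ψ x) := by
    intro x hx hTx
    obtain ⟨K, ⟨p, ω, h1⟩, ⟨p', ω', h2⟩⟩ := ((hΨe x hx).and (hΨe _ hTx)).exists
    exact h1.map_eq h2
  refine ⟨Ψ, ⟨hΨm, E ∩ T ⁻¹' E, hEm.inter (T.measurable hEm), ?_, ?_, fun x hx => heq x hx.1 hx.2⟩, ?_⟩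
  · have := hEae.and (hT.quasiMeasurePreserving.ae hEae)
    exact this
  · intro x hx x' hx' hxx
    refine hP x x' ?_
    filter_upwards [hΨe x hx.1, hΨe x' hx'.1] with K ⟨p, ω, h1⟩ ⟨p', ω', h2⟩
    rw [← hxx] at h2
    exact h1.obs_eq h2 0
  · intro U hU ⟨q, hq⟩
    rw [Measure.map_apply hΨm hU.measurableSet, pos_iff_ne_zero]
    intro h0
    have hz : ∀ᵐ x ∂μ, ∀ t : ℤ, zit T.toEquiv t x ∈ E ∧ zit T.toEquiv t x ∉ Ψ ⁻¹' U :=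
      ae_all_iff.2 fun t => (measurePreserving_zit T hT t).quasiMeasurePreserving.ae
        (hEae.and (measure_eq_zero_iff_ae_notMem.1 h0))
    obtain ⟨x, hx⟩ := hz.exists
    have hzit : ∀ t : ℤ, Ψ (zit T.toEquiv t x) = zit S.toEquiv t (Ψ x) := by
      have hs : ∀ t : ℤ, Ψ (zit T.toEquiv (t + 1) x) = S (Ψ (zit T.toEquiv t x)) := by
        intro t
        have h1 := apply_zit T.toEquiv t x
        have h2 := heq _ (hx t).1 (by
          change T.toEquiv _ ∈ E
          rw [h1]; exact (hx _).1)
        rw [← h2, ← h1]; rfl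
      intro t
      induction t using Int.induction_on with
      | zero => simp
      | succ i ih => rw [hs, ih]; exact apply_zit S.toEquiv i _
      | pred i ih =>
        have h1 := hs (-i - 1)
        rw [sub_add_cancel, ih] at h1
        apply S.injective
        rw [← h1]
        have h2 := apply_zit S.toEquiv (-i - 1) (Ψ x)
        rw [sub_add_cancel] at h2
        exact h2.symm
    obtain ⟨ε, hε, hball⟩ := Metric.isOpen_iff.1 hU q hq
    have hr0 : Tendsto (fun k => (s k).r) atTop (nhds 0) := by
      have h1 : ∀ k, (s k).r = (s 0).r * (1 / 2) ^ k := by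
        intro k
        induction k with
        | zero => simp
        | succ k ih => rw [hr, ih, pow_succ]; ring
      refine Tendsto.congr (fun k => (h1 k).symm) ?_
      simpa using (tendsto_pow_atTop_nhds_zero_of_lt_one (r := (1 / 2 : ℝ)) (by norm_num)
        (by norm_num)).const_mul (s 0).r
    obtain ⟨K, hKpt, ⟨p, ω, hK⟩, hKr⟩ := ((hpt q (ε / 2) (by positivity)).and_eventually
      ((hΨe x (by simpa using (hx 0).1)).and (hr0.eventually_lt_const (half_pos hε)))).exists
    obtain ⟨t, ht⟩ := hK.visit (fun k => hr (K + k)) 0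
    refine (hx t).2 (hball ?_)
    rw [hzit, Metric.mem_ball]
    simp only [add_zero] at ht
    linarith [dist_triangle (zit S.toEquiv t (Ψ x)) (pt K) q]

end Embedding

section Parameters

variable {X : Type*} [MeasurableSpace X] {μ : Measure X} [IsProbabilityMeasure μ] {T : X → X}

lemma exists_chain {A : Type*} (p : ℕ → A → Prop) (R : ℕ → A → A → Prop) (h0 : ∃ a, p 0 a)
    (hs : ∀ k a, p k a → ∃ b, p (k + 1) b ∧ R k a b) :
    ∃ s : ℕ → A, ∀ k, p k (s k) ∧ R k (s k) (s (k + 1)) := by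
  obtain ⟨a₀, ha₀⟩ := h0
  choose f hf hR using hs
  let g : ∀ k, {a // p k a} := fun k => Nat.rec ⟨a₀, ha₀⟩ (fun k a => ⟨f k a a.2, hf k a a.2⟩) k
  exact ⟨fun k => (g k).1, fun k => ⟨(g k).2, hR k _ (g k).2⟩⟩

lemma entropyWrt_le_of_factor {α β : Type*} [Fintype α] [Fintype β] (hT : MeasurePreserving T μ μ)
    {P : X → α} {Q : X → β} (hQ : IsObs Q) (h : ∀ x y, Q x = Q y → P x = P y) :
    entropyWrt μ T P ≤ entropyWrt μ T Q := by
  refine liminf_le_liminf (Eventually.of_forall fun n => ?_) ?_ ?_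
  · refine div_le_div_of_nonneg_right ?_ (by positivity)
    refine infoEntropy_le_of_factor (hQ.name hT.measurable n) fun x y hxy => ?_
    funext i
    exact h _ _ (congrFun hxy i)
  · exact isBoundedUnder_of ⟨0, fun n => div_nonneg (infoEntropy_nonneg _) (by positivity)⟩
  · refine IsBoundedUnder.isCoboundedUnder_ge (isBoundedUnder_of ⟨infoEntropy μ Q, fun n => ?_⟩)
    exact infoEntropy_name_div_le hT hQ n

lemma entropyWrt_le_ksEntropy (hT : MeasurePreserving T μ μ) (hfin : ksEntropy μ T ≠ ⊤)
    {α : Type*} [Fintype α] {P : X → α} (hP : IsObs P) :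
    entropyWrt μ T P ≤ (ksEntropy μ T).toReal := by
  classical
  have h1 : entropyWrt μ T P ≤ entropyWrt μ T (fun x => Fintype.equivFin α (P x)) :=
    entropyWrt_le_of_factor hT (hP.comp _) fun x y h => (Fintype.equivFin α).injective h
  refine h1.trans ((ENNReal.ofReal_le_iff_le_toReal hfin).1 ?_)
  exact le_iSup_of_le _ (le_iSup_of_le _ (le_iSup_of_le (hP.comp _).measurable le_rfl))

lemma exists_lt_entropyWrt (hT : MeasurePreserving T μ μ) (hfin : ksEntropy μ T ≠ ⊤) {γ : ℝ}
    (hγ : 0 < γ) : ∃ (k : ℕ) (P : X → Fin k), IsObs P ∧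
      (ksEntropy μ T).toReal - γ < entropyWrt μ T P := by
  rcases eq_or_ne (ksEntropy μ T) 0 with h0 | h0
  · have hP : IsObs (fun _ : X => (0 : Fin 1)) := fun s => .const _
    refine ⟨1, _, hP, ?_⟩
    rw [h0, ENNReal.toReal_zero, zero_sub]
    refine (neg_lt_zero.2 hγ).trans_le ?_
    refine le_liminf_of_le ?_ (Eventually.of_forall fun n =>
      div_nonneg (infoEntropy_nonneg _) (by positivity))
    refine IsBoundedUnder.isCoboundedUnder_ge (isBoundedUnder_of
      ⟨infoEntropy μ fun _ : X => (0 : Fin 1), fun n => ?_⟩)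
    exact infoEntropy_name_div_le hT hP n
  · have h1 : ENNReal.ofReal (max ((ksEntropy μ T).toReal - γ) 0) < ksEntropy μ T := by
      rw [ENNReal.ofReal_lt_iff_lt_toReal (le_max_right _ _) hfin]
      exact max_lt (by linarith) (ENNReal.toReal_pos h0 hfin)
    obtain ⟨k, hk⟩ := lt_iSup_iff.1 h1
    obtain ⟨P, hk⟩ := lt_iSup_iff.1 hk
    obtain ⟨hP, hk⟩ := lt_iSup_iff.1 hk
    exact ⟨k, P, fun s => hP .of_discrete,
      (le_max_left _ _).trans_lt (ENNReal.ofReal_lt_ofReal_iff'.1 hk).1⟩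

end Parameters

section Main

variable {X : Type*} [MeasurableSpace X] [StandardBorelSpace X] {μ : Measure X}
variable [IsProbabilityMeasure μ] [NullSingletonClass μ] {T : X ≃ᵐ X}
variable {Y : Type*} [MetricSpace Y] [CompactSpace Y] {S : Y ≃ₜ Y} {h : ℝ}

/-- A tower of stages of summably small defects. -/
theorem exists_tower (hspec : AlmostWeakSpec S.toEquiv) (hT : Ergodic T μ) (hh : 0 ≤ h)
    (hks : ∀ (α : Type) [Fintype α] (P : X → α), IsObs P → entropyWrt μ T P ≤ h)
    (hlt : ∀ γ : ℝ, 0 < γ → ∃ (k : ℕ) (P : X → Fin k), IsObs P ∧ h - γ < entropyWrt μ T P)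
    (B : BaseCode S.toEquiv) (hB : h < B.rate) {f : X → ℕ → Bool}
    (hf : ∀ i, IsObs (fun x => f x i)) (pt : ℕ → Y) :
    ∃ (s : ℕ → Stage B T μ h) (ρ : ℕ → ℝ) (N : ℕ → ℕ) (P : ∀ k, X → (Fin k → Bool) × Fin (N k))
      (lk : ∀ k, Link (s k) (s (k + 1)) (ρ k) (P k) (pt k)),
      (∀ k, (s (k + 1)).r = (s k).r / 2) ∧ (Summable fun k => μ.real (lk k).Bd) ∧
      ∀ k x i, (P k x).1 i = f x i := by
  have hd : 0 < B.rate - h := sub_pos.2 hB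
  set g : ℕ → ℝ := fun k => (1 / 2) ^ k * ((B.rate - h) / 4) with hg
  have hg0 : ∀ k, 0 < g k := fun k => by positivity
  choose N P₀ hP₀ hP₀' using fun k => hlt (g (k + 1) / 4) (by have := hg0 (k + 1); positivity)
  set P : ∀ k, X → (Fin k → Bool) × Fin (N k) := fun k x => (fun i => f x i, P₀ k x) with hPd
  have hP : ∀ k, IsObs (P k) := fun k => (isObs_pi fun i : Fin k => hf i).pair (hP₀ k)
  have hPe : ∀ k, h - g (k + 1) / 4 < entropyWrt μ T (P k) := fun k =>
    (hP₀' k).trans_le (entropyWrt_le_of_factor hT.toMeasurePreserving (hP k)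
      fun x y hxy => congrArg Prod.snd hxy)
  set ρ : ℕ → ℝ := fun k => if k = 0 then 1 - (B.rate - h) / (2 * (1 + B.rate)) else (1 / 2) ^ k
    with hρ
  have hρ01 : ∀ k, 0 < ρ k ∧ ρ k < 1 := by
    intro k
    rcases eq_or_ne k 0 with rfl | hk
    · simp only [hρ, if_true]
      constructor
      · rw [sub_pos, div_lt_one (by linarith)]; linarith
      · have : 0 < (B.rate - h) / (2 * (1 + B.rate)) := div_pos hd (by linarith)
        linarith
    · simp only [hρ, hk, if_false]
      exact ⟨by positivity, pow_lt_one₀ (by norm_num) (by norm_num) hk⟩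
  obtain ⟨s, hs⟩ := exists_chain
    (fun k (s : Stage B T μ h) => ρ k * h + (1 - ρ k) * (s.γ + s.κ) < ρ k * B.rate ∧
      (0 < k → s.unc = (1 / 2) ^ k))
    (fun k s s' => s'.r = s.r / 2 ∧ Nonempty (Link s s' (ρ k) (P k) (pt k))) (by
      obtain ⟨s, -, hγ, hκ⟩ := Stage.exists_initial (T := T) (μ := μ) hspec hT hh B
      refine ⟨s, ?_, by simp⟩
      have h1 : (B.rate - h) / (2 * (1 + B.rate)) * (1 + B.rate) = (B.rate - h) / 2 := by
        have : 1 + B.rate ≠ 0 := by linarith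
        field_simp
      simp only [hρ, if_true, hγ, hκ]
      nlinarith) (by
      rintro k s ⟨hcap, -⟩
      obtain ⟨s', hr, hγ, hκ, hunc, hlk⟩ := s.exists_next hspec hT hh hks (hρ01 k).1 (hρ01 k).2 hcap
        (hP k) (hg0 (k + 1)) (hg0 (k + 1)) (η' := (1 / 2) ^ (k + 1)) (by positivity) (hPe k) (pt k)
      refine ⟨s', ⟨?_, fun _ => hunc⟩, hr, hlk⟩
      have h1 := (hρ01 (k + 1)).1
      have h2 : g (k + 1) = ρ (k + 1) * ((B.rate - h) / 4) := by simp [hg, hρ]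
      rw [hγ, hκ]
      nlinarith [hg0 (k + 1), mul_pos h1 (hg0 (k + 1)), mul_pos h1 hd])
  have lk := fun k => (hs k).2.2.some
  refine ⟨s, ρ, N, P, lk, fun k => (hs k).2.1, ?_, fun k x i => rfl⟩
  refine Summable.of_nonneg_of_le (fun k => measureReal_nonneg) (fun k => ?_)
    ((summable_geometric_of_lt_one (r := (1 / 2 : ℝ)) (by norm_num) (by norm_num)).mul_left 3)
  rcases eq_or_ne k 0 with rfl | hk
  · exact measureReal_le_one.trans (by norm_num)
  · have h1 := (lk k).Bd_le
    rw [(hs k).1.2 (by omega), (hs (k + 1)).1.2 (by omega), pow_succ] at h1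
    have h2 : ρ k = (1 / 2) ^ k := by simp [hρ, hk]
    have h3 : (0 : ℝ) < (1 / 2) ^ k := by positivity
    linarith

end Main

theorem fullyUniversal_of_almostWeakSpec {Y : Type*} [MetricSpace Y] [CompactSpace Y]
    [MeasurableSpace Y] [BorelSpace Y] (S : Y ≃ₜ Y) (hspec : AlmostWeakSpec S.toEquiv) :
    FullyUniversal (⇑S) := by
  intro X _ μ T _ _ hμ hT hlt
  have : NullSingletonClass μ := hμ
  have hfin : ksEntropy μ T ≠ ⊤ := by
    intro h0
    rw [h0] at hlt
    simp at hlt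
  have hlt' : (((ksEntropy μ T).toReal : ℝ) : EReal) < topEntropy S := by
    rwa [← EReal.coe_ennreal_toReal hfin] at hlt
  obtain ⟨B, hB⟩ := exists_baseCode S hspec ENNReal.toReal_nonneg hlt'
  obtain ⟨f, hinj, hf⟩ := exists_bits X
  have : Nonempty Y := ⟨B.w none⟩
  set pt : ℕ → Y := fun k => TopologicalSpace.denseSeq Y (Nat.unpair k).1
  obtain ⟨s, ρ, N, P, lk, hr, hsum, hP⟩ := exists_tower hspec hT ENNReal.toReal_nonneg
    (fun α _ P hP => entropyWrt_le_ksEntropy hT.toMeasurePreserving hfin hP)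
    (fun γ hγ => exists_lt_entropyWrt hT.toMeasurePreserving hfin hγ) B hB hf pt
  refine exists_embedding_of_tower lk hT.toMeasurePreserving hr hsum (fun x x' hx => ?_) ?_
  · refine hinj (funext fun i => ?_)
    obtain ⟨k, hk, hik⟩ := (hx.and (eventually_gt_atTop i)).exists
    rw [← hP k x ⟨i, hik⟩, ← hP k x' ⟨i, hik⟩, hk]
  · intro q ε hε
    obtain ⟨n, hn⟩ := (TopologicalSpace.denseRange_denseSeq Y).exists_dist_lt q hε
    refine frequently_atTop.2 fun K => ⟨Nat.pair n K, Nat.right_le_pair n K, ?_⟩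
    simpa [pt, dist_comm] using hn

end Universality

/-- **Main theorem.**  A self-homeomorphism of a compact metric space satisfying almost weak
specification, asymptotic entropy expansiveness and the small boundary property is fully
universal. -/
theorem fullyUniversal_of_awsSpec_asympEntExp_smallBoundary
    {Y : Type*} [MetricSpace Y] [CompactSpace Y] [MeasurableSpace Y] [BorelSpace Y]
    (S : Y ≃ₜ Y) (hspec : AlmostWeakSpec S.toEquiv)
    (hexp : AsympEntropyExpansive (⇑S)) (hsb : SmallBoundaryProperty (⇑S)) :
    FullyUniversal (⇑S) := by
  exact Universality.fullyUniversal_of_almostWeakSpec S hspec
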